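/- Let G be a nonplanar graph with no minor isomorphic to any of K5+, K33+, K5h, K33h, K5⊕e, K33⊕e. Then the graph G* obtained from G by deleting all isolated vertices is obtained from some 3-connected almost-planar graph H by repeatedly subdividing edges, all of which belong to D(H). -/

import Mathlib

open SimpleGraph

/-- `H` is a minor of `G` (branch-set / model definition). -/
def IsMinor {W V : Type*} (H : SimpleGraph W) (G : SimpleGraph V) : Prop :=
  ∃ B : W → Set V,
    (∀ w, (B w).Nonempty) ∧
    (∀ w, (G.induce (B w)).Connected) ∧
    (Pairwise fun w₁ w₂ => Disjoint (B w₁) (B w₂)) ∧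
    (∀ ⦃w₁ w₂ : W⦄, H.Adj w₁ w₂ → ∃ v₁ ∈ B w₁, ∃ v₂ ∈ B w₂, G.Adj v₁ v₂)

def K5 : SimpleGraph (Fin 5) := ⊤

def K33 : SimpleGraph (Fin 3 ⊕ Fin 3) := completeBipartiteGraph (Fin 3) (Fin 3)

/-- A graph is planar iff it has neither a `K₅` nor a `K₃,₃` minor (Wagner's theorem). -/
def Planar {V : Type*} (G : SimpleGraph V) : Prop := ¬ IsMinor K5 G ∧ ¬ IsMinor K33 G

/-- `G / uw`: contract the edge `uw`, merging `w` into `u` (the vertex `w` becomes isolated). -/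
def contractEdge {V : Type*} (G : SimpleGraph V) (u w : V) : SimpleGraph V :=
  SimpleGraph.fromRel fun a b =>
    a ≠ w ∧ b ≠ w ∧ (G.Adj a b ∨ (a = u ∧ G.Adj w b) ∨ (b = u ∧ G.Adj a w))

/-- A nonplanar graph is almost-planar if for every edge, deletion or contraction is planar. -/
def AlmostPlanar {V : Type*} (G : SimpleGraph V) : Prop :=
  ¬ Planar G ∧ ∀ ⦃u v : V⦄, G.Adj u v →
    (Planar (G.deleteEdges {s(u, v)}) ∨ Planar (contractEdge G u v))

/-- `G` is `k`-connected: more than `k` vertices and deleting fewer than `k` vertices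
leaves a connected graph. -/
def KConnected {V : Type*} (G : SimpleGraph V) (k : ℕ) : Prop :=
  k < Nat.card V ∧ ∀ s : Set V, s.ncard < k → (G.induce (sᶜ)).Connected

/-- `{G[A], G[B]}` is a `k`-separation of `G`. -/
def IsSep {V : Type*} (G : SimpleGraph V) (k : ℕ) (A B : Set V) : Prop :=
  A ∪ B = Set.univ ∧ A ≠ Set.univ ∧ B ≠ Set.univ ∧ (A ∩ B).ncard = k ∧
  ∀ ⦃x y : V⦄, G.Adj x y → (x ∈ A ∧ y ∈ A) ∨ (x ∈ B ∧ y ∈ B)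

/-- The star `K_{1,3}`, with centre `0`. -/
def K13 : SimpleGraph (Fin 4) := SimpleGraph.fromRel fun a _ => a = 0

def InternallyFourConnected {V : Type*} (G : SimpleGraph V) : Prop :=
  KConnected G 3 ∧ 5 ≤ Nat.card V ∧
  ∀ A B : Set V, IsSep G 3 A B →
    Xor' (Nonempty (G.induce A ≃g K13)) (Nonempty (G.induce B ≃g K13))

/-- The wheel `W_n`: a cycle of length `n` plus a hub (`none`) joined to all of it. -/
def wheelGraph (n : ℕ) : SimpleGraph (Option (Fin n)) :=
  SimpleGraph.fromRel fun a b =>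
    match a, b with
    | some i, some j => j.val = (i.val + 1) % n
    | none, some _ => True
    | _, _ => False

def IsWheel {V : Type*} (G : SimpleGraph V) : Prop :=
  ∃ n, 3 ≤ n ∧ Nonempty (G ≃g wheelGraph n)

/-- The double wheel `DW_n`: a cycle of length `n` plus two adjacent hubs joined to all of it. -/
def doubleWheel (n : ℕ) : SimpleGraph (Fin n ⊕ Fin 2) :=
  SimpleGraph.fromRel fun a b =>
    match a, b with
    | .inl i, .inl j => j.val = (i.val + 1) % n
    | .inl _, .inr _ => True
    | .inr _, .inr _ => True
    | _, _ => False

/-- The Möbius ladder `M_n`: a cycle of length `2n` plus all "opposite" chords. -/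
def mobiusLadder (n : ℕ) : SimpleGraph (Fin (2 * n)) :=
  SimpleGraph.fromRel fun i j =>
    j.val = (i.val + 1) % (2 * n) ∨ j.val = (i.val + n) % (2 * n)

/-- `C²_m`: a cycle of length `m` plus all chords between vertices at distance two. -/
def squareCycle (m : ℕ) : SimpleGraph (Fin m) :=
  SimpleGraph.fromRel fun i j =>
    j.val = (i.val + 1) % m ∨ j.val = (i.val + 2) % m

/-- The alternating double wheel `AW_{2n}`: a cycle of length `2n` plus two adjacent hubs,
each joined to alternating cycle vertices. -/
def altDoubleWheel (n : ℕ) : SimpleGraph (Fin (2 * n) ⊕ Fin 2) :=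
  SimpleGraph.fromRel fun a b =>
    match a, b with
    | .inl i, .inl j => j.val = (i.val + 1) % (2 * n)
    | .inl i, .inr k => i.val % 2 = k.val
    | .inr _, .inr _ => True
    | _, _ => False

/-- The class `𝒲`: three wheels glued along a common triangle `V₀`, with no other edges. -/
def InClassW {V : Type*} (G : SimpleGraph V) : Prop :=
  ∃ P : V → Fin 4,
    (P ⁻¹' {0}).ncard = 3 ∧
    (∀ x y : V, P x = 0 → P y = 0 → x ≠ y → G.Adj x y) ∧
    (∀ i : Fin 4, i ≠ 0 → IsWheel (G.induce {v | P v = 0 ∨ P v = i})) ∧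
    (∀ ⦃x y : V⦄, G.Adj x y → ∃ i : Fin 4, i ≠ 0 ∧ (P x = 0 ∨ P x = i) ∧ (P y = 0 ∨ P y = i))

/-- `EX₁`: `K₃,₃` plus a vertex joined to all of one colour class. -/
def EX1 : SimpleGraph (Option (Fin 3 ⊕ Fin 3)) :=
  SimpleGraph.fromRel fun a b =>
    match a, b with
    | some (.inl _), some (.inr _) => True
    | none, some (.inl _) => True
    | _, _ => False

/-- `EX₂`: `K₅` plus a vertex joined to three of its vertices. -/
def EX2 : SimpleGraph (Option (Fin 5)) :=
  SimpleGraph.fromRel fun a b =>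
    match a, b with
    | some i, some j => i ≠ j
    | none, some j => j.val < 3
    | _, _ => False

/-- `EX₈`: `K₃,₃` plus a vertex joined to two vertices of one class and one of the other. -/
def EX8 : SimpleGraph (Option (Fin 3 ⊕ Fin 3)) :=
  SimpleGraph.fromRel fun a b =>
    match a, b with
    | some (.inl _), some (.inr _) => True
    | none, some x => x = Sum.inl 0 ∨ x = Sum.inl 1 ∨ x = Sum.inr 0
    | _, _ => False

/-- `K₅ʰ`: subdivide the edges `01` and `02` of `K₅` and join the two subdivision vertices. -/
def K5h : SimpleGraph (Fin 5 ⊕ Fin 2) :=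
  SimpleGraph.fromRel fun a b =>
    match a, b with
    | .inl i, .inl j =>
        i ≠ j ∧ ¬(i = 0 ∧ j = 1) ∧ ¬(i = 1 ∧ j = 0) ∧ ¬(i = 0 ∧ j = 2) ∧ ¬(i = 2 ∧ j = 0)
    | .inl i, .inr k => (k = 0 ∧ (i = 0 ∨ i = 1)) ∨ (k = 1 ∧ (i = 0 ∨ i = 2))
    | .inr _, .inr _ => True
    | _, _ => False

/-- `K₃,₃ʰ`: subdivide two edges of `K₃,₃` at a common endpoint and join
the two subdivision vertices. -/
def K33h : SimpleGraph ((Fin 3 ⊕ Fin 3) ⊕ Fin 2) :=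
  SimpleGraph.fromRel fun a b =>
    match a, b with
    | .inl (.inl i), .inl (.inr j) => ¬(i = 0 ∧ (j = 0 ∨ j = 1))
    | .inl (.inr j), .inl (.inl i) => ¬(i = 0 ∧ (j = 0 ∨ j = 1))
    | .inl x, .inr k =>
        (k = 0 ∧ (x = Sum.inl 0 ∨ x = Sum.inr 0)) ∨ (k = 1 ∧ (x = Sum.inl 0 ∨ x = Sum.inr 1))
    | .inr _, .inr _ => True
    | _, _ => False

/-- `K₅⁺`: `K₅` plus a pendant vertex. -/
def K5plus : SimpleGraph (Option (Fin 5)) :=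
  SimpleGraph.fromRel fun a b =>
    match a, b with
    | some i, some j => i ≠ j
    | none, some j => j = 0
    | _, _ => False

/-- `K₃,₃⁺`: `K₃,₃` plus a pendant vertex. -/
def K33plus : SimpleGraph (Option (Fin 3 ⊕ Fin 3)) :=
  SimpleGraph.fromRel fun a b =>
    match a, b with
    | some (.inl _), some (.inr _) => True
    | none, some x => x = Sum.inl 0
    | _, _ => False

/-- `K₅ ⊕ e`: disjoint union of `K₅` and one edge. -/
def K5oplus : SimpleGraph (Fin 5 ⊕ Fin 2) :=
  SimpleGraph.fromRel fun a b =>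
    match a, b with
    | .inl i, .inl j => i ≠ j
    | .inr _, .inr _ => True
    | _, _ => False

/-- `K₃,₃ ⊕ e`: disjoint union of `K₃,₃` and one edge. -/
def K33oplus : SimpleGraph ((Fin 3 ⊕ Fin 3) ⊕ Fin 2) :=
  SimpleGraph.fromRel fun a b =>
    match a, b with
    | .inl (.inl _), .inl (.inr _) => True
    | .inr _, .inr _ => True
    | _, _ => False

/-- The triad addition of `H` at `x y z`: add a new vertex joined to `x`, `y`, `z`. -/
def triadAddition {U : Type*} (H : SimpleGraph U) (x y z : U) : SimpleGraph (Option U) :=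
  SimpleGraph.fromRel fun a b =>
    match a, b with
    | some u, some v => H.Adj u v
    | none, some u => u = x ∨ u = y ∨ u = z
    | _, _ => False

def IsTriadAdditionOf {V U : Type*} (G : SimpleGraph V) (H : SimpleGraph U) : Prop :=
  ∃ x y z : U, x ≠ y ∧ y ≠ z ∧ x ≠ z ∧ Nonempty (G ≃g triadAddition H x y z)

/-- `G` is obtained from `H` by subdividing (possibly repeatedly) edges of `H`,
all of which lie in `S`. -/
def IsSubdivisionWithin {V W : Type*} (G : SimpleGraph V) (H : SimpleGraph W)
    (S : Set (Sym2 W)) : Prop :=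
  ∃ (f : W ↪ V) (p : ∀ ⦃u v : W⦄, H.Adj u v → G.Walk (f u) (f v)),
    (∀ ⦃u v : W⦄ (h : H.Adj u v), (p h).IsPath) ∧
    (∀ ⦃u v : W⦄ (h : H.Adj u v), p h.symm = (p h).reverse) ∧
    (∀ ⦃u v : W⦄ (h : H.Adj u v), s(u, v) ∉ S → (p h).length = 1) ∧
    (∀ ⦃u v : W⦄ (h : H.Adj u v) (w : W), f w ∈ (p h).support → w = u ∨ w = v) ∧
    (∀ ⦃u v u' v' : W⦄ (h : H.Adj u v) (h' : H.Adj u' v'), s(u, v) ≠ s(u', v') →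
      ∀ x : V, x ∈ (p h).support → x ∈ (p h').support → x ∈ Set.range f) ∧
    (∀ x : V, x ∈ Set.range f ∨ ∃ (u v : W) (h : H.Adj u v), x ∈ (p h).support) ∧
    (∀ e ∈ G.edgeSet, ∃ (u v : W) (h : H.Adj u v), e ∈ (p h).edges)

/-- `G` is a subdivision of `H`. -/
def IsSubdivision {V W : Type*} (G : SimpleGraph V) (H : SimpleGraph W) : Prop :=
  IsSubdivisionWithin G H Set.univ

/-- `D(H)`: the set of edges of `H` whose deletion leaves a planar graph. -/
def Dset {U : Type*} (H : SimpleGraph U) : Set (Sym2 U) :=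
  {e | e ∈ H.edgeSet ∧ Planar (H.deleteEdges {e})}

/-- `G[A]` together with all edges between vertices of `T` (`T ⊆ A` intended). -/
def deltaGraph {V : Type*} (G : SimpleGraph V) (A T : Set V) : SimpleGraph A :=
  SimpleGraph.fromRel fun a b => G.Adj a.1 b.1 ∨ (a.1 ∈ T ∧ b.1 ∈ T)

/-- `G[A]^Y` for the separation `{G[A], G[B]}`: add a new vertex joined to `A ∩ B`. -/
def sepY {V : Type*} (G : SimpleGraph V) (A B : Set V) : SimpleGraph (Option A) :=
  SimpleGraph.fromRel fun x y =>
    match x, y with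
    | some a, some b => G.Adj a.1 b.1
    | none, some a => a.1 ∈ A ∩ B
    | _, _ => False

/-- `G₂` is obtained from `G` by adding isolated vertices. -/
def AddIsolated {V₂ V : Type*} (G₂ : SimpleGraph V₂) (G : SimpleGraph V) : Prop :=
  ∃ f : V ↪ V₂, (∀ a b : V, G₂.Adj (f a) (f b) ↔ G.Adj a b) ∧
    ∀ x : V₂, x ∉ Set.range f → ∀ y : V₂, ¬ G₂.Adj x y

/-- The set of non-isolated vertices of `G` (so `G* = G.induce (core G)`). -/
def core {V : Type*} (G : SimpleGraph V) : Set V := {v | ∃ w, G.Adj v w}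

/-- `G` is obtained from `G'` by 3-summing wheels onto distinct triangles of `G'`. -/
def SumWheelsOnto {V U : Type*} (G : SimpleGraph V) (G' : SimpleGraph U) : Prop :=
  ∃ (g : U ↪ V) (k : ℕ) (Wp : Fin k → Set V) (T : Fin k → Set U),
    (∀ i, (T i).ncard = 3) ∧
    (∀ i, ∀ x ∈ T i, ∀ y ∈ T i, x ≠ y → G'.Adj x y) ∧
    Function.Injective T ∧
    (∀ i, Disjoint (Wp i) (Set.range ⇑g)) ∧
    (Pairwise fun i j => Disjoint (Wp i) (Wp j)) ∧
    (Set.range ⇑g ∪ ⋃ i, Wp i) = Set.univ ∧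
    (∀ i, IsWheel (deltaGraph G (Wp i ∪ ⇑g '' T i) (⇑g '' T i))) ∧
    (∀ a b : U, G.Adj (g a) (g b) → G'.Adj a b) ∧
    (∀ a b : U, G'.Adj a b → (G.Adj (g a) (g b) ∨ ∃ i, a ∈ T i ∧ b ∈ T i)) ∧
    (∀ ⦃x y : V⦄, G.Adj x y → (x ∈ Set.range ⇑g ∧ y ∈ Set.range ⇑g) ∨
      ∃ i, x ∈ Wp i ∪ ⇑g '' T i ∧ y ∈ Wp i ∪ ⇑g '' T i) ∧
    (∀ i, ∀ x ∈ Wp i, ∀ ⦃y : V⦄, G.Adj x y → y ∈ Wp i ∪ ⇑g '' T i)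

/-- `H` has an edge whose deletion and contraction are both nonplanar. -/
def HasBadEdge {V : Type*} (H : SimpleGraph V) : Prop :=
  ∃ u v : V, H.Adj u v ∧ ¬ Planar (H.deleteEdges {s(u, v)}) ∧ ¬ Planar (contractEdge H u v)

open SimpleGraph

/-- connectivity of an induced subgraph -/
def Conn {V : Type*} (G : SimpleGraph V) (S : Set V) : Prop := (G.induce S).Connected

theorem conn_iff {V : Type*} {G : SimpleGraph V} {S : Set V} :
    Conn G S ↔ S.Nonempty ∧ ∀ A : Set V, A ⊆ S → A.Nonempty →
      (∀ a ∈ A, ∀ b ∈ S, G.Adj a b → b ∈ A) → S ⊆ A := by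
  constructor
  · intro h
    refine ⟨?_, ?_⟩
    · obtain ⟨x⟩ := h.nonempty
      exact ⟨x.1, x.2⟩
    · intro A hAS ⟨a, ha⟩ hcl y hy
      have hr := h.preconnected ⟨a, hAS ha⟩ ⟨y, hy⟩
      obtain ⟨w⟩ := hr
      have key : ∀ {p q : S} (w : (G.induce S).Walk p q), p.1 ∈ A → q.1 ∈ A := by
        intro p q w
        induction w with
        | nil => exact id
        | @cons u v w hadj _ ih =>
          intro hp
          exact ih (hcl _ hp _ v.2 hadj)
      exact key w ha
  · rintro ⟨⟨x0, hx0⟩, h⟩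
    haveI : Nonempty S := ⟨⟨x0, hx0⟩⟩
    refine SimpleGraph.Connected.mk ?_
    intro x y
    have := h {z | ∃ hz : z ∈ S, (G.induce S).Reachable x ⟨z, hz⟩} (by rintro z ⟨hz, _⟩; exact hz)
      ⟨x.1, x.2, Reachable.refl _⟩ (by
        rintro a ⟨ha, hra⟩ b hb hab
        refine ⟨hb, hra.trans (Adj.reachable ?_)⟩
        exact hab)
    obtain ⟨_, hr⟩ := this y.2
    exact hr

section
variable {V : Type*} {G : SimpleGraph V}

theorem Conn.nonempty {S : Set V} (h : Conn G S) : S.Nonempty := (conn_iff.1 h).1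

theorem Conn.closed {S A : Set V} (h : Conn G S) (hn : (A ∩ S).Nonempty)
    (hcl : ∀ a ∈ A, a ∈ S → ∀ b ∈ S, G.Adj a b → b ∈ A) : S ⊆ A := by
  have := (conn_iff.1 h).2 (A ∩ S) Set.inter_subset_right hn
    (fun a ha b hb hab => ⟨hcl a ha.1 ha.2 b hb hab, hb⟩)
  exact fun x hx => (this hx).1

theorem Conn.cut {S A : Set V} (h : Conn G S) (hn : (A ∩ S).Nonempty) (hn' : (S \ A).Nonempty) :
    ∃ a ∈ A, a ∈ S ∧ ∃ b ∈ S, b ∉ A ∧ G.Adj a b := by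
  by_contra hc
  push Not at hc
  obtain ⟨x, hx, hxA⟩ := hn'
  exact hxA (h.closed hn (fun a ha haS b hb hab => by
    by_contra hbA; exact hc a ha haS b hb hbA hab) hx)

theorem conn_singleton (x : V) : Conn G {x} := by
  rw [conn_iff]
  refine ⟨⟨x, rfl⟩, ?_⟩
  rintro A hA ⟨a, ha⟩ _ y hy
  have := hA ha
  simp only [Set.mem_singleton_iff] at this hy
  rw [hy, ← this]; exact ha

theorem Conn.union_inter {S T : Set V} (hS : Conn G S) (hT : Conn G T) (h : (S ∩ T).Nonempty) :
    Conn G (S ∪ T) := by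
  rw [conn_iff]
  refine ⟨h.mono (fun x hx => Or.inl hx.1), ?_⟩
  rintro A hA ⟨a, ha⟩ hcl
  obtain ⟨z, hzS, hzT⟩ := h
  have hz : z ∈ A := by
    rcases hA ha with h1 | h1
    · exact hS.closed ⟨a, ha, h1⟩ (fun a ha _ b hb hab => hcl a ha b (Or.inl hb) hab) hzS
    · exact hT.closed ⟨a, ha, h1⟩ (fun a ha _ b hb hab => hcl a ha b (Or.inr hb) hab) hzT
  rintro y (hy | hy)
  · exact hS.closed ⟨z, hz, hzS⟩ (fun a ha _ b hb hab => hcl a ha b (Or.inl hb) hab) hy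
  · exact hT.closed ⟨z, hz, hzT⟩ (fun a ha _ b hb hab => hcl a ha b (Or.inr hb) hab) hy

theorem conn_pair {x y : V} (h : G.Adj x y) : Conn G {x, y} := by
  rw [conn_iff]
  refine ⟨⟨x, Or.inl rfl⟩, ?_⟩
  rintro A hA ⟨a, ha⟩ hcl z hz
  have hxy : x ∈ A ∧ y ∈ A := by
    rcases hA ha with rfl | h1
    · exact ⟨ha, hcl _ ha y (Or.inr rfl) h⟩
    · obtain rfl : a = y := h1
      exact ⟨hcl _ ha x (Or.inl rfl) h.symm, ha⟩
  rcases hz with rfl | h1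
  · exact hxy.1
  · obtain rfl : z = y := h1
    exact hxy.2

theorem Conn.union_adj {S T : Set V} (hS : Conn G S) (hT : Conn G T) {x y : V}
    (hx : x ∈ S) (hy : y ∈ T) (h : G.Adj x y) : Conn G (S ∪ T) := by
  have h1 : Conn G (S ∪ {x, y}) := hS.union_inter (conn_pair h) ⟨x, hx, Or.inl rfl⟩
  have h2 := h1.union_inter hT ⟨y, Or.inr (Or.inr rfl), hy⟩
  convert h2 using 1
  ext z
  constructor
  · rintro (h | h)
    · exact Or.inl (Or.inl h)
    · exact Or.inr h
  · rintro ((h | rfl | h) | h)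
    · exact Or.inl h
    · exact Or.inl hx
    · exact Or.inr (by obtain rfl : z = y := h; exact hy)
    · exact Or.inr h

theorem Conn.mono {G' : SimpleGraph V} {S : Set V} (hle : ∀ x ∈ S, ∀ y ∈ S, G.Adj x y → G'.Adj x y)
    (h : Conn G S) : Conn G' S := by
  rw [conn_iff] at h ⊢
  refine ⟨h.1, fun A hA hn hcl => h.2 A hA hn ?_⟩
  intro a ha b hb hab
  exact hcl a ha b hb (hle a (hA ha) b hb hab)

theorem Conn.insert_adj {S : Set V} (hS : Conn G S) {x y : V}
    (hx : x ∈ S) (h : G.Adj x y) : Conn G (insert y S) := by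
  have := hS.union_adj (conn_singleton y) hx rfl h
  rwa [Set.union_comm] at this

/-- transfer along an injective map -/
theorem conn_image {W : Type*} {H : SimpleGraph W} (f : W → V) {S : Set W}
    (hf : ∀ x ∈ S, ∀ y ∈ S, H.Adj x y → G.Adj (f x) (f y)) (h : Conn H S) : Conn G (f '' S) := by
  rw [conn_iff] at h ⊢
  refine ⟨h.1.image f, fun A hA hn hcl => ?_⟩
  have := h.2 (S ∩ f ⁻¹' A) Set.inter_subset_left (by
    obtain ⟨a, ha⟩ := hn
    obtain ⟨w, hw, rfl⟩ := hA ha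
    exact ⟨w, hw, ha⟩) (fun a ha b hb hab => ⟨hb, hcl _ ha.2 _ ⟨b, hb, rfl⟩ (hf _ ha.1 _ hb hab)⟩)
  rintro _ ⟨w, hw, rfl⟩
  exact (this hw).2

end

/-- A model. -/
def IsModel {W V : Type*} (H : SimpleGraph W) (G : SimpleGraph V) (B : W → Set V) : Prop :=
  (∀ w, Conn G (B w)) ∧ (∀ w₁ w₂, w₁ ≠ w₂ → Disjoint (B w₁) (B w₂)) ∧
  (∀ w₁ w₂ : W, H.Adj w₁ w₂ → ∃ v₁ ∈ B w₁, ∃ v₂ ∈ B w₂, G.Adj v₁ v₂)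

theorem isMinor_iff {W V : Type*} {H : SimpleGraph W} {G : SimpleGraph V} :
    IsMinor H G ↔ ∃ B, IsModel H G B := by
  constructor
  · rintro ⟨B, _, h2, h3, h4⟩
    exact ⟨B, h2, fun _ _ h => h3 h, fun _ _ h => h4 h⟩
  · rintro ⟨B, h2, h3, h4⟩
    exact ⟨B, fun w => (h2 w).nonempty, h2, fun _ _ h => h3 _ _ h, fun _ _ h => h4 _ _ h⟩

theorem IsModel.minor {W V : Type*} {H : SimpleGraph W} {G : SimpleGraph V} {B : W → Set V}
    (h : IsModel H G B) : IsMinor H G := isMinor_iff.2 ⟨B, h⟩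

theorem conn_biUnion {W V : Type*} {H : SimpleGraph W} {G : SimpleGraph V} {B : W → Set V}
    (h : IsModel H G B) {C : Set W} (hC : Conn H C) : Conn G (⋃ w ∈ C, B w) := by
  rw [conn_iff]
  obtain ⟨w0, hw0⟩ := hC.nonempty
  obtain ⟨x0, hx0⟩ := (h.1 w0).nonempty
  refine ⟨⟨x0, Set.mem_biUnion hw0 hx0⟩, ?_⟩
  rintro A hA ⟨a, ha⟩ hcl
  have step : ∀ w ∈ C, (A ∩ B w).Nonempty → B w ⊆ A := fun w hw hn =>
    (h.1 w).closed hn (fun a ha _ b hb hab => hcl a ha b (Set.mem_biUnion hw hb) hab)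
  have : C ⊆ {w | B w ⊆ A} := by
    apply hC.closed
    · have := hA ha
      simp only [Set.mem_iUnion] at this
      obtain ⟨w, hw, haw⟩ := this
      exact ⟨w, step w hw ⟨a, ha, haw⟩, hw⟩
    · intro w hw _ w' hw' hadj
      obtain ⟨x, hx, y, hy, hxy⟩ := h.2.2 _ _ hadj
      have : y ∈ A := hcl x (hw hx) y (Set.mem_biUnion hw' hy) hxy
      exact step w' hw' ⟨y, this, hy⟩
  intro y hy
  simp only [Set.mem_iUnion] at hy
  obtain ⟨w, hw, hyw⟩ := hy
  exact this hw hyw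

theorem IsMinor.trans {U W V : Type*} {K : SimpleGraph U} {H : SimpleGraph W} {G : SimpleGraph V}
    (h1 : IsMinor K H) (h2 : IsMinor H G) : IsMinor K G := by
  obtain ⟨C, hC⟩ := isMinor_iff.1 h1
  obtain ⟨B, hB⟩ := isMinor_iff.1 h2
  refine isMinor_iff.2 ⟨fun k => ⋃ w ∈ C k, B w, fun k => conn_biUnion hB (hC.1 k), ?_, ?_⟩
  · intro k k' hk
    rw [Set.disjoint_left]
    intro x hx hx'
    simp only [Set.mem_iUnion] at hx hx'
    obtain ⟨w, hw, hxw⟩ := hx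
    obtain ⟨w', hw', hxw'⟩ := hx'
    by_cases hww : w = w'
    · subst hww
      exact Set.disjoint_left.1 (hC.2.1 k k' hk) hw hw'
    · exact Set.disjoint_left.1 (hB.2.1 w w' hww) hxw hxw'
  · intro k k' hk
    obtain ⟨w, hw, w', hw', hadj⟩ := hC.2.2 k k' hk
    obtain ⟨x, hx, y, hy, hxy⟩ := hB.2.2 w w' hadj
    exact ⟨x, Set.mem_biUnion hw hx, y, Set.mem_biUnion hw' hy, hxy⟩

theorem isMinor_of_injective {W V : Type*} {H : SimpleGraph W} {G : SimpleGraph V} (f : W → V)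
    (hf : Function.Injective f) (h : ∀ x y, H.Adj x y → G.Adj (f x) (f y)) : IsMinor H G := by
  refine isMinor_iff.2 ⟨fun w => {f w}, fun w => conn_singleton _, ?_, ?_⟩
  · intro a b hab
    rw [Set.disjoint_left]
    rintro x rfl h2
    exact hab (hf h2)
  · intro a b hab
    exact ⟨_, rfl, _, rfl, h a b hab⟩

theorem isMinor_of_le {V : Type*} {H G : SimpleGraph V} (h : H ≤ G) : IsMinor H G :=
  isMinor_of_injective id Function.injective_id (fun _ _ hab => h hab)

theorem isMinor_induce {V : Type*} (G : SimpleGraph V) (S : Set V) : IsMinor (G.induce S) G :=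
  isMinor_of_injective (fun x : S => x.1) Subtype.val_injective (fun _ _ h => h)

theorem Planar.of_minor {W V : Type*} {H : SimpleGraph W} {G : SimpleGraph V}
    (hG : Planar G) (h : IsMinor H G) : Planar H :=
  ⟨fun h' => hG.1 (h'.trans h), fun h' => hG.2 (h'.trans h)⟩

def HFree {V : Type*} (G : SimpleGraph V) : Prop :=
  ¬ IsMinor K5plus G ∧ ¬ IsMinor K33plus G ∧ ¬ IsMinor K5h G ∧ ¬ IsMinor K33h G ∧
      ¬ IsMinor K5oplus G ∧ ¬ IsMinor K33oplus G

theorem HFree.of_minor {W V : Type*} {H : SimpleGraph W} {G : SimpleGraph V}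
    (hG : HFree G) (h : IsMinor H G) : HFree H :=
  ⟨fun h' => hG.1 (h'.trans h), fun h' => hG.2.1 (h'.trans h), fun h' => hG.2.2.1 (h'.trans h),
   fun h' => hG.2.2.2.1 (h'.trans h), fun h' => hG.2.2.2.2.1 (h'.trans h),
   fun h' => hG.2.2.2.2.2 (h'.trans h)⟩

open SimpleGraph

theorem model_pendant5 {V : Type*} {G : SimpleGraph V} {B : Fin 5 → Set V} (hB : IsModel K5 G B)
    {z : V} (hz : ∀ i, z ∉ B i) {i0 : Fin 5} {b : V} (hb : b ∈ B i0) (h : G.Adj z b) :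
    IsMinor K5plus G := by
  let σ := Equiv.swap (0 : Fin 5) i0
  refine isMinor_iff.2 ⟨fun o => o.elim {z} (fun i => B (σ i)), ?_, ?_, ?_⟩
  · rintro (_ | i)
    · exact conn_singleton z
    · exact hB.1 _
  · rintro (_ | i) (_ | j) hij
    · exact absurd rfl hij
    · exact Set.disjoint_singleton_left.2 (hz _)
    · exact Set.disjoint_singleton_right.2 (hz _)
    · exact hB.2.1 _ _ (fun h => hij (by rw [σ.injective h]))
  · rintro (_ | i) (_ | j) hij
    · simp [K5plus] at hij
    · obtain rfl : j = 0 := by simpa [K5plus] using hij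
      exact ⟨z, rfl, b, by simpa [σ] using hb, h⟩
    · obtain rfl : i = 0 := by simpa [K5plus] using hij
      exact ⟨b, by simpa [σ] using hb, z, rfl, h.symm⟩
    · refine hB.2.2 _ _ ?_
      have : i ≠ j := by
        rintro rfl
        simp [K5plus] at hij
      simpa [K5] using this

theorem K33_adj_iff (x y : Fin 3 ⊕ Fin 3) : K33.Adj x y ↔ x.isLeft ≠ y.isLeft := by
  rcases x with x | x <;> rcases y with y | y <;> simp [K33]

theorem model_pendant33 {V : Type*} {G : SimpleGraph V} {B : Fin 3 ⊕ Fin 3 → Set V}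
    (hB : IsModel K33 G B)
    {z : V} (hz : ∀ i, z ∉ B i) {i0 : Fin 3 ⊕ Fin 3} {b : V} (hb : b ∈ B i0) (h : G.Adj z b) :
    IsMinor K33plus G := by
  obtain ⟨σ, hσ0, hσ⟩ : ∃ σ : (Fin 3 ⊕ Fin 3) ≃ (Fin 3 ⊕ Fin 3), σ (Sum.inl 0) = i0 ∧
      ∀ x y, K33.Adj x y → K33.Adj (σ x) (σ y) := by
    rcases i0 with i | i
    · refine ⟨Equiv.sumCongr (Equiv.swap 0 i) (Equiv.refl _), by simp, ?_⟩
      intro x y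
      simp only [K33_adj_iff]
      rcases x with x | x <;> rcases y with y | y <;> simp only [Equiv.trans_apply,
        Equiv.sumCongr_apply, Sum.map_inl, Sum.map_inr, Equiv.sumComm_apply, Sum.swap_inl,
        Sum.swap_inr] <;> simp
    · refine ⟨(Equiv.sumCongr (Equiv.swap 0 i) (Equiv.refl _)).trans (Equiv.sumComm _ _),
        by simp, ?_⟩
      intro x y
      simp only [K33_adj_iff]
      rcases x with x | x <;> rcases y with y | y <;> simp only [Equiv.trans_apply,
        Equiv.sumCongr_apply, Sum.map_inl, Sum.map_inr, Equiv.sumComm_apply, Sum.swap_inl,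
        Sum.swap_inr] <;> simp
  refine isMinor_iff.2 ⟨fun o => o.elim {z} (fun i => B (σ i)), ?_, ?_, ?_⟩
  · rintro (_ | i)
    · exact conn_singleton z
    · exact hB.1 _
  · rintro (_ | i) (_ | j) hij
    · exact absurd rfl hij
    · exact Set.disjoint_singleton_left.2 (hz _)
    · exact Set.disjoint_singleton_right.2 (hz _)
    · exact hB.2.1 _ _ (fun h => hij (by rw [σ.injective h]))
  · rintro (_ | i) (_ | j) hij
    · simp [K33plus] at hij
    · obtain rfl : j = Sum.inl 0 := by rcases j with j | j <;> simpa [K33plus] using hij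
      exact ⟨z, rfl, b, by simpa [hσ0] using hb, h⟩
    · obtain rfl : i = Sum.inl 0 := by rcases i with i | i <;> simpa [K33plus] using hij
      exact ⟨b, by simpa [hσ0] using hb, z, rfl, h.symm⟩
    · refine hB.2.2 _ _ (hσ _ _ ?_)
      rcases i with i | i <;> rcases j with j | j <;> simp_all [K33plus, K33]

theorem spanning5 {V : Type*} {G : SimpleGraph V} (hG : HFree G) {B : Fin 5 → Set V}
    (hB : IsModel K5 G B) {x y : V} (hxy : G.Adj x y) : ∃ i, x ∈ B i := by
  by_contra hx
  push Not at hx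
  by_cases hc : ∃ z, (∀ i, z ∉ B i) ∧ ∃ i, ∃ b ∈ B i, G.Adj z b
  · obtain ⟨z, hz, i, b, hb, h⟩ := hc
    exact hG.1 (model_pendant5 hB hz hb h)
  · push Not at hc
    have hy : ∀ i, y ∉ B i := fun i hi => hc x hx i y hi hxy
    apply hG.2.2.2.2.1
    refine isMinor_iff.2 ⟨Sum.elim B ![{x}, {y}], ?_, ?_, ?_⟩
    · rintro (i | i)
      · exact hB.1 i
      · fin_cases i
        · exact conn_singleton x
        · exact conn_singleton y
    · rintro (i | i) (j | j) hij
      · exact hB.2.1 _ _ (fun h => hij (by rw [h]))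
      · fin_cases j
        · exact Set.disjoint_singleton_right.2 (hx _)
        · exact Set.disjoint_singleton_right.2 (hy _)
      · fin_cases i
        · exact Set.disjoint_singleton_left.2 (hx _)
        · exact Set.disjoint_singleton_left.2 (hy _)
      · fin_cases i <;> fin_cases j <;> simp_all [hxy.ne, hxy.ne.symm]
    · rintro (i | i) (j | j) hij
      · refine hB.2.2 _ _ ?_
        have : i ≠ j := by
          rintro rfl
          simp [K5oplus] at hij
        simpa [K5] using this
      · simp [K5oplus] at hij
      · simp [K5oplus] at hij
      · fin_cases i <;> fin_cases j <;> simp_all [K5oplus, hxy.symm]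

theorem spanning33 {V : Type*} {G : SimpleGraph V} (hG : HFree G) {B : Fin 3 ⊕ Fin 3 → Set V}
    (hB : IsModel K33 G B) {x y : V} (hxy : G.Adj x y) : ∃ i, x ∈ B i := by
  by_contra hx
  push Not at hx
  by_cases hc : ∃ z, (∀ i, z ∉ B i) ∧ ∃ i, ∃ b ∈ B i, G.Adj z b
  · obtain ⟨z, hz, i, b, hb, h⟩ := hc
    exact hG.2.1 (model_pendant33 hB hz hb h)
  · push Not at hc
    have hy : ∀ i, y ∉ B i := fun i hi => hc x hx i y hi hxy
    apply hG.2.2.2.2.2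
    refine isMinor_iff.2 ⟨Sum.elim B ![{x}, {y}], ?_, ?_, ?_⟩
    · rintro (i | i)
      · exact hB.1 i
      · fin_cases i
        · exact conn_singleton x
        · exact conn_singleton y
    · rintro (i | i) (j | j) hij
      · exact hB.2.1 _ _ (fun h => hij (by rw [h]))
      · fin_cases j
        · exact Set.disjoint_singleton_right.2 (hx _)
        · exact Set.disjoint_singleton_right.2 (hy _)
      · fin_cases i
        · exact Set.disjoint_singleton_left.2 (hx _)
        · exact Set.disjoint_singleton_left.2 (hy _)
      · fin_cases i <;> fin_cases j <;> simp_all [hxy.ne, hxy.ne.symm]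
    · rintro (i | i) (j | j) hij
      · refine hB.2.2 _ _ ?_
        rcases i with i | i <;> rcases j with j | j <;> simp_all [K33oplus, K33]
      · rcases i with i | i <;> simp [K33oplus] at hij
      · rcases j with j | j <;> simp [K33oplus] at hij
      · fin_cases i <;> fin_cases j <;> simp_all [K33oplus, hxy.symm]

/-- For HFree graphs, deleting a non-isolated vertex gives a planar graph. -/
theorem planar_delete_vertex {V : Type*} {G : SimpleGraph V} (hG : HFree G) {x y : V}
    (hxy : G.Adj x y) : Planar (G.induce {x}ᶜ) := by
  constructor
  · intro h
    obtain ⟨B, hB⟩ := isMinor_iff.1 h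
    have : IsModel K5 G (fun i => Subtype.val '' (B i)) := by
      refine ⟨fun i => conn_image _ (fun _ _ _ _ h => h) (hB.1 i), fun i j hij => ?_, ?_⟩
      · exact Set.disjoint_image_of_injective Subtype.val_injective (hB.2.1 i j hij)
      · intro i j hij
        obtain ⟨a, ha, b, hb, hab⟩ := hB.2.2 i j hij
        exact ⟨a, ⟨a, ha, rfl⟩, b, ⟨b, hb, rfl⟩, hab⟩
    obtain ⟨i, z, hz, hzx⟩ := spanning5 hG this hxy
    exact z.2 hzx
  · intro h
    obtain ⟨B, hB⟩ := isMinor_iff.1 h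
    have : IsModel K33 G (fun i => Subtype.val '' (B i)) := by
      refine ⟨fun i => conn_image _ (fun _ _ _ _ h => h) (hB.1 i), fun i j hij => ?_, ?_⟩
      · exact Set.disjoint_image_of_injective Subtype.val_injective (hB.2.1 i j hij)
      · intro i j hij
        obtain ⟨a, ha, b, hb, hab⟩ := hB.2.2 i j hij
        exact ⟨a, ⟨a, ha, rfl⟩, b, ⟨b, hb, rfl⟩, hab⟩
    obtain ⟨i, z, hz, hzx⟩ := spanning33 hG this hxy
    exact z.2 hzx

open SimpleGraph

section crit
variable {V : Type*} {G : SimpleGraph V}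

/-- sum of a function over the darts of a walk -/
def wsum (φ : V → V → ZMod 2) : ∀ {x y : V}, G.Walk x y → ZMod 2
  | _, _, .nil => 0
  | _, _, @Walk.cons _ _ u v _ _ p => φ u v + wsum φ p

def dl (r : V → ℕ) (x y : V) : ZMod 2 := if r x < r y then 1 else 0

/-- certificate for planarity -/
def Cert (G : SimpleGraph V) (r : V → ℕ) (φ : V → V → V → ZMod 2) : Prop :=
  ∀ x y z w, G.Adj x y → G.Adj z w → x ≠ z → x ≠ w → y ≠ z → y ≠ w →
    dl r x z + dl r y z + dl r x w + dl r y w = φ x y z + φ x y w + φ z w x + φ z w y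

theorem cert_edge_walk {r : V → ℕ} {φ : V → V → V → ZMod 2} (h : Cert G r φ) {x y : V}
    (hxy : G.Adj x y) : ∀ {z w : V} (Q : G.Walk z w), x ∉ Q.support → y ∉ Q.support →
    dl r x z + dl r y z + dl r x w + dl r y w =
      φ x y z + φ x y w + wsum (fun a b => φ a b x) Q + wsum (fun a b => φ a b y) Q := by
  intro z w Q
  induction Q with
  | nil => 
    intro _ _
    simp only [wsum]
    grind
  | @cons u v w huv p ih =>
    intro hx hy
    simp only [Walk.support_cons, List.mem_cons, not_or] at hx hy
    have h1 := ih hx.2 hy.2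
    have hv : v ∈ p.support := p.start_mem_support
    have h2 := h x y u v hxy huv hx.1 (fun h => hx.2 (h ▸ hv)) hy.1 (fun h => hy.2 (h ▸ hv))
    simp only [wsum]
    grind

theorem cert_walk_walk {r : V → ℕ} {φ : V → V → V → ZMod 2} (h : Cert G r φ) {z w : V}
    (Q : G.Walk z w) :
    ∀ {x y : V} (P : G.Walk x y), (∀ v ∈ P.support, v ∉ Q.support) →
    dl r x z + dl r y z + dl r x w + dl r y w =
      wsum (fun a b => φ a b z) P + wsum (fun a b => φ a b w) P +
      wsum (fun a b => φ a b x) Q + wsum (fun a b => φ a b y) Q := by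
  intro x y P
  induction P with
  | nil =>
    intro _
    simp only [wsum]
    grind
  | @cons u v w huv p ih =>
    intro hd
    simp only [Walk.support_cons, List.mem_cons] at hd
    have h1 := ih (fun a ha => hd a (Or.inr ha))
    have h2 := cert_edge_walk h huv Q (hd u (Or.inl rfl)) (hd v (Or.inr p.start_mem_support))
    simp only [wsum]
    grind

theorem Conn.exists_walk {S : Set V} (h : Conn G S) {x y : V} (hx : x ∈ S) (hy : y ∈ S) :
    ∃ w : G.Walk x y, ∀ v ∈ w.support, v ∈ S := by
  have := h.closed (A := {z | ∃ w : G.Walk x z, ∀ v ∈ w.support, v ∈ S}) 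
    ⟨x, ⟨Walk.nil, by simpa using hx⟩, hx⟩ (by
      rintro a ⟨w, hw⟩ _ b hb hab
      refine ⟨w.concat hab, ?_⟩
      intro v hv
      rw [Walk.support_concat] at hv
      simp only [List.mem_append, List.mem_singleton] at hv
      rcases hv with hv | rfl
      · exact hw v hv
      · exact hb)
  exact this hy

/-- The certificate passes to minors. -/
theorem cert_minor {W : Type*} {H : SimpleGraph W} {r : V → ℕ} {φ : V → V → V → ZMod 2}
    (h : Cert G r φ) {B : W → Set V} (hB : IsModel H G B) (hr : Function.Injective r) :
    ∃ (r' : W → ℕ) (φ' : W → W → W → ZMod 2), Function.Injective r' ∧ Cert H r' φ' := by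
  choose c hc using fun w => (hB.1 w).nonempty
  have hw : ∀ i j, H.Adj i j → ∃ w : G.Walk (c i) (c j), ∀ v ∈ w.support, v ∈ B i ∪ B j := by
    intro i j hij
    obtain ⟨a, ha, b, hb, hab⟩ := hB.2.2 i j hij
    exact ((hB.1 i).union_adj (hB.1 j) ha hb hab).exists_walk (Or.inl (hc i)) (Or.inr (hc j))
  choose w hw using hw
  classical
  refine ⟨fun i => r (c i), fun i j k => if hij : H.Adj i j then
    wsum (fun a b => φ a b (c k)) (w i j hij) else 0, ?_, ?_⟩
  · intro i j hij
    by_contra hne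
    exact Set.disjoint_left.1 (hB.2.1 i j hne) (hc i) (hr hij ▸ hc j)
  · intro i j k l hij hkl hik hil hjk hjl
    have := cert_walk_walk h (w k l hkl) (w i j hij) (by
      intro v hv hv'
      rcases hw _ _ _ _ hv with h1 | h1 <;> rcases hw _ _ _ _ hv' with h2 | h2
      · exact Set.disjoint_left.1 (hB.2.1 _ _ hik) h1 h2
      · exact Set.disjoint_left.1 (hB.2.1 _ _ hil) h1 h2
      · exact Set.disjoint_left.1 (hB.2.1 _ _ hjk) h1 h2
      · exact Set.disjoint_left.1 (hB.2.1 _ _ hjl) h1 h2)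
    simp only [hij, hkl, dif_pos]
    exact this

theorem dl_swap {r : V → ℕ} (hr : Function.Injective r) {x y : V} (h : x ≠ y) :
    dl r x y = 1 + dl r y x := by
  have : r x ≠ r y := fun h' => h (hr h')
  unfold dl
  rcases lt_or_gt_of_ne this with h1 | h1
  · rw [if_pos h1, if_neg (by omega)]; rfl
  · rw [if_neg (by omega), if_pos h1]; rfl

theorem no_cert_K5 {r : Fin 5 → ℕ} (hr : Function.Injective r) {φ} (h : Cert K5 r φ) : False := by
  have e : ∀ a b c d : Fin 5, a ≠ b → c ≠ d → a ≠ c → a ≠ d → b ≠ c → b ≠ d → _ :=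
    fun a b c d h1 h2 => h a b c d (by simpa [K5] using h1) (by simpa [K5] using h2)
  have s : ∀ a b : Fin 5, a < b → dl r b a = 1 + dl r a b := fun a b hab => dl_swap hr hab.ne'
  have e1 := e 0 1 2 3; have e2 := e 0 2 1 3; have e3 := e 0 3 1 2
  have e4 := e 0 1 2 4; have e5 := e 0 2 1 4; have e6 := e 0 4 1 2
  have e7 := e 0 1 3 4; have e8 := e 0 3 1 4; have e9 := e 0 4 1 3
  have e10 := e 0 2 3 4; have e11 := e 0 3 2 4; have e12 := e 0 4 2 3
  have e13 := e 1 2 3 4; have e14 := e 1 3 2 4; have e15 := e 1 4 2 3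
  simp only [ne_eq, Fin.reduceEq, not_false_eq_true, forall_const] at e1 e2 e3 e4 e5 e6 e7 e8 e9 e10 e11 e12 e13 e14 e15
  rw [s 1 2 (by decide)] at e2 e5
  have s1 := s 1 2 (by decide)
  have s2 := s 1 3 (by decide)
  have s3 := s 2 3 (by decide)
  have s4 := s 1 4 (by decide)
  have s5 := s 2 4 (by decide)
  have s6 := s 3 4 (by decide)
  grind

theorem no_cert_K33 {r : Fin 3 ⊕ Fin 3 → ℕ} (hr : Function.Injective r) {φ} (h : Cert K33 r φ) :
    False := by
  have e : ∀ a c b d : Fin 3, a ≠ b → c ≠ d → _ :=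
    fun a c b d h1 h2 => h (.inl a) (.inr c) (.inl b) (.inr d) (by simp [K33]) (by simp [K33])
      (by simpa using h1) (by simp) (by simp) (by simpa using h2)
  have s : ∀ a b : Fin 3, dl r (.inr a) (.inl b) = 1 + dl r (.inl b) (.inr a) :=
    fun a b => dl_swap hr (by simp)
  have e1 := e 0 0 1 1; have e2 := e 0 0 1 2; have e3 := e 0 0 2 1; have e4 := e 0 0 2 2
  have e5 := e 0 1 1 0; have e6 := e 0 1 1 2; have e7 := e 0 1 2 0; have e8 := e 0 1 2 2
  have e9 := e 0 2 1 0; have e10 := e 0 2 1 1; have e11 := e 0 2 2 0; have e12 := e 0 2 2 1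
  have e13 := e 1 0 2 1; have e14 := e 1 0 2 2; have e15 := e 1 1 2 0; have e16 := e 1 1 2 2
  have e17 := e 1 2 2 0; have e18 := e 1 2 2 1
  have t : ∀ a b : Fin 3, a < b → dl r (.inr b) (.inr a) = 1 + dl r (.inr a) (.inr b) :=
    fun a b hab => dl_swap hr (by simpa using hab.ne')
  have t1 := t 0 1 (by decide)
  have t2 := t 0 2 (by decide)
  have t3 := t 1 2 (by decide)
  simp only [ne_eq, Fin.reduceEq, not_false_eq_true, forall_const, s] at *
  grind

theorem planar_of_cert {r : V → ℕ} (hr : Function.Injective r) {φ : V → V → V → ZMod 2}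
    (h : Cert G r φ) : Planar G := by
  constructor
  · intro hm
    obtain ⟨B, hB⟩ := isMinor_iff.1 hm
    obtain ⟨r', φ', h1, h2⟩ := cert_minor h hB hr
    exact no_cert_K5 h1 h2
  · intro hm
    obtain ⟨B, hB⟩ := isMinor_iff.1 hm
    obtain ⟨r', φ', h1, h2⟩ := cert_minor h hB hr
    exact no_cert_K33 h1 h2

end crit

open SimpleGraph

section deg2
variable {V : Type*} {G : SimpleGraph V}

theorem exists_component (S : Set V) {y : V} (hy : y ∈ S) : ∃ C ⊆ S, y ∈ C ∧ Conn G C ∧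
    ∀ c ∈ C, ∀ d ∈ S, G.Adj c d → d ∈ C := by
  refine ⟨{z | ∃ T ⊆ S, Conn G T ∧ y ∈ T ∧ z ∈ T}, ?_, ?_, ?_, ?_⟩
  · rintro z ⟨T, hT, _, _, hz⟩; exact hT hz
  · exact ⟨{y}, by simpa using hy, conn_singleton y, rfl, rfl⟩
  · rw [conn_iff]
    refine ⟨⟨y, {y}, by simpa using hy, conn_singleton y, rfl, rfl⟩, ?_⟩
    rintro A hA ⟨a, ha⟩ hcl
    have key : ∀ T ⊆ S, Conn G T → y ∈ T → (A ∩ T).Nonempty → T ⊆ A := by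
      intro T hT hc hyT hn
      exact hc.closed hn (fun a ha haT b hb hab => hcl a ha b ⟨T, hT, hc, hyT, hb⟩ hab)
    have hyA : y ∈ A := by
      obtain ⟨T, hT, hc, hyT, haT⟩ := hA ha
      exact key T hT hc hyT ⟨a, ha, haT⟩ hyT
    rintro z ⟨T, hT, hc, hyT, hzT⟩
    exact key T hT hc hyT ⟨y, hyA, hyT⟩ hzT
  · rintro c ⟨T, hT, hc, hyT, hcT⟩ d hd hcd
    exact ⟨insert d T, Set.insert_subset hd hT, hc.insert_adj hcT hcd, Or.inr hyT, Or.inl rfl⟩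

/-- rerouting a connected set -/
theorem conn_reroute {S D X : Set V} {a b : V} (hS : Conn G S) (hX : Conn G X)
    (hD : ∀ d ∈ D, ∀ v, G.Adj d v → v ∈ D ∨ v = a ∨ v = b)
    (haX : a ∈ S → a ∈ X) (hbX : b ∈ S → b ∈ X) (hSX : (S ∩ X).Nonempty) :
    Conn G ((S \ D) ∪ X) := by
  rw [conn_iff]
  obtain ⟨x0, hx0⟩ := hX.nonempty
  refine ⟨⟨x0, Or.inr hx0⟩, ?_⟩
  rintro A hA ⟨a0, ha0⟩ hcl
  by_cases hXA : (A ∩ X).Nonempty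
  · have hXsub : X ⊆ A := hX.closed hXA (fun p hp _ q hq hpq => hcl p hp q (Or.inr hq) hpq)
    have : S ⊆ A ∪ D := by
      obtain ⟨z, hz, hz'⟩ := hSX
      refine hS.closed ⟨z, Or.inl (hXsub hz'), hz⟩ ?_
      intro p hp hpS q hq hpq
      by_cases hqD : q ∈ D
      · exact Or.inr hqD
      · left
        rcases hp with hp | hp
        · exact hcl p hp q (Or.inl ⟨hq, hqD⟩) hpq
        · rcases hD p hp q hpq with h | rfl | rfl
          · exact absurd h hqD
          · exact hXsub (haX hq)
          · exact hXsub (hbX hq)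
    rintro y (hy | hy)
    · exact (this hy.1).resolve_right hy.2
    · exact hXsub hy
  · exfalso
    have hno : ∀ p ∈ A, p ∉ X := fun p hp hpX => hXA ⟨p, hp, hpX⟩
    have : S ⊆ A := by
      refine hS.closed ⟨a0, ha0, ?_⟩ ?_
      · rcases hA ha0 with h | h
        · exact h.1
        · exact absurd h (hno _ ha0)
      · intro p hp hpS q hq hpq
        refine hcl p hp q (Or.inl ⟨hq, ?_⟩) hpq
        intro hqD
        have hpD : p ∉ D := by
          rcases hA hp with h | h
          · exact h.2
          · exact absurd h (hno _ hp)
        rcases hD q hqD p hpq.symm with h | rfl | rfl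
        · exact hpD h
        · exact hno _ hp (haX hpS)
        · exact hno _ hp (hbX hpS)
    obtain ⟨z, hz, hz'⟩ := hSX
    exact hno z (this hz) hz'

theorem reroute_model {W : Type*} {K : SimpleGraph W} {B : W → Set V} (hB : IsModel K G B)
    (hspan : ∀ B, IsModel K G B → ∀ x, ∃ i, x ∈ B i)
    {D Q : Set V} {a b : V} (haD : a ∉ D) (hbD : b ∉ D)
    (hD : ∀ d ∈ D, ∀ v, G.Adj d v → v ∈ D ∨ v = a ∨ v = b)
    (hmiss : ∀ w, a ∉ B w → b ∉ B w → Disjoint (B w) D)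
    (hQ : Q ⊆ D) (hQa : Conn G (insert a Q)) (hQab : Conn G (insert b (insert a Q))) : D ⊆ Q := by
  classical
  obtain ⟨w0, hw0⟩ := hspan B hB a
  have hdis : ∀ {w w' z}, z ∈ B w → z ∈ B w' → w = w' := by
    intro w w' z h h'
    by_contra hne
    exact Set.disjoint_left.1 (hB.2.1 w w' hne) h h'
  have hM : IsModel K G (fun w => if w = w0 then (B w \ D) ∪ Q else B w \ D) := by
    refine ⟨?_, ?_, ?_⟩
    · intro w
      by_cases hw : w = w0
      · subst hw
        simp only [if_true]
        by_cases hb : b ∈ B w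
        · have := conn_reroute (hB.1 w) hQab hD (fun _ => Or.inr (Or.inl rfl)) (fun _ => Or.inl rfl)
            ⟨a, hw0, Or.inr (Or.inl rfl)⟩
          convert this using 1
          ext z
          simp only [Set.mem_union, Set.mem_sdiff, Set.mem_insert_iff]
          constructor
          · tauto
          · rintro (h | rfl | rfl | h)
            · exact Or.inl h
            · exact Or.inl ⟨hb, hbD⟩
            · exact Or.inl ⟨hw0, haD⟩
            · exact Or.inr h
        · have := conn_reroute (hB.1 w) hQa hD (fun _ => Or.inl rfl) (fun h => absurd h hb)
            ⟨a, hw0, (Or.inl rfl)⟩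
          convert this using 1
          ext z
          simp only [Set.mem_union, Set.mem_sdiff, Set.mem_insert_iff]
          constructor
          · tauto
          · rintro (h | rfl | h)
            · exact Or.inl h
            · exact Or.inl ⟨hw0, haD⟩
            · exact Or.inr h
      · simp only [if_neg hw]
        have ha : a ∉ B w := fun h => hw (hdis h hw0)
        by_cases hb : b ∈ B w
        · have := conn_reroute (hB.1 w) (conn_singleton b) hD (fun h => absurd h ha)
            (fun _ => rfl) ⟨b, hb, rfl⟩
          convert this using 1
          ext z
          simp only [Set.mem_union, Set.mem_sdiff, Set.mem_singleton_iff]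
          constructor
          · tauto
          · rintro (h | rfl)
            · exact h
            · exact ⟨hb, hbD⟩
        · have := hmiss w ha hb
          rw [this.sdiff_eq_left]
          exact hB.1 w
    · intro w w' hne
      rw [Set.disjoint_left]
      intro z hz hz'
      beta_reduce at hz hz'
      have h1 : z ∈ B w ∨ (w = w0 ∧ z ∈ D) := by
        split_ifs at hz with h
        · rcases hz with hz | hz
          · exact Or.inl hz.1
          · exact Or.inr ⟨h, hQ hz⟩
        · exact Or.inl hz.1
      have h1' : z ∈ D → w = w0 := by
        intro hzD
        by_contra h
        rw [if_neg h] at hz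
        exact hz.2 hzD
      have h2' : z ∈ D → w' = w0 := by
        intro hzD
        by_contra h
        rw [if_neg h] at hz'
        exact hz'.2 hzD
      by_cases hzD : z ∈ D
      · exact hne ((h1' hzD).trans (h2' hzD).symm)
      · have g1 : z ∈ B w := by
          rcases h1 with h | h
          · exact h
          · exact absurd h.2 hzD
        have g2 : z ∈ B w' := by
          split_ifs at hz' with h
          · rcases hz' with hz' | hz'
            · exact hz'.1
            · exact absurd (hQ hz') hzD
          · exact hz'.1
        exact hne (hdis g1 g2)
    · -- adjacency
      have hmem : ∀ {w z}, z ∈ B w → z ∉ D → z ∈ (if w = w0 then (B w \ D) ∪ Q else B w \ D) := by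
        intro w z hz hzD
        split_ifs
        · exact Or.inl ⟨hz, hzD⟩
        · exact ⟨hz, hzD⟩
      have hmem0 : ∀ {z}, z ∈ insert a Q →
          z ∈ (if w0 = w0 then (B w0 \ D) ∪ Q else B w0 \ D) := by
        intro z hz
        rw [if_pos rfl]
        rcases hz with rfl | hz
        · exact Or.inl ⟨hw0, haD⟩
        · exact Or.inr hz
      have hts : ∀ {w z}, z ∈ B w → z ∈ D → a ∈ B w ∨ b ∈ B w := by
        intro w z hz hzD
        by_contra h
        push Not at h
        exact Set.disjoint_left.1 (hmiss w h.1 h.2) hz hzD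
      -- the key adjacency
      have hkey : ∀ w1, w1 ≠ w0 → b ∈ B w1 → ∃ v₁ ∈ (if w0 = w0 then (B w0 \ D) ∪ Q else B w0 \ D),
          ∃ v₂ ∈ (if w1 = w0 then (B w1 \ D) ∪ Q else B w1 \ D), G.Adj v₁ v₂ := by
        intro w1 hne hb
        have hba : b ≠ a := by rintro rfl; exact hne (hdis hb hw0)
        have hbQ : b ∉ insert a Q := by
          rintro (h | h)
          · exact hba h
          · exact hbD (hQ h)
        obtain ⟨p, hp, hp', q, hq, hq', hpq⟩ := hQab.cut (A := insert a Q)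
          ⟨a, Or.inl rfl, Or.inr (Or.inl rfl)⟩ ⟨b, Or.inl rfl, hbQ⟩
        obtain rfl : q = b := by
          rcases hq with h | h
          · exact h
          · exact absurd h hq'
        exact ⟨p, hmem0 hp, q, hmem hb hbD, hpq⟩
      intro w w' hadj
      obtain ⟨v, hv, v', hv', hvv⟩ := hB.2.2 w w' hadj
      by_cases h : v ∉ D ∧ v' ∉ D
      · exact ⟨v, hmem hv h.1, v', hmem hv' h.2, hvv⟩
      · have hw : a ∈ B w ∨ b ∈ B w := by
          by_cases hvD : v ∈ D
          · exact hts hv hvD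
          · have hvD' : v' ∈ D := by tauto
            rcases hD v' hvD' v hvv.symm with h | rfl | rfl
            · exact absurd h hvD
            · exact Or.inl hv
            · exact Or.inr hv
        have hw' : a ∈ B w' ∨ b ∈ B w' := by
          by_cases hvD : v' ∈ D
          · exact hts hv' hvD
          · have hvD' : v ∈ D := by tauto
            rcases hD v hvD' v' hvv with h | rfl | rfl
            · exact absurd h hvD
            · exact Or.inl hv'
            · exact Or.inr hv'
        have hne : w ≠ w' := hadj.ne
        rcases hw with ha | hb
        · obtain rfl := hdis ha hw0
          rcases hw' with ha' | hb'
          · exact absurd (hdis ha ha') hne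
          · exact hkey w' hne.symm hb'
        · rcases hw' with ha' | hb'
          · obtain rfl := hdis ha' hw0
            obtain ⟨p, hp, q, hq, hpq⟩ := hkey w hne hb
            exact ⟨q, hq, p, hp, hpq.symm⟩
          · exact absurd (hdis hb hb') hne
  intro z hz
  obtain ⟨i, hi⟩ := hspan _ hM z
  beta_reduce at hi
  split_ifs at hi with h
  · rcases hi with hi | hi
    · exact absurd hz hi.2
    · exact hi
  · exact absurd hz hi.2

/-- Peel a thin set. -/
theorem thin_step {D : Set V} {a b x : V}
    (hD : ∀ d ∈ D, ∀ v, G.Adj d v → v ∈ D ∨ v = a ∨ v = b) (hDc : Conn G D)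
    (hmin : ∀ Q ⊆ D, Conn G (insert a Q) → Conn G (insert b (insert a Q)) → D ⊆ Q)
    (hx : x ∈ D) (hax : G.Adj a x) (hb : ∃ y ∈ D, G.Adj b y) (hab : a ∉ D) :
    (G.Adj x b ∧ D = {x}) ∨ (¬ G.Adj x b ∧ ∃ E, D = insert x E ∧ x ∉ E ∧ Conn G E ∧
      (∀ y ∈ E, ¬ G.Adj a y) ∧ (∃ y ∈ E, G.Adj x y) ∧ (∃ y ∈ E, G.Adj b y)) := by
  by_cases hxb : G.Adj x b
  · refine Or.inl ⟨hxb, ?_⟩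
    have h1 : Conn G (insert a {x}) := conn_pair hax
    have := hmin {x} (by simpa using hx) h1 (h1.insert_adj (Or.inr rfl) hxb)
    exact Set.Subset.antisymm this (by simpa using hx)
  · right
    refine ⟨hxb, ?_⟩
    obtain ⟨y, hy, hby⟩ := hb
    have hyx : y ≠ x := by rintro rfl; exact hxb hby.symm
    obtain ⟨E, hES, hyE, hEc, hEcl⟩ := exists_component (G := G) (D \ {x}) (y := y) ⟨hy, hyx⟩
    have hxE : x ∉ E := fun h => (hES h).2 rfl
    have hED : E ⊆ D := fun z hz => (hES hz).1
    obtain ⟨p, hp, _, q, hq, hqE, hpq⟩ := hDc.cut (A := E) ⟨y, hyE, hy⟩ ⟨x, hx, hxE⟩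
    have hqx : q = x := by
      by_contra hne
      exact hqE (hEcl p hp q ⟨hq, hne⟩ hpq)
    subst hqx
    have hc1 : Conn G (insert q E) := hEc.insert_adj hp hpq
    have hc2 : Conn G (insert a (insert q E)) := hc1.insert_adj (Or.inl rfl) hax.symm
    have hc3 : Conn G (insert b (insert a (insert q E))) :=
      hc2.insert_adj (Or.inr (Or.inr hyE)) hby.symm
    have hDE := hmin (insert q E) (Set.insert_subset hx hED) hc2 hc3
    refine ⟨E, Set.Subset.antisymm hDE (Set.insert_subset hx hED), hxE, hEc, ?_, ⟨p, hp, hpq.symm⟩,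
      ⟨y, hyE, hby⟩⟩
    intro z hz haz
    have hc4 : Conn G (insert a E) := hEc.insert_adj hz haz.symm
    exact hxE (hmin E hED hc4 (hc4.insert_adj (Or.inr hyE) hby.symm) hx)

theorem thin_deg2 {D : Set V} {a b x : V}
    (hD : ∀ d ∈ D, ∀ v, G.Adj d v → v ∈ D ∨ v = a ∨ v = b) (hDc : Conn G D)
    (hmin : ∀ Q ⊆ D, Conn G (insert a Q) → Conn G (insert b (insert a Q)) → D ⊆ Q)
    (hx : x ∈ D) (hax : G.Adj a x) (hb : ∃ y ∈ D, G.Adj b y) (haD : a ∉ D) (hbD : b ∉ D)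
    (hab : a ≠ b) (hnab : ¬ G.Adj a b) :
    ∃ y, a ≠ y ∧ ¬ G.Adj a y ∧ G.Adj x y ∧ ∀ z, G.Adj x z → z = a ∨ z = y := by
  rcases thin_step hD hDc hmin hx hax hb haD with ⟨hxb, rfl⟩ | ⟨hxb, E, rfl, hxE, hEc, hEa, ⟨y, hyE, hxy⟩, hEb⟩
  · refine ⟨b, hab, hnab, hxb, fun z hz => ?_⟩
    rcases hD x rfl z hz with h | h
    · obtain rfl : z = x := h
      exact absurd hz (G.irrefl)
    · exact h
  · have haE : a ∉ E := fun h => haD (Or.inr h)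
    have h2 := thin_step (D := E) (a := x) (b := b) (x := y) (by
        intro d hd v hv
        rcases hD d (Or.inr hd) v hv with (h | h) | h | h
        · exact Or.inr (Or.inl h)
        · exact Or.inl h
        · subst h; exact absurd hv.symm (hEa d hd)
        · exact Or.inr (Or.inr h)) hEc (by
        intro Q hQ h1 h2
        have hc1 : Conn G (insert a (insert x Q)) := h1.insert_adj (Or.inl rfl) hax.symm
        have hc2 : Conn G (insert b (insert a (insert x Q))) := by
          have := h2.union_inter hc1 ⟨x, Or.inr (Or.inl rfl), Or.inr (Or.inl rfl)⟩
          convert this using 1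
          ext z
          simp only [Set.mem_union, Set.mem_insert_iff]
          tauto
        have := hmin (insert x Q) (Set.insert_subset_insert hQ) hc1 hc2
        intro z hz
        rcases this (Or.inr hz) with rfl | h
        · exact absurd hz hxE
        · exact h) hyE hxy hEb hxE
    refine ⟨y, fun h => haE (h ▸ hyE), hEa y hyE, hxy, ?_⟩
    intro z hz
    have hz' : z = a ∨ z ∈ E := by
      rcases hD x (Or.inl rfl) z hz with (h | h) | h | h
      · subst h; exact absurd hz G.irrefl
      · exact Or.inr h
      · exact Or.inl h
      · subst h; exact absurd hz hxb
    rcases hz' with h | hzE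
    · exact Or.inl h
    · right
      rcases h2 with ⟨_, h⟩ | ⟨_, F, hEF, _, _, hF, _⟩
      · rw [h] at hzE; exact hzE
      · rw [hEF] at hzE
        rcases hzE with h | h
        · exact h
        · exact absurd hz (hF z h)

theorem no_small_sep {W : Type*} {K : SimpleGraph W} (hK : ∀ a b : W, Conn K {a, b}ᶜ)
    {B : W → Set V} (hB : IsModel K G B)
    (hspan : ∀ B, IsModel K G B → ∀ x, ∃ i, x ∈ B i) {A C s : Set V} {a b : V}
    (hA : A.Nonempty) (hC : C.Nonempty) (hAC : Disjoint A C) (hAs : Disjoint A s)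
    (hCs : Disjoint C s)
    (hun : ∀ x, x ∈ A ∨ x ∈ C ∨ x ∈ s) (hno : ∀ x ∈ A, ∀ y ∈ C, ¬ G.Adj x y)
    (hs : s ⊆ {a, b}) (hs' : s = ∅ ∨ a ∈ s ∧ b ∈ s) :
    ∃ x a b, a ≠ b ∧ ¬ G.Adj a b ∧ G.Adj x a ∧ G.Adj x b ∧ ∀ y, G.Adj x y → y = a ∨ y = b := by
  obtain ⟨wa, hwa⟩ := hspan B hB a
  obtain ⟨wb, hwb⟩ := hspan B hB b
  have hdis : ∀ {w w' z}, z ∈ B w → z ∈ B w' → w = w' := by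
    intro w w' z h h'
    by_contra hne
    exact Set.disjoint_left.1 (hB.2.1 w w' hne) h h'
  -- choose sides
  wlog hside : ∀ w, Disjoint (B w) s → Disjoint (B w) A generalizing A C
  · refine this hC hA hAC.symm hCs hAs (fun x => by have := hun x; tauto)
      (fun x hx y hy h => hno y hy x hx h.symm) ?_
    push Not at hside
    obtain ⟨w1, hw1s, hw1A⟩ := hside
    have inside : ∀ w, Disjoint (B w) s → ¬ Disjoint (B w) A → B w ⊆ A := by
      intro w hws hwA
      rw [Set.not_disjoint_iff] at hwA
      obtain ⟨z, hz, hzA⟩ := hwA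
      refine (hB.1 w).closed ⟨z, hzA, hz⟩ ?_
      intro p hp _ q hq hpq
      rcases hun q with h | h | h
      · exact h
      · exact absurd hpq (hno p hp q h)
      · exact absurd h (Set.disjoint_left.1 hws hq)
    have hmiss : ∀ w, w ∉ ({wa, wb} : Set W) → Disjoint (B w) s := by
      intro w hw
      rw [Set.disjoint_left]
      intro z hz hzs
      rcases hs hzs with rfl | h
      · exact hw (Or.inl (hdis hz hwa))
      · obtain rfl : z = b := h
        exact hw (Or.inr (hdis hz hwb))
    have hcoll : ∀ w, Disjoint (B w) s → B w ⊆ A := by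
      rcases hs' with hs0 | ⟨has, hbs⟩
      · -- all of K
        subst hs0
        have hall : ∀ w w', K.Adj w w' → B w ⊆ A → B w' ⊆ A := by
          intro w w' hadj hw
          obtain ⟨v, hv, v', hv', hvv⟩ := hB.2.2 w w' hadj
          apply inside w' (Set.disjoint_empty _)
          rw [Set.not_disjoint_iff]
          refine ⟨v', hv', ?_⟩
          rcases hun v' with h | h | h
          · exact h
          · exact absurd hvv (hno v (hw hv) v' h)
          · exact absurd h (Set.notMem_empty _)
        have hw1 := inside w1 hw1s hw1A
        intro w _
        -- K is connected: pick u outside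
        have conn_pt : ∀ u u' : W, u ∈ ({w1, w1} : Set W)ᶜ → u' ∈ ({w1, w1} : Set W)ᶜ →
            B u ⊆ A → B u' ⊆ A := by
          intro u u' hu hu' huA
          exact (hK w1 w1).closed (A := {w | B w ⊆ A}) ⟨u, huA, hu⟩
            (fun p hp _ q _ hpq => hall p q hpq hp) hu'
        by_cases hw : w = w1
        · rw [hw]; exact hw1
        · obtain ⟨u, hu⟩ := (hK w w1).nonempty
          simp only [Set.mem_compl_iff, Set.mem_insert_iff, Set.mem_singleton_iff, not_or] at hu
          -- connect w1 to u avoiding w, then u to w avoiding w1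
          have huA : B u ⊆ A := (hK w w).closed (A := {w | B w ⊆ A})
            ⟨w1, hw1, by simpa using fun h => hw h.symm⟩
            (fun p hp _ q _ hpq => hall p q hpq hp) (show u ∈ ({w, w} : Set W)ᶜ by simpa using hu.1)
          exact conn_pt u w (by simpa using hu.2) (by simpa using hw) huA
      · have hmem : ∀ w, Disjoint (B w) s → w ∈ ({wa, wb} : Set W)ᶜ := by
          rintro w hw (rfl | h)
          · exact Set.disjoint_left.1 hw hwa has
          · obtain rfl : w = wb := h
            exact Set.disjoint_left.1 hw hwb hbs
        intro w hw
        refine (hK wa wb).closed (A := {w | B w ⊆ A}) ⟨w1, inside w1 hw1s hw1A, hmem w1 hw1s⟩ ?_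
          (hmem w hw)
        intro p hp _ q hq hpq
        obtain ⟨v, hv, v', hv', hvv⟩ := hB.2.2 p q hpq
        apply inside q (hmiss q hq)
        rw [Set.not_disjoint_iff]
        refine ⟨v', hv', ?_⟩
        rcases hun v' with h | h | h
        · exact h
        · exact absurd hvv (hno v (hp hv) v' h)
        · exact absurd h (Set.disjoint_left.1 (hmiss q hq) hv')
    intro w hw
    exact hAC.mono_left (hcoll w hw)
  -- main argument
  obtain ⟨d0, hd0⟩ := hA
  obtain ⟨D, hDA, hdD, hDc, hDcl⟩ := exists_component (G := G) A hd0
  have hDs : ∀ d ∈ D, ∀ v, G.Adj d v → v ∈ D ∨ v ∈ s := by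
    intro d hd v hv
    rcases hun v with h | h | h
    · exact Or.inl (hDcl d hd v h hv)
    · exact absurd hv (hno d (hDA hd) v h)
    · exact Or.inr h
  have hnotD : ∀ z ∈ s, z ∉ D := fun z hz hzD => Set.disjoint_left.1 hAs (hDA hzD) hz
  -- any single attachment vertex leads to a contradiction
  have single : ∀ c, c ∉ D → (∀ d ∈ D, ∀ v, G.Adj d v → v ∈ D ∨ v = c) → False := by
    intro c hc hcD
    have := reroute_model hB hspan (D := D) (Q := ∅) (a := c) (b := c) hc hc
      (fun d hd v hv => by rcases hcD d hd v hv with h | h <;> tauto) (by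
        intro w hw _
        rw [Set.disjoint_left]
        intro z hz hzD
        have hsub : B w ⊆ D := by
          refine (hB.1 w).closed ⟨z, hzD, hz⟩ ?_
          intro p hp _ q hq hpq
          rcases hcD p hp q hpq with h | h
          · exact h
          · exact absurd (h ▸ hq) hw
        have h1 := hside w (by
          rw [Set.disjoint_left]
          intro y hy hys
          exact hnotD y hys (hsub hy))
        exact Set.disjoint_left.1 h1 hz (hDA hzD)) (Set.empty_subset _)
      (by simpa using conn_singleton c) (by simpa using conn_singleton c)
    exact this hdD
  rcases hs' with hs0 | ⟨has, hbs⟩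
  · obtain ⟨c, hc⟩ := hC
    exact (single c (fun h => Set.disjoint_left.1 hAC (hDA h) hc) (fun d hd v hv => by
      rcases hDs d hd v hv with h | h
      · exact Or.inl h
      · rw [hs0] at h; exact absurd h (Set.notMem_empty _))).elim
  · have haD := hnotD a has
    have hbD := hnotD b hbs
    have hDab : ∀ d ∈ D, ∀ v, G.Adj d v → v ∈ D ∨ v = a ∨ v = b := by
      intro d hd v hv
      rcases hDs d hd v hv with h | h
      · exact Or.inl h
      · rcases hs h with h | h
        · exact Or.inr (Or.inl h)
        · exact Or.inr (Or.inr h)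
    have hab : a ≠ b := by
      rintro rfl
      exact single a haD (fun d hd v hv => by have := hDab d hd v hv; tauto)
    have hta : ∃ x ∈ D, G.Adj a x := by
      by_contra h
      push Not at h
      refine single b hbD (fun d hd v hv => ?_)
      rcases hDab d hd v hv with h1 | rfl | h1
      · exact Or.inl h1
      · exact absurd hv.symm (h d hd)
      · exact Or.inr h1
    have htb : ∃ x ∈ D, G.Adj b x := by
      by_contra h
      push Not at h
      refine single a haD (fun d hd v hv => ?_)
      rcases hDab d hd v hv with h1 | h1 | rfl
      · exact Or.inl h1
      · exact Or.inr h1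
      · exact absurd hv.symm (h d hd)
    have hmin : ∀ Q ⊆ D, Conn G (insert a Q) → Conn G (insert b (insert a Q)) → D ⊆ Q := by
      intro Q hQ h1 h2
      refine reroute_model hB hspan haD hbD hDab ?_ hQ h1 h2
      intro w hwa' hwb'
      refine (hside w ?_).mono_right hDA
      rw [Set.disjoint_left]
      intro y hy hys
      rcases hs hys with rfl | h
      · exact hwa' hy
      · obtain rfl : y = b := h
        exact hwb' hy
    have hnab : ¬ G.Adj a b := by
      intro h
      exact hmin ∅ (Set.empty_subset _) (by simpa using conn_singleton a)
        (by simpa using conn_pair h.symm) hdD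
    obtain ⟨x, hxD, hax⟩ := hta
    obtain ⟨y, h1, h2, h3, h4⟩ := thin_deg2 hDab hDc hmin hxD hax htb haD hbD hab hnab
    exact ⟨x, a, y, h1, h2, hax.symm, h3, h4⟩

end deg2

open SimpleGraph

theorem conn_of_diam2 {V : Type*} {G : SimpleGraph V} {S : Set V} (hn : S.Nonempty)
    (h : ∀ x ∈ S, ∀ y ∈ S, x ≠ y → G.Adj x y ∨ ∃ z ∈ S, G.Adj x z ∧ G.Adj z y) : Conn G S := by
  rw [conn_iff]
  refine ⟨hn, ?_⟩
  rintro A hA ⟨a, ha⟩ hcl y hy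
  by_cases hay : a = y
  · rw [← hay]; exact ha
  rcases h a (hA ha) y hy hay with h | ⟨z, hz, h1, h2⟩
  · exact hcl a ha y hy h
  · exact hcl z (hcl a ha z hz h1) y hy h2

theorem K5_conn (a b : Fin 5) : Conn K5 {a, b}ᶜ := by
  apply conn_of_diam2
  · have : ∀ a b : Fin 5, ∃ c, ¬ (c = a ∨ c = b) := by decide
    obtain ⟨c, hc⟩ := this a b
    exact ⟨c, hc⟩
  · intro x _ y _ hxy
    exact Or.inl (by simpa [K5] using hxy)

theorem K33_conn (a b : Fin 3 ⊕ Fin 3) : Conn K33 {a, b}ᶜ := by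
  apply conn_of_diam2
  · have : ∀ a b : Fin 3 ⊕ Fin 3, ∃ c, ¬ (c = a ∨ c = b) := by decide
    obtain ⟨c, hc⟩ := this a b
    exact ⟨c, hc⟩
  · intro x hx y hy hxy
    simp only [K33_adj_iff, Set.mem_compl_iff, Set.mem_insert_iff, Set.mem_singleton_iff] at *
    have : ∀ (a b : Fin 3 ⊕ Fin 3) (s : Bool), ∃ z : Fin 3 ⊕ Fin 3, ¬ (z = a ∨ z = b) ∧
        z.isLeft = s := by
      decide
    by_cases hl : x.isLeft = y.isLeft
    · obtain ⟨z, hz, hzl⟩ := this a b (!x.isLeft)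
      refine Or.inr ⟨z, hz, ?_, ?_⟩
      · rw [hzl]; cases x.isLeft <;> decide
      · rw [hzl, ← hl]; cases x.isLeft <;> decide
    · exact Or.inl hl

theorem card_of_model {W V : Type*} [Fintype W] [Finite V] {K : SimpleGraph W} {G : SimpleGraph V}
    {B : W → Set V} (hB : IsModel K G B) : Fintype.card W ≤ Nat.card V := by
  choose c hc using fun w => (hB.1 w).nonempty
  have : Function.Injective c := by
    intro i j hij
    by_contra hne
    exact Set.disjoint_left.1 (hB.2.1 i j hne) (hc i) (hij ▸ hc j)
  rw [← Nat.card_eq_fintype_card]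
  exact Nat.card_le_card_of_injective c this

theorem deg2_or_conn {W V : Type*} [Fintype W] [Finite V] {K : SimpleGraph W} {G : SimpleGraph V}
    (hK : ∀ a b : W, Conn K {a, b}ᶜ) (hW : 3 < Fintype.card W)
    {B : W → Set V} (hB : IsModel K G B)
    (hspan : ∀ B, IsModel K G B → ∀ x, ∃ i, x ∈ B i) (hc : ¬ KConnected G 3) :
    ∃ x a b, a ≠ b ∧ ¬ G.Adj a b ∧ G.Adj x a ∧ G.Adj x b ∧ ∀ y, G.Adj x y → y = a ∨ y = b := by
  have hcard := card_of_model hB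
  have h3 : 3 < Nat.card V := by omega
  simp only [KConnected, h3, true_and] at hc
  push Not at hc
  obtain ⟨s, hs, hsc⟩ := hc
  have hsne : sᶜ.Nonempty := by
    rw [Set.nonempty_compl]
    rintro rfl
    rw [Set.ncard_univ] at hs
    omega
  have hsc' : ¬ Conn G sᶜ := hsc
  rw [conn_iff] at hsc'
  push Not at hsc'
  obtain ⟨A, hAs, hAn, hcl, hnot⟩ := hsc' hsne
  rw [Set.not_subset] at hnot
  obtain ⟨c, hcs, hcA⟩ := hnot
  obtain ⟨a, b, hab, hab'⟩ : ∃ a b, s ⊆ {a, b} ∧ (s = ∅ ∨ a ∈ s ∧ b ∈ s) := by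
    have : s.ncard = 0 ∨ s.ncard = 1 ∨ s.ncard = 2 := by omega
    rcases this with h | h | h
    · rw [Set.ncard_eq_zero (Set.toFinite s)] at h
      exact ⟨c, c, by simp [h], Or.inl h⟩
    · rw [Set.ncard_eq_one] at h
      obtain ⟨a, rfl⟩ := h
      exact ⟨a, a, by simp, Or.inr ⟨rfl, rfl⟩⟩
    · rw [Set.ncard_eq_two] at h
      obtain ⟨a, b, _, rfl⟩ := h
      exact ⟨a, b, subset_rfl, Or.inr ⟨Or.inl rfl, Or.inr rfl⟩⟩
  refine no_small_sep hK hB hspan (A := A) (C := sᶜ \ A) (s := s) hAn ⟨c, hcs, hcA⟩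
    Set.disjoint_sdiff_right ?_ ?_ ?_ ?_ hab hab'
  · exact Set.disjoint_left.2 (fun x hx => hAs hx)
  · exact Set.disjoint_left.2 (fun x hx => hx.1)
  · intro x
    by_cases h1 : x ∈ s
    · exact Or.inr (Or.inr h1)
    · by_cases h2 : x ∈ A
      · exact Or.inl h2
      · exact Or.inr (Or.inl ⟨h1, h2⟩)
  · intro x hx y hy hxy
    exact hy.2 (hcl x hx y hy.1 hxy)

theorem exists_deg2 {V : Type*} [Finite V] {G : SimpleGraph V} (hG : HFree G) (hnp : ¬ Planar G)
    (hiso : ∀ x, ∃ y, G.Adj x y) (hc : ¬ KConnected G 3) :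
    ∃ x a b, a ≠ b ∧ ¬ G.Adj a b ∧ G.Adj x a ∧ G.Adj x b ∧ ∀ y, G.Adj x y → y = a ∨ y = b := by
  have : IsMinor K5 G ∨ IsMinor K33 G := by
    by_contra h
    push Not at h
    exact hnp h
  rcases this with h | h
  · obtain ⟨B, hB⟩ := isMinor_iff.1 h
    refine deg2_or_conn K5_conn (by simp) hB ?_ hc
    intro B hB x
    obtain ⟨y, hy⟩ := hiso x
    exact spanning5 hG hB hy
  · obtain ⟨B, hB⟩ := isMinor_iff.1 h
    refine deg2_or_conn K33_conn (by simp) hB ?_ hc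
    intro B hB x
    obtain ⟨y, hy⟩ := hiso x
    exact spanning33 hG hB hy

open SimpleGraph

section suppress
variable {V : Type*} {G : SimpleGraph V} {x a b : V}

structure Deg2 (G : SimpleGraph V) (x a b : V) : Prop where
  ne : a ≠ b
  nadj : ¬ G.Adj a b
  xa : G.Adj x a
  xb : G.Adj x b
  only : ∀ y, G.Adj x y → y = a ∨ y = b

/-- suppress the degree two vertex x -/
def suppress (G : SimpleGraph V) (x a b : V) : SimpleGraph {v // v ≠ x} where
  Adj u v := u ≠ v ∧ (G.Adj u.1 v.1 ∨ (u.1 = a ∧ v.1 = b) ∨ (u.1 = b ∧ v.1 = a))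
  symm := ⟨by
    rintro u v ⟨h, h1⟩
    refine ⟨h.symm, ?_⟩
    rcases h1 with h1 | h1 | h1
    · exact Or.inl h1.symm
    · exact Or.inr (Or.inr h1.symm)
    · exact Or.inr (Or.inl h1.symm)⟩
  loopless := ⟨fun u h => h.1 rfl⟩

theorem suppress_adj_of (u v : {v // v ≠ x}) (h : G.Adj u.1 v.1) : (suppress G x a b).Adj u v :=
  ⟨fun h' => h.ne (congrArg _ h'), Or.inl h⟩

theorem suppress_ab (hd : Deg2 G x a b) (ha : a ≠ x) (hb : b ≠ x) :
    (suppress G x a b).Adj ⟨a, ha⟩ ⟨b, hb⟩ :=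
  ⟨fun h => hd.ne (congrArg Subtype.val h), Or.inr (Or.inl ⟨rfl, rfl⟩)⟩

theorem suppress_iso_free (hd : Deg2 G x a b) (hiso : ∀ x, ∃ y, G.Adj x y) (u : {v // v ≠ x}) :
    ∃ v, (suppress G x a b).Adj u v := by
  obtain ⟨y, hy⟩ := hiso u.1
  by_cases h : y = x
  · subst h
    rcases hd.only _ hy.symm with h | h
    · refine ⟨⟨b, hd.xb.ne.symm⟩, ?_, Or.inr (Or.inl ⟨h, rfl⟩)⟩
      intro h'
      exact hd.ne (h.symm.trans (congrArg Subtype.val h'))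
    · refine ⟨⟨a, hd.xa.ne.symm⟩, ?_, Or.inr (Or.inr ⟨h, rfl⟩)⟩
      intro h'
      exact hd.ne ((congrArg Subtype.val h').symm.trans h)
  · exact ⟨⟨y, h⟩, suppress_adj_of _ _ hy⟩

/-- minors of subgraphs of the suppression -/
theorem suppress_minor_aux (hd : Deg2 G x a b) {G₁ : SimpleGraph {v // v ≠ x}}
    {G₂ : SimpleGraph V} (hxa : G₂.Adj x a) (hxb : G₂.Adj x b)
    (hle : ∀ u v, G₁.Adj u v → G₂.Adj u.1 v.1 ∨ (u.1 = a ∧ v.1 = b) ∨ (u.1 = b ∧ v.1 = a)) :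
    IsMinor G₁ G₂ := by
  refine isMinor_iff.2 ⟨fun v => {z | z = v.1 ∨ (v.1 = a ∧ z = x)}, ?_, ?_, ?_⟩
  · intro v
    by_cases hv : v.1 = a
    · have : {z | z = v.1 ∨ (v.1 = a ∧ z = x)} = {a, x} := by
        ext z; simp [hv]
      show Conn G₂ {z | z = v.1 ∨ (v.1 = a ∧ z = x)}
      rw [this]
      exact conn_pair hxa.symm
    · have : {z | z = v.1 ∨ (v.1 = a ∧ z = x)} = {v.1} := by
        ext z; simp [hv]
      show Conn G₂ {z | z = v.1 ∨ (v.1 = a ∧ z = x)}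
      rw [this]
      exact conn_singleton _
  · intro u v huv
    rw [Set.disjoint_left]
    rintro z (h1 | h1) (h2 | h2)
    · exact huv (Subtype.ext (h1.symm.trans h2))
    · exact u.2 (h1.symm.trans h2.2)
    · exact v.2 (h2.symm.trans h1.2)
    · exact huv (Subtype.ext (h1.1.trans h2.1.symm))
  · intro u v huv
    rcases hle u v huv with h | ⟨h1, h2⟩ | ⟨h1, h2⟩
    · exact ⟨u.1, Or.inl rfl, v.1, Or.inl rfl, h⟩
    · exact ⟨x, Or.inr ⟨h1, rfl⟩, v.1, Or.inl rfl, h2 ▸ hxb⟩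
    · exact ⟨u.1, Or.inl rfl, x, Or.inr ⟨h2, rfl⟩, h1 ▸ hxb.symm⟩

theorem suppress_minor (hd : Deg2 G x a b) : IsMinor (suppress G x a b) G :=
  suppress_minor_aux hd hd.xa hd.xb (fun _ _ h => h.2)

/-- minors with minimum degree at least three survive suppression -/
theorem minor_suppress {W : Type*} {K : SimpleGraph W} (hd : Deg2 G x a b)
    (hK : ∀ w, ∃ w1 w2 w3, w1 ≠ w2 ∧ w1 ≠ w3 ∧ w2 ≠ w3 ∧ K.Adj w w1 ∧ K.Adj w w2 ∧ K.Adj w w3)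
    (h : IsMinor K G) : IsMinor K (suppress G x a b) := by
  obtain ⟨B, hB⟩ := isMinor_iff.1 h
  have hdis : ∀ {w w' z}, z ∈ B w → z ∈ B w' → w = w' := by
    intro w w' z h h'
    by_contra hne
    exact Set.disjoint_left.1 (hB.2.1 w w' hne) h h'
  have hne : ∀ w, x ∈ B w → ∃ y ∈ B w, y ≠ x := by
    intro w hx
    by_contra hc
    push Not at hc
    obtain ⟨w1, w2, w3, h12, h13, h23, k1, k2, k3⟩ := hK w
    have key : ∀ w', K.Adj w w' → a ∈ B w' ∨ b ∈ B w' := by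
      intro w' hw'
      obtain ⟨v, hv, v', hv', hvv⟩ := hB.2.2 _ _ hw'
      rw [hc v hv] at hvv
      rcases hd.only _ hvv with rfl | rfl
      · exact Or.inl hv'
      · exact Or.inr hv'
    rcases key w1 k1 with g1 | g1 <;> rcases key w2 k2 with g2 | g2 <;>
      rcases key w3 k3 with g3 | g3 <;>
      first
      | exact h12 (hdis g1 g2)
      | exact h13 (hdis g1 g3)
      | exact h23 (hdis g2 g3)
  have hab : ∀ w, x ∈ B w → a ∈ B w ∨ b ∈ B w := by
    intro w hx
    obtain ⟨y, hy, hyx⟩ := hne w hx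
    obtain ⟨p, hp, _, q, hq, hq', hpq⟩ := (hB.1 w).cut (A := {x}) ⟨x, rfl, hx⟩ ⟨y, hy, hyx⟩
    obtain rfl : p = x := hp
    rcases hd.only _ hpq with rfl | rfl
    · exact Or.inl hq
    · exact Or.inr hq
  refine isMinor_iff.2 ⟨fun w => {v | v.1 ∈ B w}, ?_, ?_, ?_⟩
  · intro w
    rw [conn_iff]
    constructor
    · by_cases hx : x ∈ B w
      · obtain ⟨y, hy, hyx⟩ := hne w hx
        exact ⟨⟨y, hyx⟩, hy⟩
      · obtain ⟨y, hy⟩ := (hB.1 w).nonempty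
        exact ⟨⟨y, fun h => hx (h ▸ hy)⟩, hy⟩
    · rintro A hA ⟨a0, ha0⟩ hcl
      have := (hB.1 w).closed (A := {v | (∃ h : v ≠ x, (⟨v, h⟩ : {v // v ≠ x}) ∈ A) ∨
          (v = x ∧ ∃ u ∈ A, u.1 = a ∨ u.1 = b)})
        ⟨a0.1, Or.inl ⟨a0.2, ha0⟩, hA ha0⟩ (by
          rintro p (⟨hpx, hpA⟩ | ⟨rfl, u, huA, hu⟩) hpB q hq hpq
          · by_cases hqx : q = x
            · subst hqx
              exact Or.inr ⟨rfl, ⟨p, hpx⟩, hpA, hd.only p hpq.symm⟩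
            · exact Or.inl ⟨hqx, hcl _ hpA ⟨q, hqx⟩ hq (suppress_adj_of _ _ hpq)⟩
          · left
            refine ⟨hpq.ne.symm, ?_⟩
            by_cases huq : u.1 = q
            · have : u = ⟨q, hpq.ne.symm⟩ := Subtype.ext huq
              rw [← this]; exact huA
            · refine hcl u huA _ hq ⟨fun h => huq (congrArg Subtype.val h), ?_⟩
              rcases hu with hu | hu <;> rcases hd.only q hpq with hq' | hq'
              · exact absurd (hu.trans hq'.symm) huq
              · exact Or.inr (Or.inl ⟨hu, hq'⟩)
              · exact Or.inr (Or.inr ⟨hu, hq'⟩)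
              · exact absurd (hu.trans hq'.symm) huq)
      intro v hv
      rcases this hv with ⟨_, h⟩ | ⟨h, _⟩
      · exact h
      · exact absurd h v.2
  · intro w w' hww
    rw [Set.disjoint_left]
    intro v hv hv'
    exact hww (hdis hv hv')
  · have half : ∀ w w', w ≠ w' → x ∈ B w → ∀ v' ∈ B w', G.Adj x v' →
        ∃ v₁ ∈ {v : {v // v ≠ x} | v.1 ∈ B w}, ∃ v₂ ∈ {v : {v // v ≠ x} | v.1 ∈ B w'},
          (suppress G x a b).Adj v₁ v₂ := by
      intro w w' hww hx v' hv' hadj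
      rcases hd.only _ hadj with rfl | rfl
      · rcases hab w hx with h | h
        · exact absurd (hdis h hv') hww
        · exact ⟨⟨b, hd.xb.ne.symm⟩, h, ⟨v', hd.xa.ne.symm⟩, hv', (suppress_ab hd _ _).symm⟩
      · rcases hab w hx with h | h
        · exact ⟨⟨a, hd.xa.ne.symm⟩, h, ⟨v', hd.xb.ne.symm⟩, hv', (suppress_ab hd _ _)⟩
        · exact absurd (hdis h hv') hww
    intro w w' hadj
    obtain ⟨v, hv, v', hv', hvv⟩ := hB.2.2 _ _ hadj
    by_cases h1 : v = x
    · subst h1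
      exact half w w' hadj.ne hv v' hv' hvv
    · by_cases h2 : v' = x
      · subst h2
        obtain ⟨p, hp, q, hq, hpq⟩ := half w' w hadj.ne.symm hv' v hv hvv.symm
        exact ⟨q, hq, p, hp, hpq.symm⟩
      · exact ⟨⟨v, h1⟩, hv, ⟨v', h2⟩, hv', suppress_adj_of _ _ hvv⟩

theorem suppress_nonplanar (hd : Deg2 G x a b) (h : ¬ Planar G) : ¬ Planar (suppress G x a b) := by
  intro hp
  apply h
  constructor
  · intro hm
    refine hp.1 (minor_suppress hd ?_ hm)
    intro w
    have : ∀ w : Fin 5, ∃ w1 w2 w3, w1 ≠ w2 ∧ w1 ≠ w3 ∧ w2 ≠ w3 ∧ w ≠ w1 ∧ w ≠ w2 ∧ w ≠ w3 := by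
      decide
    simpa [K5] using this w
  · intro hm
    refine hp.2 (minor_suppress hd ?_ hm)
    rintro (w | w)
    · exact ⟨.inr 0, .inr 1, .inr 2, by simp [K33]⟩
    · exact ⟨.inl 0, .inl 1, .inl 2, by simp [K33]⟩

open Classical in
/-- one step of the walk expansion -/
noncomputable def estep (hd : Deg2 G x a b) {u v : {v // v ≠ x}} (h : (suppress G x a b).Adj u v) :
    G.Walk u.1 v.1 :=
  if hg : G.Adj u.1 v.1 then Walk.cons hg Walk.nil
  else Walk.cons (show G.Adj u.1 x by
      rcases h.2 with h | h | h
      · exact absurd h hg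
      · rw [h.1]; exact hd.xa.symm
      · rw [h.1]; exact hd.xb.symm)
    (Walk.cons (show G.Adj x v.1 by
      rcases h.2 with h | h | h
      · exact absurd h hg
      · rw [h.2]; exact hd.xb
      · rw [h.2]; exact hd.xa) Walk.nil)

noncomputable def expand (hd : Deg2 G x a b) : ∀ {u v : {v // v ≠ x}},
    (suppress G x a b).Walk u v → G.Walk u.1 v.1
  | _, _, .nil => .nil
  | _, _, .cons h p => (estep hd h).append (expand hd p)

theorem estep_symm (hd : Deg2 G x a b) {u v : {v // v ≠ x}} (h : (suppress G x a b).Adj u v) :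
    estep hd h.symm = (estep hd h).reverse := by
  unfold estep
  by_cases hg : G.Adj u.1 v.1
  · rw [dif_pos hg, dif_pos hg.symm]; rfl
  · rw [dif_neg hg, dif_neg (fun h => hg h.symm)]; rfl

theorem expand_append (hd : Deg2 G x a b) {u v w : {v // v ≠ x}} (p : (suppress G x a b).Walk u v)
    (q : (suppress G x a b).Walk v w) :
    expand hd (p.append q) = (expand hd p).append (expand hd q) := by
  induction p with
  | nil => rfl
  | cons h p ih =>
    simp only [Walk.cons_append, expand, ih, Walk.append_assoc]

theorem expand_reverse (hd : Deg2 G x a b) {u v : {v // v ≠ x}} (p : (suppress G x a b).Walk u v) :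
    expand hd p.reverse = (expand hd p).reverse := by
  induction p with
  | nil => rfl
  | cons h p ih =>
    rw [Walk.reverse_cons, expand_append, ih]
    simp only [expand, Walk.reverse_append, Walk.append_nil]
    rw [← estep_symm]

/-- the endpoint condition on an edge of the suppression which is new -/
theorem suppress_new (hd : Deg2 G x a b) {u v : {v // v ≠ x}} (h : (suppress G x a b).Adj u v) :
    ¬ G.Adj u.1 v.1 ↔ ((u.1 = a ∧ v.1 = b) ∨ (u.1 = b ∧ v.1 = a)) := by
  constructor
  · intro hg
    exact h.2.resolve_left hg
  · rintro (⟨h1, h2⟩ | ⟨h1, h2⟩) hg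
    · rw [h1, h2] at hg; exact hd.nadj hg
    · rw [h1, h2] at hg; exact hd.nadj hg.symm

theorem sym2_ab_iff (ha : a ≠ x) (hb : b ≠ x) {u v : {v // v ≠ x}} :
    s((⟨a, ha⟩ : {v // v ≠ x}), ⟨b, hb⟩) = s(u, v) ↔
      ((u.1 = a ∧ v.1 = b) ∨ (u.1 = b ∧ v.1 = a)) := by
  rw [Sym2.eq_iff]
  constructor
  · rintro (⟨rfl, rfl⟩ | ⟨rfl, rfl⟩) <;> simp
  · rintro (⟨h1, h2⟩ | ⟨h1, h2⟩)
    · exact Or.inl ⟨Subtype.ext h1.symm, Subtype.ext h2.symm⟩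
    · exact Or.inr ⟨Subtype.ext h2.symm, Subtype.ext h1.symm⟩

theorem mem_expand_support (hd : Deg2 G x a b) {u v : {v // v ≠ x}}
    (p : (suppress G x a b).Walk u v) (z : V) :
    z ∈ (expand hd p).support ↔ (∃ h : z ≠ x, (⟨z, h⟩ : {v // v ≠ x}) ∈ p.support) ∨
      (z = x ∧ s((⟨a, hd.xa.ne.symm⟩ : {v // v ≠ x}), ⟨b, hd.xb.ne.symm⟩) ∈ p.edges) := by
  induction p with
  | @nil u =>
    simp only [expand, Walk.support_nil, List.mem_singleton, Walk.edges_nil, List.not_mem_nil,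
      and_false, or_false]
    constructor
    · rintro rfl; exact ⟨u.2, rfl⟩
    · rintro ⟨_, h⟩; exact congrArg Subtype.val h
  | @cons u v w h p ih =>
    simp only [expand, Walk.mem_support_append_iff, ih, Walk.support_cons, List.mem_cons,
      Walk.edges_cons, sym2_ab_iff]
    have hv : v ∈ p.support := p.start_mem_support
    unfold estep
    by_cases hg : G.Adj u.1 v.1
    · rw [dif_pos hg]
      have hng : ¬ ((u.1 = a ∧ v.1 = b) ∨ (u.1 = b ∧ v.1 = a)) := by
        rw [← suppress_new hd h]; simpa using hg
      simp only [Walk.support_cons, Walk.support_nil, List.mem_cons, List.not_mem_nil, or_false, hng, false_or]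
      constructor
      · rintro ((rfl | rfl) | h1)
        · exact Or.inl ⟨u.2, Or.inl rfl⟩
        · exact Or.inl ⟨v.2, Or.inr hv⟩
        · rcases h1 with ⟨h1, h2⟩ | h1
          · exact Or.inl ⟨h1, Or.inr h2⟩
          · exact Or.inr h1
      · rintro (⟨h1, h2 | h2⟩ | h1)
        · exact Or.inl (Or.inl (congrArg Subtype.val h2))
        · exact Or.inr (Or.inl ⟨h1, h2⟩)
        · exact Or.inr (Or.inr h1)
    · rw [dif_neg hg]
      have hng : ((u.1 = a ∧ v.1 = b) ∨ (u.1 = b ∧ v.1 = a)) := by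
        rw [← suppress_new hd h]; exact hg
      simp only [Walk.support_cons, Walk.support_nil, List.mem_cons, List.not_mem_nil, or_false, hng, true_or]
      constructor
      · rintro ((rfl | rfl | rfl) | h1)
        · exact Or.inl ⟨u.2, Or.inl rfl⟩
        · exact Or.inr ⟨rfl, trivial⟩
        · exact Or.inl ⟨v.2, Or.inr hv⟩
        · rcases h1 with ⟨h1, h2⟩ | h1
          · exact Or.inl ⟨h1, Or.inr h2⟩
          · exact Or.inr ⟨h1.1, trivial⟩
      · rintro (⟨h1, h2 | h2⟩ | h1)
        · exact Or.inl (Or.inl (congrArg Subtype.val h2))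
        · exact Or.inr (Or.inl ⟨h1, h2⟩)
        · exact Or.inl (Or.inr (Or.inl h1.1))

theorem mem_expand_edges (hd : Deg2 G x a b) {u v : {v // v ≠ x}}
    (p : (suppress G x a b).Walk u v) (e : Sym2 V) :
    e ∈ (expand hd p).edges ↔ (∃ c d : {v // v ≠ x}, G.Adj c.1 d.1 ∧ s(c, d) ∈ p.edges ∧
        e = s(c.1, d.1)) ∨
      ((e = s(x, a) ∨ e = s(x, b)) ∧
        s((⟨a, hd.xa.ne.symm⟩ : {v // v ≠ x}), ⟨b, hd.xb.ne.symm⟩) ∈ p.edges) := by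
  induction p with
  | @nil u => simp [expand]
  | @cons u v w h p ih =>
    simp only [expand, Walk.edges_append, List.mem_append, ih, Walk.edges_cons, List.mem_cons, sym2_ab_iff]
    unfold estep
    by_cases hg : G.Adj u.1 v.1
    · rw [dif_pos hg]
      have hng : ¬ ((u.1 = a ∧ v.1 = b) ∨ (u.1 = b ∧ v.1 = a)) := by
        rw [← suppress_new hd h]; simpa using hg
      simp only [Walk.edges_cons, Walk.edges_nil, List.mem_cons, List.not_mem_nil, or_false, hng, false_or]
      constructor
      · rintro (h1 | ⟨c, d, h1, h2, h3⟩ | h1)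
        · exact Or.inl ⟨u, v, hg, Or.inl rfl, h1⟩
        · exact Or.inl ⟨c, d, h1, Or.inr h2, h3⟩
        · exact Or.inr h1
      · rintro (⟨c, d, h1, h2 | h2, h3⟩ | h1)
        · left
          rw [h3]
          exact congrArg (Sym2.map Subtype.val) h2
        · exact Or.inr (Or.inl ⟨c, d, h1, h2, h3⟩)
        · exact Or.inr (Or.inr h1)
    · rw [dif_neg hg]
      have hng : ((u.1 = a ∧ v.1 = b) ∨ (u.1 = b ∧ v.1 = a)) := by
        rw [← suppress_new hd h]; exact hg
      simp only [Walk.edges_cons, Walk.edges_nil, List.mem_cons, List.not_mem_nil, or_false, hng, true_or, and_true]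
      have hst : (e = s(u.1, x) ∨ e = s(x, v.1)) ↔ (e = s(x, a) ∨ e = s(x, b)) := by
        rcases hng with ⟨h1, h2⟩ | ⟨h1, h2⟩
        · rw [h1, h2, Sym2.eq_swap]
        · rw [h1, h2, Sym2.eq_swap]; tauto
      rw [hst]
      constructor
      · rintro (h1 | ⟨c, d, h1, h2, h3⟩ | h1)
        · exact Or.inr h1
        · exact Or.inl ⟨c, d, h1, Or.inr h2, h3⟩
        · exact Or.inr h1.1
      · rintro (⟨c, d, h1, h2 | h2, h3⟩ | h1)
        · exfalso
          have : s(c.1, d.1) = s(u.1, v.1) := congrArg (Sym2.map Subtype.val) h2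
          rw [← mem_edgeSet, this, mem_edgeSet] at h1
          exact hg h1
        · exact Or.inr (Or.inl ⟨c, d, h1, h2, h3⟩)
        · exact Or.inl h1

theorem expand_isPath (hd : Deg2 G x a b) {u v : {v // v ≠ x}}
    (p : (suppress G x a b).Walk u v) (hp : p.IsPath) : (expand hd p).IsPath := by
  induction p with
  | nil => exact Walk.IsPath.nil
  | @cons u v w h p ih =>
    rw [Walk.cons_isPath_iff] at hp
    have hu : u.1 ∉ (expand hd p).support := by
      rw [mem_expand_support]
      rintro (⟨_, h1⟩ | ⟨h1, _⟩)
      · exact hp.2 h1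
      · exact u.2 h1
    simp only [expand]
    unfold estep
    by_cases hg : G.Adj u.1 v.1
    · rw [dif_pos hg]
      simp only [Walk.cons_append, Walk.nil_append]
      exact (ih hp.1).cons hu
    · rw [dif_neg hg]
      have hng : ((u.1 = a ∧ v.1 = b) ∨ (u.1 = b ∧ v.1 = a)) := by
        rw [← suppress_new hd h]; exact hg
      simp only [Walk.cons_append, Walk.nil_append]
      refine Walk.IsPath.cons (Walk.IsPath.cons (ih hp.1) ?_) ?_
      · rw [mem_expand_support]
        rintro (⟨h1, _⟩ | ⟨_, h1⟩)
        · exact h1 rfl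
        · have h2 : s((⟨a, hd.xa.ne.symm⟩ : {v // v ≠ x}), ⟨b, hd.xb.ne.symm⟩) = s(u, v) :=
            (sym2_ab_iff _ _).2 hng
          rw [h2] at h1
          exact hp.2 (Walk.fst_mem_support_of_mem_edges _ h1)
      · rw [Walk.support_cons, List.mem_cons]
        rintro (h1 | h1)
        · exact u.2 h1
        · exact hu h1

theorem expand_length (hd : Deg2 G x a b) {u v : {v // v ≠ x}}
    (p : (suppress G x a b).Walk u v)
    (hp : s((⟨a, hd.xa.ne.symm⟩ : {v // v ≠ x}), ⟨b, hd.xb.ne.symm⟩) ∉ p.edges) :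
    (expand hd p).length = p.length := by
  induction p with
  | nil => rfl
  | @cons u v w h p ih =>
    rw [Walk.edges_cons, List.mem_cons, not_or, sym2_ab_iff, ← suppress_new hd h] at hp
    simp only [expand]
    unfold estep
    rw [dif_pos (not_not.1 hp.1)]
    simp [ih hp.2]

end suppress

open SimpleGraph

/-- subdivision with the additional minor information on the subdivided edges -/
def Sd {V W : Type*} (G : SimpleGraph V) (H : SimpleGraph W) : Prop :=
  ∃ (f : W → V) (p : ∀ ⦃u v : W⦄, H.Adj u v → G.Walk (f u) (f v)), Function.Injective f ∧
    ((∀ ⦃u v : W⦄ (h : H.Adj u v), (p h).IsPath) ∧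
    (∀ ⦃u v : W⦄ (h : H.Adj u v), p h.symm = (p h).reverse) ∧
    (∀ ⦃u v : W⦄ (h : H.Adj u v), s(u, v) ∉ Dset H → (p h).length = 1) ∧
    (∀ ⦃u v : W⦄ (h : H.Adj u v) (w : W), f w ∈ (p h).support → w = u ∨ w = v) ∧
    (∀ ⦃u v u' v' : W⦄ (h : H.Adj u v) (h' : H.Adj u' v'), s(u, v) ≠ s(u', v') →
      ∀ x : V, x ∈ (p h).support → x ∈ (p h').support → x ∈ Set.range f) ∧
    (∀ x : V, x ∈ Set.range f ∨ ∃ (u v : W) (h : H.Adj u v), x ∈ (p h).support) ∧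
    (∀ e ∈ G.edgeSet, ∃ (u v : W) (h : H.Adj u v), e ∈ (p h).edges)) ∧
    (∀ ⦃u v : W⦄ (h : H.Adj u v), ∀ e ∈ (p h).edges,
      IsMinor (H.deleteEdges {s(u, v)}) (G.deleteEdges {e}))

theorem Sd.within {V W : Type*} {G : SimpleGraph V} {H : SimpleGraph W} (h : Sd G H) :
    IsSubdivisionWithin G H (Dset H) := by
  obtain ⟨f, p, hf, h, _⟩ := h
  exact ⟨⟨f, hf⟩, p, h⟩

theorem isMinor_refl {V : Type*} (G : SimpleGraph V) : IsMinor G G :=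
  isMinor_of_le le_rfl

theorem Sd.refl {V : Type*} (G : SimpleGraph V) : Sd G G := by
  refine ⟨fun w => w, fun u v h => Walk.cons h Walk.nil, fun _ _ h => h, ⟨?_, ?_, ?_, ?_, ?_, ?_, ?_⟩, ?_⟩
  · intro u v h
    simpa using h.ne
  · intro u v h
    rfl
  · intro u v h _
    rfl
  · intro u v h w hw
    simpa using hw
  · intro u v u' v' h h' _ x _ _
    exact ⟨x, rfl⟩
  · intro x
    exact Or.inl ⟨x, rfl⟩
  · intro e
    induction e with
    | _ u v =>
      intro h
      rw [mem_edgeSet] at h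
      exact ⟨u, v, h, by simp⟩
  · intro u v h e he
    have : e = s(u, v) := by simpa using he
    rw [this]
    exact isMinor_refl _

theorem Sd.step {V W : Type*} [Finite V] {G : SimpleGraph V} {H : SimpleGraph W} {x a b : V}
    (hd : Deg2 G x a b) (hG : HFree G) (h : Sd (suppress G x a b) H) : Sd G H := by
  obtain ⟨f, p, hf, ⟨h1, h2, h3, h4, h5, h6, h7⟩, h8⟩ := h
  have hab := suppress_ab hd hd.xa.ne.symm hd.xb.ne.symm
  set A : {v // v ≠ x} := ⟨a, hd.xa.ne.symm⟩ with hA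
  set B : {v // v ≠ x} := ⟨b, hd.xb.ne.symm⟩ with hB
  have hdel : IsMinor ((suppress G x a b).deleteEdges {s(A, B)}) (G.induce {x}ᶜ) := by
    refine isMinor_of_injective (f := fun v : {v // v ≠ x} => (⟨v.1, v.2⟩ : ({x}ᶜ : Set V))) ?_ ?_
    · intro u v huv
      exact Subtype.ext (congrArg Subtype.val huv)
    · intro u v huv
      rw [deleteEdges_adj] at huv
      have h1 : ¬ (u.1 = a ∧ v.1 = b ∨ u.1 = b ∧ v.1 = a) := by
        rw [← sym2_ab_iff hd.xa.ne.symm hd.xb.ne.symm]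
        intro h
        exact huv.2 (by simp [hA, hB, h])
      rcases huv.1.2 with h | h
      · exact h
      · exact absurd h h1
  refine ⟨fun w => (f w).1, fun u v h => expand hd (p h),
    fun _ _ h => hf (Subtype.ext h), ⟨?_, ?_, ?_, ?_, ?_, ?_, ?_⟩, ?_⟩
  · intro u v h
    exact expand_isPath hd _ (h1 h)
  · intro u v h
    show expand hd (p h.symm) = (expand hd (p h)).reverse
    rw [h2, expand_reverse]
  · intro u v h hD
    show (expand hd (p h)).length = 1
    rw [expand_length, h3 h hD]
    intro hmem
    apply hD
    refine ⟨h, ?_⟩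
    exact (planar_delete_vertex hG hd.xa).of_minor ((h8 h _ hmem).trans hdel)
  · intro u v h w hw
    rw [mem_expand_support] at hw
    rcases hw with ⟨_, hw⟩ | ⟨hw, _⟩
    · exact h4 h w hw
    · exact absurd hw (f w).2
  · intro u v u' v' h h' hne z hz hz'
    rw [mem_expand_support] at hz hz'
    rcases hz with ⟨hzx, hz⟩ | ⟨hzx, hz⟩
    · rcases hz' with ⟨_, hz'⟩ | ⟨hzx', _⟩
      · obtain ⟨w, hw⟩ := h5 h h' hne _ hz hz'
        exact ⟨w, congrArg Subtype.val hw⟩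
      · exact absurd hzx' hzx
    · rcases hz' with ⟨hzx', _⟩ | ⟨_, hz'⟩
      · exact absurd hzx hzx'
      · exfalso
        have a1 := Walk.fst_mem_support_of_mem_edges _ hz
        have a2 := Walk.fst_mem_support_of_mem_edges _ hz'
        have b1 := Walk.snd_mem_support_of_mem_edges _ hz
        have b2 := Walk.snd_mem_support_of_mem_edges _ hz'
        obtain ⟨w, hw⟩ := h5 h h' hne _ a1 a2
        obtain ⟨w', hw'⟩ := h5 h h' hne _ b1 b2
        rw [← hw] at a1 a2
        rw [← hw'] at b1 b2
        have hww : w ≠ w' := by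
          rintro rfl
          have : A = B := hw.symm.trans hw'
          exact hd.ne (congrArg Subtype.val this)
        apply hne
        rw [Sym2.eq_iff]
        have := h4 h w a1
        have := h4 h w' b1
        have := h4 h' w a2
        have := h4 h' w' b2
        grind
  · intro z
    by_cases hz : z = x
    · right
      obtain ⟨u, v, h, hm⟩ := h7 s(A, B) hab
      exact ⟨u, v, h, by rw [mem_expand_support]; exact Or.inr ⟨hz, hm⟩⟩
    · rcases h6 ⟨z, hz⟩ with ⟨w, hw⟩ | ⟨u, v, h, hm⟩
      · exact Or.inl ⟨w, congrArg Subtype.val hw⟩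
      · exact Or.inr ⟨u, v, h, by rw [mem_expand_support]; exact Or.inl ⟨hz, hm⟩⟩
  · intro e
    have hx : ∀ d, G.Adj x d → ∃ (u v : W) (h : H.Adj u v), s(x, d) ∈ (expand hd (p h)).edges := by
      intro d hxd
      obtain ⟨u, v, h, hm⟩ := h7 s(A, B) hab
      refine ⟨u, v, h, ?_⟩
      rw [mem_expand_edges]
      refine Or.inr ⟨?_, hm⟩
      rcases hd.only d hxd with rfl | rfl <;> simp
    induction e with
    | _ c d =>
      intro hcd
      rw [mem_edgeSet] at hcd
      by_cases hc : c = x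
      · subst hc
        exact hx d hcd
      · by_cases hdx : d = x
        · subst hdx
          rw [Sym2.eq_swap]
          exact hx c hcd.symm
        · obtain ⟨u, v, h, hm⟩ := h7 s(⟨c, hc⟩, ⟨d, hdx⟩) (suppress_adj_of _ _ hcd)
          refine ⟨u, v, h, ?_⟩
          rw [mem_expand_edges]
          exact Or.inl ⟨_, _, hcd, hm, rfl⟩
  · intro u v h e he
    rw [mem_expand_edges] at he
    rcases he with ⟨c, d, hcd, hm, rfl⟩ | ⟨he, hm⟩
    · refine (h8 h _ hm).trans ?_
      have hx : ∀ y : V, s(x, y) ≠ s(c.1, d.1) := by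
        intro y hy
        rw [Sym2.eq_iff] at hy
        rcases hy with ⟨h, _⟩ | ⟨h, _⟩
        · exact c.2 h.symm
        · exact d.2 h.symm
      refine suppress_minor_aux hd ?_ ?_ ?_
      · rw [deleteEdges_adj]; exact ⟨hd.xa, by simpa using hx a⟩
      · rw [deleteEdges_adj]; exact ⟨hd.xb, by simpa using hx b⟩
      · intro u v huv
        rw [deleteEdges_adj] at huv
        rcases huv.1.2 with h | h
        · left
          rw [deleteEdges_adj]
          refine ⟨h, ?_⟩
          intro h'
          apply huv.2
          rw [Set.mem_singleton_iff, Sym2.eq_iff] at h' ⊢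
          simpa [Subtype.ext_iff] using h'
        · exact Or.inr h
    · refine ((h8 h _ hm).trans hdel).trans ?_
      refine isMinor_of_injective (f := Subtype.val) Subtype.val_injective ?_
      intro u v huv
      rw [deleteEdges_adj]
      refine ⟨huv, ?_⟩
      intro h'
      rw [Set.mem_singleton_iff] at h'
      have hu := u.2
      have hv := v.2
      simp only [Set.mem_compl_iff, Set.mem_singleton_iff] at hu hv
      rcases he with rfl | rfl <;> rw [Sym2.eq_iff] at h' <;> tauto

theorem exists_core (n : ℕ) : ∀ {V : Type} [Finite V] (G : SimpleGraph V), Nat.card V = n →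
    HFree G → ¬ Planar G → (∀ x, ∃ y, G.Adj x y) →
    ∃ (U : Type) (H : SimpleGraph U), KConnected H 3 ∧ ¬ Planar H ∧ IsMinor H G ∧ Sd G H := by
  induction n with
  | zero =>
    intro V _ G hc hG hnp hiso
    by_cases h : KConnected G 3
    · exact ⟨V, G, h, hnp, isMinor_refl G, Sd.refl G⟩
    · obtain ⟨x, _⟩ := exists_deg2 hG hnp hiso h
      have : Nonempty V := ⟨x⟩
      exact absurd hc Nat.card_pos.ne'
  | succ n ih =>
    intro V _ G hc hG hnp hiso
    by_cases h : KConnected G 3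
    · exact ⟨V, G, h, hnp, isMinor_refl G, Sd.refl G⟩
    · obtain ⟨x, a, b, h1, h2, h3, h4, h5⟩ := exists_deg2 hG hnp hiso h
      have hd : Deg2 G x a b := ⟨h1, h2, h3, h4, h5⟩
      have hcard : Nat.card {v // v ≠ x} = n := by
        classical
        have := Fintype.ofFinite V
        rw [Nat.card_eq_fintype_card] at hc ⊢
        have := Set.card_ne_eq x
        simp only [Set.coe_setOf] at this
        omega
      obtain ⟨U, H, k1, k2, k3, k4⟩ := ih (suppress G x a b) hcard (hG.of_minor (suppress_minor hd))
        (suppress_nonplanar hd hnp) (suppress_iso_free hd hiso)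
      exact ⟨U, H, k1, k2, k3.trans (suppress_minor hd), k4.step hd hG⟩

theorem core_nonplanar {V : Type*} {G : SimpleGraph V} (h : ¬ Planar G) :
    ¬ Planar (G.induce (core G)) := by
  have key : ∀ {W : Type} {K : SimpleGraph W}, (∀ w, ∃ w', K.Adj w w') → IsMinor K G →
      IsMinor K (G.induce (core G)) := by
    intro W K hK hm
    obtain ⟨B, hB⟩ := isMinor_iff.1 hm
    have hcore : ∀ w, B w ⊆ core G := by
      intro w z hz
      by_cases hs : B w = {z}
      · obtain ⟨w', hw'⟩ := hK w
        obtain ⟨v, hv, v', _, hvv⟩ := hB.2.2 _ _ hw'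
        rw [hs] at hv
        rw [Set.mem_singleton_iff.1 hv] at hvv
        exact ⟨_, hvv⟩
      · have : ∃ y ∈ B w, y ≠ z := by
          by_contra hc
          push Not at hc
          exact hs (Set.eq_singleton_iff_unique_mem.2 ⟨hz, hc⟩)
        obtain ⟨y, hy, hyz⟩ := this
        obtain ⟨p, hp, _, q, _, _, hpq⟩ := (hB.1 w).cut (A := {z}) ⟨z, rfl, hz⟩ ⟨y, hy, hyz⟩
        rw [Set.mem_singleton_iff.1 hp] at hpq
        exact ⟨_, hpq⟩
    refine isMinor_iff.2 ⟨fun w => Subtype.val ⁻¹' (B w), ?_, ?_, ?_⟩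
    · intro w
      rw [conn_iff]
      constructor
      · obtain ⟨y, hy⟩ := (hB.1 w).nonempty
        exact ⟨⟨y, hcore w hy⟩, hy⟩
      · rintro A hA ⟨a0, ha0⟩ hcl
        have := (hB.1 w).closed (A := Subtype.val '' A) ⟨a0.1, ⟨a0, ha0, rfl⟩, hA ha0⟩ (by
          rintro _ ⟨p, hp, rfl⟩ hpB q hq hpq
          exact ⟨⟨q, hcore w hq⟩, hcl p hp _ hq hpq, rfl⟩)
        intro v hv
        obtain ⟨v', hv', hvv⟩ := this hv
        rw [← Subtype.ext hvv]; exact hv'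
    · intro w w' hww
      exact (hB.2.1 w w' hww).preimage _
    · intro w w' hww
      obtain ⟨v, hv, v', hv', hvv⟩ := hB.2.2 _ _ hww
      exact ⟨⟨v, hcore w hv⟩, hv, ⟨v', hcore w' hv'⟩, hv', hvv⟩
  intro hp
  apply h
  constructor
  · intro hm
    refine hp.1 (key ?_ hm)
    unfold K5
    simp only [top_adj]
    decide
  · intro hm
    refine hp.2 (key ?_ hm)
    rintro (w | w)
    · exact ⟨.inr 0, by simp [K33]⟩
    · exact ⟨.inl 0, by simp [K33]⟩

theorem main_reduction (AP : ∀ {U : Type} [Finite U] (H : SimpleGraph U), KConnected H 3 →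
      ¬ Planar H → HFree H → AlmostPlanar H)
    {V : Type} [Fintype V] (G : SimpleGraph V) (hnp : ¬ Planar G) (hG : HFree G) :
    ∃ (U : Type) (H : SimpleGraph U), KConnected H 3 ∧ AlmostPlanar H ∧
      IsSubdivisionWithin (G.induce (core G)) H (Dset H) := by
  have hG' : HFree (G.induce (core G)) := hG.of_minor (isMinor_induce _ _)
  obtain ⟨U, H, h1, h2, h3, h4⟩ := exists_core _ (G.induce (core G)) rfl hG' (core_nonplanar hnp) (by
    rintro ⟨x, y, hxy⟩
    exact ⟨⟨y, x, hxy.symm⟩, hxy⟩)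
  have : Finite U := Nat.finite_of_card_ne_zero (by have := h1.1; omega)
  exact ⟨U, H, h1, AP H h1 h2 (hG'.of_minor h3), h4.within⟩

open SimpleGraph

section contract
variable {V : Type*} {G : SimpleGraph V} {u v : V}

theorem contract_adj (a b : V) : (contractEdge G u v).Adj a b ↔ a ≠ b ∧ a ≠ v ∧ b ≠ v ∧
    (G.Adj a b ∨ (a = u ∧ G.Adj v b) ∨ (b = u ∧ G.Adj a v)) := by
  simp only [contractEdge, fromRel_adj]
  constructor
  · rintro ⟨h, ⟨h1, h2, h3⟩ | ⟨h1, h2, h3⟩⟩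
    · exact ⟨h, h1, h2, h3⟩
    · refine ⟨h, h2, h1, ?_⟩
      rcases h3 with h3 | h3 | h3
      · exact Or.inl h3.symm
      · exact Or.inr (Or.inr ⟨h3.1, h3.2.symm⟩)
      · exact Or.inr (Or.inl ⟨h3.1, h3.2.symm⟩)
  · rintro ⟨h, h1, h2, h3⟩
    exact ⟨h, Or.inl ⟨h1, h2, h3⟩⟩

theorem contract_adj_of {a b : V} (ha : a ≠ v) (hb : b ≠ v) (h : G.Adj a b) :
    (contractEdge G u v).Adj a b := (contract_adj a b).2 ⟨h.ne, ha, hb, Or.inl h⟩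

theorem contract_adj_iff {a b : V} (ha : a ≠ u) (hb : b ≠ u) (ha' : a ≠ v) (hb' : b ≠ v) :
    (contractEdge G u v).Adj a b ↔ G.Adj a b := by
  rw [contract_adj]
  constructor
  · rintro ⟨_, _, _, h | h | h⟩
    · exact h
    · exact absurd h.1 ha
    · exact absurd h.1 hb
  · intro h
    exact ⟨h.ne, ha', hb', Or.inl h⟩

theorem contract_not_mem {W : Type*} {K : SimpleGraph W} (hK : ∀ w, ∃ w', K.Adj w w')
    {B : W → Set V} (hB : IsModel K (contractEdge G u v) B) (w : W) : v ∉ B w := by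
  intro hv
  have hs : ∀ y ∈ B w, y = v := by
    by_contra hc
    push Not at hc
    obtain ⟨y, hy, hyv⟩ := hc
    obtain ⟨p, hp, _, q, _, _, hpq⟩ := (hB.1 w).cut (A := {v}) ⟨v, rfl, hv⟩ ⟨y, hy, hyv⟩
    exact ((contract_adj _ _).1 hpq).2.1 hp
  obtain ⟨w', hw'⟩ := hK w
  obtain ⟨p, hp, q, _, hpq⟩ := hB.2.2 _ _ hw'
  exact ((contract_adj _ _).1 hpq).2.1 (hs p hp)

theorem contract_lift (huv : G.Adj u v) {W : Type*} {K : SimpleGraph W}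
    (hK : ∀ w, ∃ w', K.Adj w w')
    {B : W → Set V} (hB : IsModel K (contractEdge G u v) B) :
    IsModel K G (fun w => B w ∪ {x | x = v ∧ u ∈ B w}) := by
  have hv := contract_not_mem hK hB
  refine ⟨?_, ?_, ?_⟩
  · intro w
    rw [conn_iff]
    refine ⟨(hB.1 w).nonempty.mono Set.subset_union_left, ?_⟩
    rintro A hA ⟨a0, ha0⟩ hcl
    have hvu : v ∈ A → u ∈ A := by
      intro h
      rcases hA h with h' | h'
      · exact absurd h' (hv w)
      · exact hcl v h u (Or.inl h'.2) huv.symm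
    have huw : u ∈ B w → u ∈ A → v ∈ A := fun h0 h => hcl u h v (Or.inr ⟨rfl, h0⟩) huv
    have hsub : B w ⊆ A := by
      refine (hB.1 w).closed ?_ ?_
      · rcases hA ha0 with h | ⟨rfl, h⟩
        · exact ⟨a0, ha0, h⟩
        · exact ⟨u, hvu ha0, h⟩
      · intro p hp hpB q hq hpq
        rcases ((contract_adj _ _).1 hpq).2.2.2 with h | ⟨rfl, h⟩ | ⟨rfl, h⟩
        · exact hcl p hp q (Or.inl hq) h
        · exact hcl v (huw hpB hp) q (Or.inl hq) h
        · exact hvu (hcl p hp v (Or.inr ⟨rfl, hq⟩) h)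
    rintro x (hx | ⟨rfl, hx⟩)
    · exact hsub hx
    · exact huw hx (hsub hx)
  · intro w w' hww
    have hd := hB.2.1 w w' hww
    rw [Set.disjoint_left] at hd ⊢
    rintro x (hx | ⟨rfl, hx⟩) (hx' | ⟨hx1, hx'⟩)
    · exact hd hx hx'
    · exact hv w (hx1 ▸ hx)
    · exact hv _ hx'
    · exact hd hx hx'
  · intro w w' hww
    obtain ⟨p, hp, q, hq, hpq⟩ := hB.2.2 _ _ hww
    rcases ((contract_adj _ _).1 hpq).2.2.2 with h | ⟨rfl, h⟩ | ⟨rfl, h⟩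
    · exact ⟨p, Or.inl hp, q, Or.inl hq, h⟩
    · exact ⟨v, Or.inr ⟨rfl, hp⟩, q, Or.inl hq, h⟩
    · exact ⟨p, Or.inl hp, v, Or.inr ⟨rfl, hq⟩, h⟩

theorem K5_nbr (w : Fin 5) : ∃ w', K5.Adj w w' := by
  unfold K5; simp only [top_adj]; revert w; decide

theorem K33_nbr (w : Fin 3 ⊕ Fin 3) : ∃ w', K33.Adj w w' := by
  rcases w with w | w
  · exact ⟨.inr 0, by simp [K33]⟩
  · exact ⟨.inl 0, by simp [K33]⟩

theorem contract_span5 (hG : HFree G) (hiso : ∀ x, ∃ y, G.Adj x y) (huv : G.Adj u v)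
    {B : Fin 5 → Set V} (hB : IsModel K5 (contractEdge G u v) B) {x : V} (hx : x ≠ v) :
    ∃ i, x ∈ B i := by
  obtain ⟨y, hy⟩ := hiso x
  obtain ⟨i, h | h⟩ := spanning5 hG (contract_lift huv K5_nbr hB) hy
  · exact ⟨i, h⟩
  · exact absurd h.1 hx

theorem contract_span33 (hG : HFree G) (hiso : ∀ x, ∃ y, G.Adj x y) (huv : G.Adj u v)
    {B : Fin 3 ⊕ Fin 3 → Set V} (hB : IsModel K33 (contractEdge G u v) B) {x : V} (hx : x ≠ v) :
    ∃ i, x ∈ B i := by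
  obtain ⟨y, hy⟩ := hiso x
  obtain ⟨i, h | h⟩ := spanning33 hG (contract_lift huv K33_nbr hB) hy
  · exact ⟨i, h⟩
  · exact absurd h.1 hx

end contract

theorem conn_split' {V : Type*} {G : SimpleGraph V} {S : Set V} (hS : Conn G S) {x y : V}
    (hx : x ∈ S) (hy : y ∈ S) (hxy : x ≠ y) : ∃ X Y, S = X ∪ Y ∧ Disjoint X Y ∧ x ∈ X ∧ y ∈ Y ∧
      Conn G X ∧ Conn G Y ∧ ∀ c ∈ Y, ∀ d ∈ S, d ≠ x → G.Adj c d → d ∈ Y := by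
  obtain ⟨C, hCS, hyC, hC, hcl⟩ := exists_component (G := G) (S \ {x}) (y := y) ⟨hy, hxy.symm⟩
  have hxC : x ∉ C := fun h => (hCS h).2 rfl
  refine ⟨S \ C, C, ?_, Set.disjoint_sdiff_left, ⟨hx, hxC⟩, hyC, ?_, hC,
    fun c hc d hd hdx h => hcl c hc d ⟨hd, hdx⟩ h⟩
  · rw [Set.diff_union_of_subset (fun z hz => (hCS hz).1)]
  · rw [conn_iff]
    refine ⟨⟨x, hx, hxC⟩, ?_⟩
    intro A hA hn hAcl
    have hxA : x ∈ A := by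
      by_contra hxA
      refine hxA (hS.closed (A := A) ?_ ?_ hx)
      · obtain ⟨a, ha⟩ := hn
        exact ⟨a, ha, (hA ha).1⟩
      · intro a ha haS b hb hab
        refine hAcl a ha b ⟨hb, fun hbC => ?_⟩ hab
        exact (hA ha).2 (hcl b hbC a ⟨haS, fun h => hxA (h ▸ ha)⟩ hab.symm)
    have := hS.closed (A := A ∪ C) ⟨x, Or.inl hxA, hx⟩ (by
      rintro a (ha | ha) haS b hb hab
      · by_cases hbC : b ∈ C
        · exact Or.inr hbC
        · exact Or.inl (hAcl a ha b ⟨hb, hbC⟩ hab)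
      · by_cases hbx : b = x
        · exact Or.inl (hbx ▸ hxA)
        · exact Or.inr (hcl a ha b ⟨hb, hbx⟩ hab))
    rintro z ⟨hz, hzC⟩
    exact (this hz).resolve_right hzC

theorem conn_split {V : Type*} {G : SimpleGraph V} {S : Set V} (hS : Conn G S) {x y : V}
    (hx : x ∈ S) (hy : y ∈ S) (hxy : x ≠ y) : ∃ X Y, S = X ∪ Y ∧ Disjoint X Y ∧ x ∈ X ∧ y ∈ Y ∧
      Conn G X ∧ Conn G Y := by
  obtain ⟨X, Y, h1, h2, h3, h4, h5, h6, _⟩ := conn_split' hS hx hy hxy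
  exact ⟨X, Y, h1, h2, h3, h4, h5, h6⟩

open SimpleGraph

theorem exists_max_of {α : Sort*} (P : α → Prop) (f : α → ℕ) (N : ℕ) (hN : ∀ a, f a ≤ N)
    (h : ∃ a, P a) : ∃ a, P a ∧ ∀ b, P b → f b ≤ f a := by
  obtain ⟨a0, h0⟩ := h
  have key : ∀ k a, P a → N - f a = k → ∃ a, P a ∧ ∀ b, P b → f b ≤ f a := by
    intro k
    induction k using Nat.strong_induction_on with
    | _ k ih =>
      intro a ha hk
      by_cases hc : ∀ b, P b → f b ≤ f a
      · exact ⟨a, ha, hc⟩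
      · push Not at hc
        obtain ⟨b, hb, hlt⟩ := hc
        have := hN b
        exact ih (N - f b) (by omega) b hb rfl
  exact key _ a0 h0 rfl

theorem nd_perms {α : Type*} {i a b c d : α} (h : [i, a, b, c, d].Nodup) :
    [i, a, c, b, d].Nodup ∧ [i, a, d, b, c].Nodup ∧ [i, b, c, a, d].Nodup ∧ [i, b, d, a, c].Nodup ∧
      [i, c, d, a, b].Nodup := by
  simp only [List.nodup_cons, List.mem_cons, List.not_mem_nil, not_or, or_false,
      not_false_eq_true, List.nodup_nil, and_true] at h ⊢
  grind


theorem bool_split {xa xb xc xd ya yb yc yd : Prop}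
    (n1 : xa → xb → yc → yd → False) (n2 : xa → xc → yb → yd → False)
    (n3 : xa → xd → yb → yc → False) (n4 : xb → xc → ya → yd → False)
    (n5 : xb → xd → ya → yc → False) (n6 : xc → xd → ya → yb → False)
    (oa : xa ∨ ya) (ob : xb ∨ yb) (oc : xc ∨ yc) (od : xd ∨ yd)
    (hX : ¬ (xa ∧ xb ∧ xc ∧ xd)) (hY : ¬ (ya ∧ yb ∧ yc ∧ yd)) :
    (xa ∧ xb ∧ xc ∧ ¬ xd ∧ ¬ ya ∧ ¬ yb ∧ ¬ yc ∧ yd) ∨ (xa ∧ xb ∧ ¬ xc ∧ xd ∧ ¬ ya ∧ ¬ yb ∧ yc ∧ ¬ yd) ∨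
      (xa ∧ ¬ xb ∧ xc ∧ xd ∧ ¬ ya ∧ yb ∧ ¬ yc ∧ ¬ yd) ∨ (¬ xa ∧ xb ∧ xc ∧ xd ∧ ya ∧ ¬ yb ∧ ¬ yc ∧ ¬ yd) ∨
      (ya ∧ yb ∧ yc ∧ ¬ yd ∧ ¬ xa ∧ ¬ xb ∧ ¬ xc ∧ xd) ∨ (ya ∧ yb ∧ ¬ yc ∧ yd ∧ ¬ xa ∧ ¬ xb ∧ xc ∧ ¬ xd) ∨
      (ya ∧ ¬ yb ∧ yc ∧ yd ∧ ¬ xa ∧ xb ∧ ¬ xc ∧ ¬ xd) ∨ (¬ ya ∧ yb ∧ yc ∧ yd ∧ xa ∧ ¬ xb ∧ ¬ xc ∧ ¬ xd) := by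
  by_cases xa <;> by_cases xb <;> by_cases xc <;> by_cases xd <;> simp_all <;> grind

theorem five_split (i : Fin 5) (P R : Fin 5 → Prop)
    (hno : ∀ j k l m, [i, j, k, l, m].Nodup → P j → P k → R l → R m → False)
    (hor : ∀ j, j ≠ i → P j ∨ R j) (hX : ¬ ∀ j, j ≠ i → P j) (hY : ¬ ∀ j, j ≠ i → R j) :
    ∃ m, m ≠ i ∧ (((∀ j, j ≠ i → (R j ↔ j = m)) ∧ (∀ j, j ≠ i → (P j ↔ j ≠ m))) ∨
      ((∀ j, j ≠ i → (P j ↔ j = m)) ∧ (∀ j, j ≠ i → (R j ↔ j ≠ m)))) := by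
  have henum : ∀ i : Fin 5, ∃ a b c d, [i, a, b, c, d].Nodup ∧ ∀ j, j ≠ i → j = a ∨ j = b ∨ j = c ∨ j = d := by
    decide
  obtain ⟨a, b, c, d, hn, hj⟩ := henum i
  have perm := nd_perms hn
  have n1 := hno a b c d hn
  have n2 := hno a c b d perm.1
  have n3 := hno a d b c perm.2.1
  have n4 := hno b c a d perm.2.2.1
  have n5 := hno b d a c perm.2.2.2.1
  have n6 := hno c d a b perm.2.2.2.2
  simp only [List.nodup_cons, List.mem_cons, List.not_mem_nil, not_or, or_false,
      not_false_eq_true, List.nodup_nil, and_true] at hn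
  obtain ⟨⟨ij, ik, il, im⟩, ⟨jk, jl, jm⟩, ⟨kl, km⟩, lm⟩ := hn
  have hX' : ¬ (P a ∧ P b ∧ P c ∧ P d) := by
    intro h; apply hX; intro j hji; rcases hj j hji with rfl | rfl | rfl | rfl
    exacts [h.1, h.2.1, h.2.2.1, h.2.2.2]
  have hY' : ¬ (R a ∧ R b ∧ R c ∧ R d) := by
    intro h; apply hY; intro j hji; rcases hj j hji with rfl | rfl | rfl | rfl
    exacts [h.1, h.2.1, h.2.2.1, h.2.2.2]
  have e1 := Ne.symm ij
  have e2 := Ne.symm ik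
  have e3 := Ne.symm il
  have e4 := Ne.symm im
  have cases := bool_split n1 n2 n3 n4 n5 n6 (hor a e1) (hor b e2) (hor c e3) (hor d e4) hX' hY'
  have fin : ∀ (P R : Fin 5 → Prop) (m : Fin 5), ((P a ↔ a = m) ∧ (P b ↔ b = m) ∧ (P c ↔ c = m) ∧
      (P d ↔ d = m) ∧ (R a ↔ a ≠ m) ∧ (R b ↔ b ≠ m) ∧ (R c ↔ c ≠ m) ∧
      (R d ↔ d ≠ m)) → (∀ j, j ≠ i → (P j ↔ j = m)) ∧ (∀ j, j ≠ i → (R j ↔ j ≠ m)) := by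
    rintro P R m ⟨p1, p2, p3, p4, r1, r2, r3, r4⟩
    constructor
    · intro j hji; rcases hj j hji with rfl | rfl | rfl | rfl <;> assumption
    · intro j hji; rcases hj j hji with rfl | rfl | rfl | rfl <;> assumption
  have ji := Ne.symm jk
  have ki := Ne.symm jl
  have li := Ne.symm jm
  have lk := Ne.symm kl
  have mk := Ne.symm km
  have ml := Ne.symm lm
  rcases cases with h | h | h | h | h | h | h | h
  · exact ⟨d, e4, Or.inl (fin _ _ d (by clear * - h jk jl jm kl km lm ji ki li lk mk ml; simp [*]))⟩
  · exact ⟨c, e3, Or.inl (fin _ _ c (by clear * - h jk jl jm kl km lm ji ki li lk mk ml; simp [*]))⟩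
  · exact ⟨b, e2, Or.inl (fin _ _ b (by clear * - h jk jl jm kl km lm ji ki li lk mk ml; simp [*]))⟩
  · exact ⟨a, e1, Or.inl (fin _ _ a (by clear * - h jk jl jm kl km lm ji ki li lk mk ml; simp [*]))⟩
  · exact ⟨d, e4, Or.inr (fin _ _ d (by clear * - h jk jl jm kl km lm ji ki li lk mk ml; simp [*]))⟩
  · exact ⟨c, e3, Or.inr (fin _ _ c (by clear * - h jk jl jm kl km lm ji ki li lk mk ml; simp [*]))⟩
  · exact ⟨b, e2, Or.inr (fin _ _ b (by clear * - h jk jl jm kl km lm ji ki li lk mk ml; simp [*]))⟩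
  · exact ⟨a, e1, Or.inr (fin _ _ a (by clear * - h jk jl jm kl km lm ji ki li lk mk ml; simp [*]))⟩

section K5case
variable {V : Type*} {Q : SimpleGraph V} {S : Set V} {u : V}

/-- contact between two sets -/
def ct (Q : SimpleGraph V) (X Z : Set V) : Prop := ∃ x ∈ X, ∃ z ∈ Z, Q.Adj x z

theorem ct.symm {X Z : Set V} (h : ct Q X Z) : ct Q Z X := by
  obtain ⟨x, hx, z, hz, h⟩ := h
  exact ⟨z, hz, x, hx, h.symm⟩

theorem ct_comm {X Z : Set V} : ct Q X Z ↔ ct Q Z X := ⟨ct.symm, ct.symm⟩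

theorem ct_union {X Y Z : Set V} : ct Q (X ∪ Y) Z ↔ ct Q X Z ∨ ct Q Y Z := by
  constructor
  · rintro ⟨x, hx | hx, z, hz, h⟩
    · exact Or.inl ⟨x, hx, z, hz, h⟩
    · exact Or.inr ⟨x, hx, z, hz, h⟩
  · rintro (⟨x, hx, z, hz, h⟩ | ⟨x, hx, z, hz, h⟩)
    · exact ⟨x, Or.inl hx, z, hz, h⟩
    · exact ⟨x, Or.inr hx, z, hz, h⟩

theorem ct.mono {X Y Z : Set V} (h : ct Q X Z) (hXY : X ⊆ Y) : ct Q Y Z := by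
  obtain ⟨x, hx, z, hz, h⟩ := h
  exact ⟨x, hXY hx, z, hz, h⟩

theorem ct_of_split {X Y : Set V} (h : Conn Q (X ∪ Y)) (hd : Disjoint X Y) (hX : X.Nonempty)
    (hY : Y.Nonempty) : ct Q X Y := by
  obtain ⟨y, hy⟩ := hY
  obtain ⟨x, hx⟩ := hX
  obtain ⟨p, hp, _, q, hq, hq', hpq⟩ := h.cut (A := X) ⟨x, hx, Or.inl hx⟩
    ⟨y, Or.inr hy, fun h' => Set.disjoint_left.1 hd h' hy⟩
  exact ⟨p, hp, q, hq.resolve_left hq', hpq⟩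

theorem mk33 (A C : Fin 3 → Set V) (hA : ∀ i, Conn Q (A i)) (hC : ∀ i, Conn Q (C i))
    (dA : ∀ i j, i ≠ j → Disjoint (A i) (A j)) (dC : ∀ i j, i ≠ j → Disjoint (C i) (C j))
    (dAC : ∀ i j, Disjoint (A i) (C j)) (h : ∀ i j, ct Q (A i) (C j)) :
    IsModel K33 Q (Sum.elim A C) := by
  refine ⟨?_, ?_, ?_⟩
  · rintro (i | i)
    · exact hA i
    · exact hC i
  · rintro (i | i) (j | j) hij
    · exact dA i j (fun h => hij (h ▸ rfl))
    · exact dAC i j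
    · exact (dAC j i).symm
    · exact dC i j (fun h => hij (h ▸ rfl))
  · rintro (i | i) (j | j) hij
    · simp [K33] at hij
    · exact h i j
    · exact (h j i).symm
    · simp [K33] at hij

structure Sp (Q : SimpleGraph V) (B : Fin 5 → Set V) (i m : Fin 5) (X Y : Set V) : Prop where
  model : IsModel K5 Q B
  im : m ≠ i
  eq : B i = X ∪ Y
  disj : Disjoint X Y
  cX : Conn Q X
  cY : Conn Q Y
  yc : ∀ j, j ≠ i → (ct Q Y (B j) ↔ j = m)
  xc : ∀ j, j ≠ i → (ct Q X (B j) ↔ j ≠ m)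

theorem K5_ct {B : Fin 5 → Set V} (hB : IsModel K5 Q B) {i j : Fin 5} (h : i ≠ j) :
    ct Q (B i) (B j) := hB.2.2 i j h

theorem K5_model_mk {B : Fin 5 → Set V} (h1 : ∀ i, Conn Q (B i))
    (h2 : ∀ i j, i ≠ j → Disjoint (B i) (B j)) (h3 : ∀ i j, i ≠ j → ct Q (B i) (B j)) :
    IsModel K5 Q B := ⟨h1, h2, fun i j h => h3 i j h.ne⟩

theorem K5_replace {B : Fin 5 → Set V} (hB : IsModel K5 Q B) {i : Fin 5} {X : Set V}
    (hX : X ⊆ B i) (hc : Conn Q X) (h : ∀ j, j ≠ i → ct Q X (B j)) :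
    IsModel K5 Q (Function.update B i X) := by
  apply K5_model_mk
  · intro j
    by_cases hj : j = i
    · subst hj; simpa using hc
    · simpa [hj] using hB.1 j
  · intro j k hjk
    by_cases hj : j = i
    · subst hj
      have hk : k ≠ j := hjk.symm
      simp only [Function.update_self, Function.update_of_ne hk]
      exact (hB.2.1 j k hjk).mono_left hX
    · by_cases hk : k = i
      · subst hk
        simp only [Function.update_self, Function.update_of_ne hj]
        exact (hB.2.1 j k hjk).mono_right hX
      · simp only [Function.update_of_ne hj, Function.update_of_ne hk]
        exact hB.2.1 j k hjk
  · intro j k hjk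
    by_cases hj : j = i
    · subst hj
      have hk : k ≠ j := hjk.symm
      simp only [Function.update_self, Function.update_of_ne hk]
      exact h k hk
    · by_cases hk : k = i
      · subst hk
        simp only [Function.update_self, Function.update_of_ne hj]
        exact (h j hj).symm
      · simp only [Function.update_of_ne hj, Function.update_of_ne hk]
        exact K5_ct hB hjk

theorem split_cases
    (hspan : ∀ B : Fin 5 → Set V, IsModel K5 Q B → ∀ x, x ∈ S ↔ ∃ i, x ∈ B i)
    (hK : ¬ IsMinor K33 Q) {B : Fin 5 → Set V} (hB : IsModel K5 Q B) {i : Fin 5} {X Y : Set V}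
    (he : B i = X ∪ Y) (hd : Disjoint X Y) (cX : Conn Q X) (cY : Conn Q Y) :
    ∃ m, Sp Q B i m X Y ∨ Sp Q B i m Y X := by
  have hXY : ct Q X Y := ct_of_split (he ▸ hB.1 i) hd cX.nonempty cY.nonempty
  have hno : ∀ j k l m, [i, j, k, l, m].Nodup → ct Q X (B j) → ct Q X (B k) → ct Q Y (B l) →
      ct Q Y (B m) → False := by
    intro j k l m hn h1 h2 h3 h4
    simp only [List.nodup_cons, List.mem_cons, List.not_mem_nil, not_or, or_false,
      not_false_eq_true, List.nodup_nil, and_true] at hn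
    obtain ⟨⟨ij, ik, il, im⟩, ⟨jk, jl, jm⟩, ⟨kl, km⟩, lm⟩ := hn
    have hXi : X ⊆ B i := he ▸ Set.subset_union_left
    have hYi : Y ⊆ B i := he ▸ Set.subset_union_right
    have dX : ∀ t, i ≠ t → Disjoint X (B t) := fun t ht => (hB.2.1 i t ht).mono_left hXi
    have dY : ∀ t, i ≠ t → Disjoint Y (B t) := fun t ht => (hB.2.1 i t ht).mono_left hYi
    refine hK (mk33 (Q := Q) ![X, B l, B m] ![Y, B j, B k] ?_ ?_ ?_ ?_ ?_ ?_).minor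
    · intro t; fin_cases t
      · exact cX
      · exact hB.1 _
      · exact hB.1 _
    · intro t; fin_cases t
      · exact cY
      · exact hB.1 _
      · exact hB.1 _
    · intro s t hst; fin_cases s <;> fin_cases t <;> first | exact absurd rfl hst | skip
      · exact dX l il
      · exact dX m im
      · exact (dX l il).symm
      · exact hB.2.1 _ _ lm
      · exact (dX m im).symm
      · exact (hB.2.1 _ _ lm).symm
    · intro s t hst; fin_cases s <;> fin_cases t <;> first | exact absurd rfl hst | skip
      · exact dY j ij
      · exact dY k ik
      · exact (dY j ij).symm
      · exact hB.2.1 _ _ jk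
      · exact (dY k ik).symm
      · exact (hB.2.1 _ _ jk).symm
    · intro s t; fin_cases s <;> fin_cases t
      · exact hd
      · exact dX j ij
      · exact dX k ik
      · exact (dY l il).symm
      · exact (hB.2.1 _ _ jl).symm
      · exact (hB.2.1 _ _ kl).symm
      · exact (dY m im).symm
      · exact (hB.2.1 _ _ jm).symm
      · exact (hB.2.1 _ _ km).symm
    · intro s t; fin_cases s <;> fin_cases t
      · exact hXY
      · exact h1
      · exact h2
      · exact h3.symm
      · exact (K5_ct hB jl).symm
      · exact (K5_ct hB kl).symm
      · exact h4.symm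
      · exact (K5_ct hB jm).symm
      · exact (K5_ct hB km).symm
  have hor : ∀ j, j ≠ i → ct Q X (B j) ∨ ct Q Y (B j) := by
    intro j hj
    rw [← ct_union, ← he]
    exact K5_ct hB hj.symm
  have hall : ∀ X' Y', B i = X' ∪ Y' → Disjoint X' Y' → Conn Q X' → Conn Q Y' →
      ¬ ∀ j, j ≠ i → ct Q X' (B j) := by
    intro X' Y' he' hd' cX' cY' hj
    have hm := K5_replace hB (i := i) (he' ▸ Set.subset_union_left) cX' hj
    obtain ⟨y, hy⟩ := cY'.nonempty
    have hyi : y ∈ B i := he' ▸ Or.inr hy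
    obtain ⟨k, hk⟩ := (hspan _ hm y).1 ((hspan _ hB y).2 ⟨i, hyi⟩)
    by_cases hki : k = i
    · subst hki
      rw [Function.update_self] at hk
      exact Set.disjoint_left.1 hd' hk hy
    · rw [Function.update_of_ne hki] at hk
      exact Set.disjoint_left.1 (hB.2.1 _ _ hki) hk hyi
  have hX := hall X Y he hd cX cY
  have hY := hall Y X (by rw [he, Set.union_comm]) hd.symm cY cX
  suffices ∃ m, m ≠ i ∧ (((∀ j, j ≠ i → (ct Q Y (B j) ↔ j = m)) ∧ (∀ j, j ≠ i → (ct Q X (B j) ↔ j ≠ m))) ∨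
      ((∀ j, j ≠ i → (ct Q X (B j) ↔ j = m)) ∧ (∀ j, j ≠ i → (ct Q Y (B j) ↔ j ≠ m)))) by
    obtain ⟨m, hm, h | h⟩ := this
    · exact ⟨m, Or.inl ⟨hB, hm, he, hd, cX, cY, h.1, h.2⟩⟩
    · exact ⟨m, Or.inr ⟨hB, hm, by rw [he, Set.union_comm], hd.symm, cY, cX, h.1, h.2⟩⟩
  exact five_split i _ _ hno hor hX hY

end K5case

open SimpleGraph

section K5case
variable {V : Type*} {Q : SimpleGraph V} {S : Set V} {u : V}

theorem Sp.ctXY {B : Fin 5 → Set V} {i m : Fin 5} {X Y : Set V} (h : Sp Q B i m X Y) : ct Q X Y :=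
  ct_of_split (h.eq ▸ h.model.1 i) h.disj h.cX.nonempty h.cY.nonempty

/-- move the side with one contact to the neighbouring branch set -/
theorem Sp.move {B : Fin 5 → Set V} {i m : Fin 5} {X Y : Set V} (h : Sp Q B i m X Y) :
    Sp Q (fun j => if j = i then X else if j = m then B m ∪ Y else B j) m i (B m) Y := by
  have hB := h.model
  have hXi : X ⊆ B i := h.eq ▸ Set.subset_union_left
  have hYi : Y ⊆ B i := h.eq ▸ Set.subset_union_right
  have dX : ∀ t, i ≠ t → Disjoint X (B t) := fun t ht => (hB.2.1 i t ht).mono_left hXi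
  have dY : ∀ t, i ≠ t → Disjoint Y (B t) := fun t ht => (hB.2.1 i t ht).mono_left hYi
  have hYm : ct Q Y (B m) := (h.yc m h.im).2 rfl
  have hmi := h.im
  have hmodel : IsModel K5 Q (fun j => if j = i then X else if j = m then B m ∪ Y else B j) := by
    apply K5_model_mk
    · intro j
      split_ifs with h1 h2
      · exact h.cX
      · obtain ⟨y, hy, b, hb, hyb⟩ := hYm
        exact (hB.1 m).union_adj h.cY hb hy hyb.symm
      · exact hB.1 j
    · intro j k hjk
      split_ifs with h1 h2 h3 h4 h5 h6
      · exact absurd (h1.trans h2.symm) hjk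
      · exact (dX m h.im.symm).union_right h.disj
      · exact dX k (fun h => h2 h.symm)
      · exact ((dX m h.im.symm).union_right h.disj).symm
      · exact absurd (h4.trans h6.symm) hjk
      · exact (hB.2.1 _ _ (by rintro rfl; exact h6 rfl)).union_left (dY k (fun h => h5 h.symm))
      · exact (dX j (fun h => h1 h.symm)).symm
      · exact ((hB.2.1 m j (fun h => h4 h.symm)).union_left (dY j (fun h => h1 h.symm))).symm
      · exact hB.2.1 _ _ hjk
    · intro j k hjk
      split_ifs with h1 h2 h3 h4 h5 h6
      · exact absurd (h1.trans h2.symm) hjk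
      · rw [ct_comm, ct_union]; exact Or.inr h.ctXY.symm
      · exact (h.xc k h2).2 h3
      · rw [ct_union]; exact Or.inr h.ctXY.symm
      · exact absurd (h4.trans h6.symm) hjk
      · rw [ct_union]; exact Or.inl (K5_ct hB (by rintro rfl; exact h6 rfl))
      · exact ((h.xc j h1).2 h4).symm
      · rw [ct_comm, ct_union]; exact Or.inl (K5_ct hB (fun h => h4 h.symm))
      · exact K5_ct hB hjk
  refine ⟨hmodel, hmi.symm, by simp [hmi], (dY m hmi.symm).symm, hB.1 m, h.cY, ?_, ?_⟩
  · intro j hj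
    split_ifs with h1
    · simp [h1, h.ctXY.symm]
    · rw [h.yc j h1]; simp [h1, hj]
  · intro j hj
    split_ifs with h1
    · rw [ct_comm, h.xc m hmi]; simp [h1]
    · simp [h1, K5_ct hB hj.symm]

theorem one_nbr
    (hspan : ∀ B : Fin 5 → Set V, IsModel K5 Q B → ∀ x, x ∈ S ↔ ∃ i, x ∈ B i)
    (hK : ¬ IsMinor K33 Q) [Finite V]
    {B : Fin 5 → Set V} {i m : Fin 5} {X Y : Set V} (h : Sp Q B i m X Y)
    (hu : u ∉ X) (hum : u ∉ B m)
    (hmax : ∀ B' i' m' X' Y', Sp Q B' i' m' X' Y' → u ∉ X' → u ∉ B' m' → Y'.ncard ≤ Y.ncard)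
    {x1 x2 y1 y2 : V} (hx1 : x1 ∈ X) (hx2 : x2 ∈ X) (hy1 : y1 ∈ Y) (hy2 : y2 ∈ Y)
    (h1 : Q.Adj x1 y1) (h2 : Q.Adj x2 y2) : x1 = x2 := by
  by_contra hne
  have key : ∀ X1 X2, X = X1 ∪ X2 → Disjoint X1 X2 → Conn Q X1 → Conn Q X2 →
      (∃ x ∈ X1, ∃ y ∈ Y, Q.Adj x y) → ∃ m', ∀ j, j ≠ i → (ct Q X2 (B j) → j = m') := by
    rintro X1 X2 rfl hd c1 c2 ⟨x, hx, y, hy, hxy⟩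
    have dY := Set.disjoint_union_left.1 h.disj
    obtain ⟨m', hm | hm⟩ := split_cases hspan hK h.model (i := i) (X := X1 ∪ Y) (Y := X2)
      (by rw [h.eq, Set.union_right_comm]) (Set.disjoint_union_left.2 ⟨hd, dY.2.symm⟩)
      (c1.union_adj h.cY hx hy hxy) c2
    · exact ⟨m', fun j hj hc => (hm.yc j hj).1 hc⟩
    · exfalso
      have hmm : m = m' := (hm.yc m h.im).1 (ct_union.2 (Or.inr ((h.yc m h.im).2 rfl)))
      subst hmm
      have := hmax _ _ _ _ _ hm (fun h => hu (Or.inr h)) hum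
      rw [Set.ncard_union_eq dY.1] at this
      have := (Set.ncard_pos (s := X1)).2 c1.nonempty
      omega
  obtain ⟨X1, X2, he, hd, hx1', hx2', c1, c2⟩ := conn_split h.cX hx1 hx2 hne
  obtain ⟨m1, hm1⟩ := key X1 X2 he hd c1 c2 ⟨x1, hx1', y1, hy1, h1⟩
  obtain ⟨m2, hm2⟩ := key X2 X1 (by rw [he, Set.union_comm]) hd.symm c2 c1 ⟨x2, hx2', y2, hy2, h2⟩
  have : ∀ i m m1 m2 : Fin 5, ∃ j, j ≠ i ∧ j ≠ m ∧ j ≠ m1 ∧ j ≠ m2 := by decide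
  obtain ⟨j, ji, jm, j1, j2⟩ := this i m m1 m2
  have := (h.xc j ji).2 jm
  rw [he, ct_union] at this
  rcases this with h | h
  · exact j2 (hm2 j ji h)
  · exact j1 (hm1 j ji h)

theorem no_sp
    (hspan : ∀ B : Fin 5 → Set V, IsModel K5 Q B → ∀ x, x ∈ S ↔ ∃ i, x ∈ B i)
    (hK : ¬ IsMinor K33 Q) [Finite V] (hadj : ∀ a b, Q.Adj a b → b ∈ S)
    (hsep : ∀ (Y : Set V) (a b : V), Y.Nonempty → Y ⊆ S →
      (∀ y ∈ Y, ∀ w, Q.Adj y w → w ∈ Y ∨ w = a ∨ w = b) → a ≠ u → b ≠ u →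
      (∃ s ∈ S, s ∉ Y ∧ s ≠ a ∧ s ≠ b) → False)
    {B : Fin 5 → Set V} {i m : Fin 5} {X Y : Set V} (h : Sp Q B i m X Y) : u ∈ X ∨ u ∈ B m := by
  by_contra hc
  rw [not_or] at hc
  obtain ⟨⟨B, i, m, X, Y⟩, ⟨h, hu, hum⟩, hmax⟩ := exists_max_of
    (fun t : (Fin 5 → Set V) × Fin 5 × Fin 5 × Set V × Set V =>
      Sp Q t.1 t.2.1 t.2.2.1 t.2.2.2.1 t.2.2.2.2 ∧ u ∉ t.2.2.2.1 ∧ u ∉ t.1 t.2.2.1)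
    (fun t => t.2.2.2.2.ncard) (Nat.card V) (fun t => Set.ncard_le_card _)
    ⟨⟨B, i, m, X, Y⟩, h, hc⟩
  dsimp only at h hu hum hmax
  have hmax' : ∀ B' i' m' X' Y', Sp Q B' i' m' X' Y' → u ∉ X' → u ∉ B' m' → Y'.ncard ≤ Y.ncard :=
    fun B' i' m' X' Y' h1 h2 h3 => hmax ⟨B', i', m', X', Y'⟩ ⟨h1, h2, h3⟩
  obtain ⟨x, hx, y, hy, hxy⟩ := h.ctXY
  obtain ⟨y', hy', w, hw, hyw⟩ := (h.yc m h.im).2 rfl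
  have hB := h.model
  have hYi : Y ⊆ B i := h.eq ▸ Set.subset_union_right
  have hXi : X ⊆ B i := h.eq ▸ Set.subset_union_left
  have hj : ∀ i m : Fin 5, ∃ j, j ≠ i ∧ j ≠ m := by decide
  obtain ⟨j, hji, hjm⟩ := hj i m
  obtain ⟨s, hs⟩ := (hB.1 j).nonempty
  refine hsep Y x w ⟨y, hy⟩ (fun z hz => (hspan B hB z).2 ⟨i, hYi hz⟩) ?_ (by rintro rfl; exact hu hx)
    (by rintro rfl; exact hum hw) ⟨s, (hspan B hB s).2 ⟨j, hs⟩, ?_, ?_, ?_⟩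
  · intro z hz t hzt
    obtain ⟨k, hk⟩ := (hspan B hB t).1 (hadj _ _ hzt)
    by_cases hki : k = i
    · subst hki
      rw [h.eq] at hk
      rcases hk with hk | hk
      · right; left
        exact one_nbr hspan hK h hu hum hmax' hk hx hz hy hzt.symm hxy
      · exact Or.inl hk
    · have hkm := (h.yc k hki).1 ⟨z, hz, t, hk, hzt⟩
      subst hkm
      right; right
      refine one_nbr hspan hK h.move hum (by simpa using hu) hmax' hk hw hz hy' hzt.symm hyw.symm
  · intro h'; exact Set.disjoint_left.1 (hB.2.1 _ _ hji) hs (hYi h')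
  · rintro rfl; exact Set.disjoint_left.1 (hB.2.1 _ _ hji) hs (hXi hx)
  · rintro rfl; exact Set.disjoint_left.1 (hB.2.1 _ _ hjm) hs hw

theorem K5_struct
    (hspan : ∀ B : Fin 5 → Set V, IsModel K5 Q B → ∀ x, x ∈ S ↔ ∃ i, x ∈ B i)
    (hK : ¬ IsMinor K33 Q) [Finite V] (hadj : ∀ a b, Q.Adj a b → b ∈ S) (huS : u ∈ S)
    (hsep : ∀ (Y : Set V) (a b : V), Y.Nonempty → Y ⊆ S →
      (∀ y ∈ Y, ∀ w, Q.Adj y w → w ∈ Y ∨ w = a ∨ w = b) → a ≠ u → b ≠ u →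
      (∃ s ∈ S, s ∉ Y ∧ s ≠ a ∧ s ≠ b) → False) (hm : IsMinor K5 Q) :
    ∃ B, IsModel K5 Q B ∧ u ∈ B 0 ∧ (∀ i, i ≠ 0 → ∃ b, B i = {b}) ∧
      ∀ X Y, B 0 = X ∪ Y → Disjoint X Y → Conn Q X → Conn Q Y → u ∈ X →
        ∃ m, Sp Q B 0 m X Y := by
  obtain ⟨B0, hB0⟩ := isMinor_iff.1 hm
  obtain ⟨i0, hi0⟩ := (hspan _ hB0 u).1 huS
  have hperm : ∀ (σ : Fin 5 ≃ Fin 5) B, IsModel K5 Q B → IsModel K5 Q (fun i => B (σ i)) :=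
    fun σ B hB => K5_model_mk (fun i => hB.1 _) (fun i j h => hB.2.1 _ _ (σ.injective.ne h))
      (fun i j h => K5_ct hB (σ.injective.ne h))
  obtain ⟨B, ⟨hB, hu⟩, hmax⟩ := exists_max_of
    (fun B : Fin 5 → Set V => IsModel K5 Q B ∧ u ∈ B 0)
    (fun B => (B 0).ncard) (Nat.card V) (fun t => Set.ncard_le_card _)
    ⟨_, hperm (Equiv.swap 0 i0) B0 hB0, by simpa using hi0⟩
  have hX : ∀ i m X Y, Sp Q B i m X Y → u ∈ X := by
    intro i m X Y h
    refine (no_sp hspan hK hadj hsep h).resolve_right ?_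
    intro hum
    have hm0 : m = 0 := by
      by_contra hm0
      exact Set.disjoint_left.1 (hB.2.1 _ _ hm0) hum hu
    subst hm0
    have := hmax _ ⟨h.move.model, by simp [h.im, hu]⟩
    rw [h.move.eq, Set.ncard_union_eq h.move.disj] at this
    have := (Set.ncard_pos (s := Y)).2 h.cY.nonempty
    omega
  refine ⟨B, hB, hu, ?_, ?_⟩
  · intro i hi
    obtain ⟨b, hb⟩ := (hB.1 i).nonempty
    refine ⟨b, Set.eq_singleton_iff_unique_mem.2 ⟨hb, ?_⟩⟩
    by_contra hc
    push Not at hc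
    obtain ⟨x, hx, hxb⟩ := hc
    obtain ⟨X, Y, he, hd, _, _, cX, cY⟩ := conn_split (hB.1 i) hx hb hxb
    have hui : u ∈ B i := by
      obtain ⟨m, h | h⟩ := split_cases hspan hK hB he hd cX cY
      · rw [he]; exact Or.inl (hX _ _ _ _ h)
      · rw [he]; exact Or.inr (hX _ _ _ _ h)
    exact Set.disjoint_left.1 (hB.2.1 _ _ hi) hui hu
  · intro X Y he hd cX cY huX
    obtain ⟨m, h | h⟩ := split_cases hspan hK hB he hd cX cY
    · exact ⟨m, h⟩
    · exact absurd (hX _ _ _ _ h) (Set.disjoint_left.1 hd huX)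

end K5case

open SimpleGraph

section mks
variable {V : Type*} {G : SimpleGraph V}

theorem no_K5h (hG : HFree G) {s0 s1 s2 s3 s4 t0 t1 : Set V}
    (hc : ∀ S ∈ [s0, s1, s2, s3, s4, t0, t1], Conn G S)
    (hd : [s0, s1, s2, s3, s4, t0, t1].Pairwise Disjoint)
    (h03 : ct G s0 s3) (h04 : ct G s0 s4) (h12 : ct G s1 s2) (h13 : ct G s1 s3) (h14 : ct G s1 s4)
    (h23 : ct G s2 s3) (h24 : ct G s2 s4) (h34 : ct G s3 s4) (k00 : ct G t0 s0) (k01 : ct G t0 s1)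
    (k10 : ct G t1 s0) (k12 : ct G t1 s2) (k : ct G t0 t1) : False := by
  apply hG.2.2.1
  have g03 := h03.symm
  have g04 := h04.symm
  have g12 := h12.symm
  have g13 := h13.symm
  have g14 := h14.symm
  have g23 := h23.symm
  have g24 := h24.symm
  have g34 := h34.symm
  have l00 := k00.symm
  have l01 := k01.symm
  have l10 := k10.symm
  have l12 := k12.symm
  have l := k.symm
  simp only [List.pairwise_cons, List.mem_cons, forall_eq_or_imp, List.not_mem_nil,
    IsEmpty.forall_iff, implies_true, and_true, List.Pairwise.nil] at hd hc
  obtain ⟨⟨d01, d02, d03, d04, d05, d06⟩, ⟨d12, d13, d14, d15, d16⟩, ⟨d23, d24, d25, d26⟩,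
    ⟨d34, d35, d36⟩, ⟨d45, d46⟩, d56⟩ := hd
  obtain ⟨c0, c1, c2, c3, c4, c5, c6⟩ := hc
  refine isMinor_iff.2 ⟨Sum.elim ![s0, s1, s2, s3, s4] ![t0, t1], ?_, ?_, ?_⟩
  · rintro (i | i) <;> fin_cases i <;> assumption
  · rintro (i | i) (j | j) <;> fin_cases i <;> fin_cases j <;> intro hne <;>
      first | exact absurd rfl hne | assumption | (apply Disjoint.symm; assumption)
  · rintro (i | i) (j | j) <;> fin_cases i <;> fin_cases j <;> intro ha <;>
      first | assumption | (exfalso; revert ha; simp [K5h])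

theorem no_K33h (hG : HFree G) {a0 a1 a2 b0 b1 b2 t0 t1 : Set V}
    (hc : ∀ S ∈ [a0, a1, a2, b0, b1, b2, t0, t1], Conn G S)
    (hd : [a0, a1, a2, b0, b1, b2, t0, t1].Pairwise Disjoint)
    (h02 : ct G a0 b2) (h10 : ct G a1 b0) (h11 : ct G a1 b1) (h12 : ct G a1 b2)
    (h20 : ct G a2 b0) (h21 : ct G a2 b1) (h22 : ct G a2 b2)
    (k00 : ct G t0 a0) (k01 : ct G t0 b0)
    (k10 : ct G t1 a0) (k12 : ct G t1 b1) (k : ct G t0 t1) : False := by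
  apply hG.2.2.2.1
  have g02 := h02.symm
  have g10 := h10.symm
  have g11 := h11.symm
  have g12 := h12.symm
  have g20 := h20.symm
  have g21 := h21.symm
  have g22 := h22.symm
  have l00 := k00.symm
  have l01 := k01.symm
  have l10 := k10.symm
  have l12 := k12.symm
  have l := k.symm
  simp only [List.pairwise_cons, List.mem_cons, forall_eq_or_imp, List.not_mem_nil,
    IsEmpty.forall_iff, implies_true, and_true, List.Pairwise.nil] at hd hc
  obtain ⟨⟨d01, d02, d03, d04, d05, d06, d07⟩, ⟨d12, d13, d14, d15, d16, d17⟩,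
    ⟨d23, d24, d25, d26, d27⟩, ⟨d34, d35, d36, d37⟩, ⟨d45, d46, d47⟩, ⟨d56, d57⟩, d67⟩ := hd
  obtain ⟨c0, c1, c2, c3, c4, c5, c6, c7⟩ := hc
  refine isMinor_iff.2 ⟨Sum.elim (Sum.elim ![a0, a1, a2] ![b0, b1, b2]) ![t0, t1], ?_, ?_, ?_⟩
  · rintro ((i | i) | i) <;> fin_cases i <;> assumption
  · rintro ((i | i) | i) ((j | j) | j) <;> fin_cases i <;> fin_cases j <;> intro hne <;>
      first | exact absurd rfl hne | assumption | (apply Disjoint.symm; assumption)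
  · rintro ((i | i) | i) ((j | j) | j) <;> fin_cases i <;> fin_cases j <;> intro ha <;>
      first | assumption | (exfalso; revert ha; simp [K33h])

theorem no_K5 (hG : HFree G) {z z' : V} (hz : G.Adj z z') {s0 s1 s2 s3 s4 : Set V}
    (hc : ∀ S ∈ [s0, s1, s2, s3, s4], Conn G S)
    (hd : [s0, s1, s2, s3, s4].Pairwise Disjoint) (hn : ∀ S ∈ [s0, s1, s2, s3, s4], z ∉ S)
    (hct : [s0, s1, s2, s3, s4].Pairwise (ct G)) : False := by
  simp only [List.pairwise_cons, List.mem_cons, forall_eq_or_imp, List.not_mem_nil,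
    IsEmpty.forall_iff, implies_true, and_true, List.Pairwise.nil] at hd hc hn hct
  obtain ⟨⟨d01, d02, d03, d04⟩, ⟨d12, d13, d14⟩, ⟨d23, d24⟩, d34⟩ := hd
  obtain ⟨⟨e01, e02, e03, e04⟩, ⟨e12, e13, e14⟩, ⟨e23, e24⟩, e34⟩ := hct
  obtain ⟨c0, c1, c2, c3, c4⟩ := hc
  have hB : IsModel K5 G ![s0, s1, s2, s3, s4] := by
    refine ⟨?_, ?_, ?_⟩
    · intro i; fin_cases i <;> assumption
    · intro i j; fin_cases i <;> fin_cases j <;> intro hne <;>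
        first | exact absurd rfl hne | assumption | (apply Disjoint.symm; assumption)
    · intro i j; fin_cases i <;> fin_cases j <;> intro hne <;>
        first | exact absurd rfl hne.ne | assumption | (apply ct.symm; assumption)
  obtain ⟨i, hi⟩ := spanning5 hG hB hz
  obtain ⟨n0, n1, n2, n3, n4⟩ := hn
  fin_cases i <;> contradiction

theorem no_K33 (hG : HFree G) {z z' : V} (hz : G.Adj z z') {a0 a1 a2 b0 b1 b2 : Set V}
    (hc : ∀ S ∈ [a0, a1, a2, b0, b1, b2], Conn G S)
    (hd : [a0, a1, a2, b0, b1, b2].Pairwise Disjoint) (hn : ∀ S ∈ [a0, a1, a2, b0, b1, b2], z ∉ S)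
    (h : ∀ S ∈ [a0, a1, a2], ∀ T ∈ [b0, b1, b2], ct G S T) : False := by
  simp only [List.pairwise_cons, List.mem_cons, forall_eq_or_imp, List.not_mem_nil,
    IsEmpty.forall_iff, implies_true, and_true, List.Pairwise.nil] at hd hc hn h
  obtain ⟨⟨d01, d02, d03, d04, d05⟩, ⟨d12, d13, d14, d15⟩, ⟨d23, d24, d25⟩, ⟨d34, d35⟩, d45⟩ := hd
  obtain ⟨⟨h00, h01, h02⟩, ⟨h10, h11, h12⟩, ⟨h20, h21, h22⟩⟩ := h
  obtain ⟨c0, c1, c2, c3, c4, c5⟩ := hc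
  have hB : IsModel K33 G (Sum.elim ![a0, a1, a2] ![b0, b1, b2]) := by
    refine ⟨?_, ?_, ?_⟩
    · rintro (i | i) <;> fin_cases i <;> assumption
    · rintro (i | i) (j | j) <;> fin_cases i <;> fin_cases j <;> intro hne <;>
        first | exact absurd rfl hne | assumption | (apply Disjoint.symm; assumption)
    · rintro (i | i) (j | j) <;> fin_cases i <;> fin_cases j <;> intro ha <;>
      first | assumption | (apply ct.symm; assumption) | (exfalso; revert ha; simp [K33])
  obtain ⟨i, hi⟩ := spanning33 hG hB hz
  obtain ⟨n0, n1, n2, n3, n4, n5⟩ := hn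
  rcases i with i | i <;> fin_cases i <;> contradiction

end mks

open SimpleGraph

section conn3
variable {V : Type*} {G : SimpleGraph V}

theorem exists_off (h3 : KConnected G 3) (x y z : V) : ∃ s, s ≠ x ∧ s ≠ y ∧ s ≠ z := by
  classical
  by_contra hc
  push Not at hc
  have h1 : (Set.univ : Set V) ⊆ (({x, y, z} : Finset V) : Set V) := by
    intro s _
    by_cases hx : s = x
    · simp [hx]
    by_cases hy : s = y
    · simp [hy]
    simp [hc s hx hy]
  have := Set.ncard_le_ncard h1 (Finset.finite_toSet _)
  rw [Set.ncard_univ, Set.ncard_coe_finset] at this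
  have h4 : ({x, y, z} : Finset V).card ≤ 3 := Finset.card_le_three
  have := h3.1
  omega

theorem sep_aux (h3 : KConnected G 3) {Y : Set V} {a b : V}
    (hcl : ∀ y ∈ Y, ∀ w, G.Adj y w → w ∈ Y ∨ w = a ∨ w = b)
    (hs : ∃ s, s ∉ Y ∧ s ≠ a ∧ s ≠ b) (hy : ∃ y ∈ Y, y ≠ a ∧ y ≠ b) : False := by
  have hc : Conn G ({a, b} : Set V)ᶜ := h3.2 _ (lt_of_le_of_lt (Set.ncard_insert_le a {b}) (by simp))
  obtain ⟨s, hsY, hsa, hsb⟩ := hs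
  obtain ⟨y, hyY, hya, hyb⟩ := hy
  have := hc.closed (A := Y) ⟨y, hyY, by simp [hya, hyb]⟩ (by
    intro p hp _ q hq hpq
    rcases hcl p hp q hpq with h | h | h
    · exact h
    · exact absurd h (by simp at hq; tauto)
    · exact absurd h (by simp at hq; tauto))
  exact hsY (this (by simp [hsa, hsb]))

theorem deg3 (h3 : KConnected G 3) {x a b : V} (ha : x ≠ a) (hb : x ≠ b) :
    ∃ w, G.Adj x w ∧ w ≠ a ∧ w ≠ b := by
  by_contra hc
  push Not at hc
  obtain ⟨s, h1, h2, h4⟩ := exists_off h3 x a b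
  refine sep_aux h3 (Y := {x}) (a := a) (b := b) ?_ ⟨s, h1, h2, h4⟩ ⟨x, rfl, ha, hb⟩
  rintro y rfl w hw
  by_cases h : w = a
  · exact .inr (.inl h)
  · exact .inr (.inr (hc w hw h))

theorem has_nbr (h3 : KConnected G 3) (x : V) : ∃ y, G.Adj x y := by
  obtain ⟨s, h1, _⟩ := exists_off h3 x x x
  obtain ⟨w, h, _⟩ := deg3 h3 h1.symm h1.symm
  exact ⟨w, h⟩

theorem sep_aux' (h3 : KConnected G 3) {Y : Set V} {a b : V} (hY : Y.Nonempty)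
    (hcl : ∀ y ∈ Y, ∀ w, G.Adj y w → w ∈ Y ∨ w = a ∨ w = b)
    (hs : ∃ s, s ∉ Y ∧ s ≠ a ∧ s ≠ b) : False := by
  by_cases hy : ∃ y ∈ Y, y ≠ a ∧ y ≠ b
  · exact sep_aux h3 hcl hs hy
  push Not at hy
  obtain ⟨y, hyY⟩ := hY
  have hYs : ∀ y ∈ Y, y = a ∨ y = b := fun y h => by
    by_cases h' : y = a
    · exact .inl h'
    · exact .inr (hy y h h')
  have hn : ∀ w, G.Adj y w → w = a ∨ w = b := fun w hw => by
    rcases hcl y hyY w hw with h | h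
    · exact hYs w h
    · exact h
  rcases hYs y hyY with rfl | rfl
  · obtain ⟨s, hs, h1, h2⟩ := hs
    by_cases hb : y = b
    · obtain ⟨w, hw⟩ := has_nbr h3 y
      rcases hn w hw with h | h
      · exact hw.ne h.symm
      · exact hw.ne (hb.trans h.symm)
    · obtain ⟨w, hw, h, _⟩ := deg3 h3 hb hb
      rcases hn w hw with h' | h'
      · exact hw.ne h'.symm
      · exact h h'
  · by_cases hb : y = a
    · obtain ⟨w, hw⟩ := has_nbr h3 y
      rcases hn w hw with h | h
      · exact hw.ne (hb.trans h.symm)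
      · exact hw.ne h.symm
    · obtain ⟨w, hw, h, _⟩ := deg3 h3 hb hb
      rcases hn w hw with h' | h'
      · exact h h'
      · exact hw.ne h'.symm

end conn3

def H6 : SimpleGraph (Fin 6) := SimpleGraph.fromRel fun a b =>
  ¬ (a = 1 ∧ b = 3) ∧ ¬ (a = 3 ∧ b = 1) ∧ ¬ (a = 3 ∧ b = 0) ∧ ¬ (a = 0 ∧ b = 3) ∧
    ¬ (a = 1 ∧ b = 4) ∧ ¬ (a = 4 ∧ b = 1)

instance : DecidableRel H6.Adj := by unfold H6; infer_instance

theorem planar_H6 : Planar H6 := by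
  apply planar_of_cert (r := Fin.val) Fin.val_injective (φ := fun x y z =>
    if ((x, y) ∈ [((0 : Fin 6), (4 : Fin 6)), (0, 2), (2, 4)] ∧ x < z ∧ z < y) ∨
     ((y, x) ∈ [((0 : Fin 6), (4 : Fin 6)), (0, 2), (2, 4)] ∧ y < z ∧ z < x) then 1 else 0)
  unfold Cert dl
  set_option synthInstance.maxHeartbeats 200000 in
  set_option synthInstance.maxSize 2000 in
  decide +kernel

open SimpleGraph

section k5case
variable {V : Type*} {G : SimpleGraph V} {u v : V}

theorem six_planar (b : Fin 5 → V) {i j k l : Fin 5} 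
    (hall : ∀ x, x = u ∨ x = v ∨ x = b i ∨ x = b j ∨ x = b k ∨ x = b l)
    (h1 : ¬ G.Adj u (b i)) (h2 : ¬ G.Adj v (b j)) : Planar (G.deleteEdges {s(u, v)}) := by
  let g : Fin 6 → V := ![b i, v, b k, u, b j, b l]
  have hg : ∀ x, ∃ a, g a = x := by
    intro x
    rcases hall x with h | h | h | h | h | h
    exacts [⟨3, h.symm⟩, ⟨1, h.symm⟩, ⟨0, h.symm⟩, ⟨4, h.symm⟩, ⟨2, h.symm⟩, ⟨5, h.symm⟩]
  choose f hf using hg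
  refine planar_H6.of_minor (isMinor_of_injective f (fun x y h => by rw [← hf x, ← hf y, h]) ?_)
  intro x y hxy
  have h0 : (G.deleteEdges {s(u, v)}).Adj (g (f x)) (g (f y)) := by rw [hf, hf]; exact hxy
  have h3 : (f x) ≠ f y := fun h => h0.ne (by rw [h])
  generalize f x = a at *
  generalize f y = c at *
  have h1' : ¬ G.Adj (b i) u := fun h => h1 h.symm
  have h2' : ¬ G.Adj (b j) v := fun h => h2 h.symm
  rw [deleteEdges_adj] at h0
  obtain ⟨h4, h5⟩ := h0
  simp only [Set.mem_singleton_iff] at h5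
  unfold H6
  rw [fromRel_adj]
  refine ⟨h3, Or.inl ⟨?_, ?_, ?_, ?_, ?_, ?_⟩⟩ <;> rintro ⟨rfl, rfl⟩
  · exact h5 (Sym2.eq_swap)
  · exact h5 rfl
  · exact h1 h4
  · exact h1' h4
  · exact h2 h4
  · exact h2' h4

theorem fin5_pick : ∀ i j m : Fin 5, i ≠ 0 → j ≠ 0 → m ≠ 0 → i ≠ j → m ≠ i → m ≠ j →
    ∃ l, l ≠ 0 ∧ l ≠ i ∧ l ≠ j ∧ l ≠ m ∧ ∀ x : Fin 5, x = 0 ∨ x = i ∨ x = j ∨ x = m ∨ x = l := by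
  decide

theorem fin5_pick' : ∀ i j : Fin 5, i ≠ 0 → j ≠ 0 → i ≠ j → ∃ m, m ≠ 0 ∧ m ≠ i ∧ m ≠ j := by
  decide

theorem AP5 [Finite V] (h3 : KConnected G 3) (hG : HFree G) (huv : G.Adj u v)
    (hK : ¬ IsMinor K33 (contractEdge G u v)) (hm : IsMinor K5 (contractEdge G u v)) :
    Planar (G.deleteEdges {s(u, v)}) := by
  have hiso := has_nbr h3
  obtain ⟨B, hB, hu0, hsing, hsplit⟩ := K5_struct (Q := contractEdge G u v) (S := {v}ᶜ) (u := u)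
    (fun B hB x => ⟨fun hx => contract_span5 hG hiso huv hB hx, fun ⟨i, hi⟩ h =>
      contract_not_mem K5_nbr hB i (by rw [← show x = v from h]; exact hi)⟩) hK
    (fun a b h => ((contract_adj a b).1 h).2.2.1) huv.ne
    (by
      intro Y a b hY hYS hcl ha hb ⟨s, hs, hsY, hsa, hsb⟩
      by_cases hu : u ∈ Y
      · refine sep_aux' h3 (Y := Y ∪ {v}) (a := a) (b := b) ⟨u, .inl hu⟩ ?_
          ⟨s, ?_, hsa, hsb⟩
        · rintro y (hy | hy) w hw
          · by_cases hwv : w = v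
            · exact .inl (.inr hwv)
            rcases hcl y hy w (contract_adj_of (hYS hy) hwv hw) with h | h
            · exact .inl (.inl h)
            · exact .inr h
          · obtain rfl : y = v := hy
            by_cases hwu : w = u
            · exact .inl (.inl (hwu ▸ hu))
            rcases hcl u hu w ((contract_adj _ _).2 ⟨Ne.symm hwu, huv.ne, hw.ne', .inr (.inl ⟨rfl, hw⟩)⟩)
              with h | h
            · exact .inl (.inl h)
            · exact .inr h
        · rintro (h | h)
          · exact hsY h
          · exact hs h
      · refine sep_aux' h3 (Y := Y) (a := a) (b := b) hY ?_ ⟨s, hsY, hsa, hsb⟩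
        intro y hy w hw
        by_cases hwv : w = v
        · rcases hcl y hy u ((contract_adj _ _).2 ⟨fun h => hu (h ▸ hy), hYS hy, huv.ne,
            .inr (.inr ⟨rfl, hwv ▸ hw⟩)⟩) with h | h | h
          · exact absurd h hu
          · exact absurd h.symm ha
          · exact absurd h.symm hb
        · exact hcl y hy w (contract_adj_of (hYS hy) hwv hw)) hm
  have hb' : ∀ i, ∃ b, i ≠ 0 → B i = {b} := fun i => by
    by_cases h : i = 0
    · exact ⟨u, fun h' => absurd h h'⟩
    · obtain ⟨b, hb⟩ := hsing i h; exact ⟨b, fun _ => hb⟩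
  choose b hb using hb'
  have hvB : ∀ i, v ∉ B i := contract_not_mem K5_nbr hB
  have hbm : ∀ i, i ≠ 0 → b i ∈ B i := fun i hi => by rw [hb i hi]; rfl
  have hbv : ∀ i, i ≠ 0 → b i ≠ v := fun i hi h => hvB i (h ▸ hbm i hi)
  have hb0 : ∀ i, i ≠ 0 → b i ∉ B 0 := fun i hi h =>
    Set.disjoint_left.1 (hB.2.1 i 0 hi) (hbm i hi) h
  have hbu : ∀ i, i ≠ 0 → b i ≠ u := fun i hi h => hb0 i hi (h ▸ hu0)
  have hbne : ∀ i j, i ≠ 0 → j ≠ 0 → i ≠ j → b i ≠ b j := fun i j hi hj hij h =>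
    Set.disjoint_left.1 (hB.2.1 i j hij) (hbm i hi) (h ▸ hbm j hj)
  have hbadj : ∀ i j, i ≠ 0 → j ≠ 0 → i ≠ j → G.Adj (b i) (b j) := fun i j hi hj hij => by
    obtain ⟨x, hx, y, hy, h⟩ := K5_ct hB hij
    rw [hb i hi] at hx; rw [hb j hj] at hy
    obtain rfl : x = b i := hx
    obtain rfl : y = b j := hy
    exact (contract_adj_iff (hbu i hi) (hbu j hj) (hbv i hi) (hbv j hj)).1 h
  have hspan : ∀ x, x ≠ v → ∃ i, x ∈ B i := fun x hx => contract_span5 hG hiso huv hB hx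
  -- components
  have comp : ∀ c ∈ B 0, c ≠ u → ∃ C m, c ∈ C ∧ C ⊆ B 0 ∧ u ∉ C ∧ Conn G C ∧ m ≠ 0 ∧
      (∀ x ∈ C, ∀ y ∈ B 0, y ≠ u → G.Adj x y → y ∈ C) ∧ (∀ j, j ≠ 0 → (ct G C {b j} ↔ j = m)) ∧
      ct G C {u} ∧ ct G C {v} := by
    intro c hc hcu
    obtain ⟨X, C, e, hd, hX, hC, cX, cC, hcl⟩ := conn_split' (hB.1 0) hu0 hc hcu.symm
    obtain ⟨m, hm⟩ := hsplit X C e hd cX cC hX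
    have huC : u ∉ C := fun h => Set.disjoint_left.1 hd hX h
    have hCB : C ⊆ B 0 := by rw [e]; exact Set.subset_union_right
    have hCv : ∀ x ∈ C, x ≠ v := fun x hx h => hvB 0 (h ▸ hCB hx)
    have hCu : ∀ x ∈ C, x ≠ u := fun x hx h => huC (h ▸ hx)
    have hctj : ∀ j, j ≠ 0 → (ct G C {b j} ↔ j = m) := by
      intro j hj
      rw [← hm.yc j hj, hb j hj]
      constructor
      · rintro ⟨x, hx, y, rfl, h⟩
        exact ⟨x, hx, b j, rfl, contract_adj_of (hCv x hx) (hbv j hj) h⟩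
      · rintro ⟨x, hx, y, rfl, h⟩
        exact ⟨x, hx, b j, rfl, (contract_adj_iff (hCu x hx) (hbu j hj) (hCv x hx) (hbv j hj)).1 h⟩
    have hnb : ∀ x ∈ C, ∀ w, G.Adj x w → w ∈ C ∨ w = u ∨ w = v ∨ w = b m := by
      intro x hx w hw
      by_cases hwv : w = v
      · exact .inr (.inr (.inl hwv))
      by_cases hwu : w = u
      · exact .inr (.inl hwu)
      obtain ⟨j, hj⟩ := hspan w hwv
      by_cases hj0 : j = 0
      · exact .inl (hcl x hx w (hj0 ▸ hj) hwu (contract_adj_of (hCv x hx) hwv hw))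
      · rw [hb j hj0] at hj
        obtain rfl : w = b j := hj
        rw [(hctj j hj0).1 ⟨x, hx, b j, rfl, hw⟩]
        exact .inr (.inr (.inr rfl))
    refine ⟨C, m, hC, hCB, huC, ?_, hm.im, ?_, hctj, ?_, ?_⟩
    · exact cC.mono fun x hx y hy h => (contract_adj_iff (hCu x hx) (hCu y hy) (hCv x hx) (hCv y hy)).1 h
    · intro x hx y hy hyu h
      exact hcl x hx y hy hyu (contract_adj_of (hCv x hx) (fun h => hvB 0 (h ▸ hy)) h)
    · by_contra hcon
      refine sep_aux' h3 (Y := C) (a := v) (b := b m) ⟨c, hC⟩ ?_ ⟨u, huC, huv.ne, (hbu m hm.im).symm⟩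
      intro x hx w hw
      rcases hnb x hx w hw with h | h | h
      · exact .inl h
      · exact absurd ⟨x, hx, w, h, hw⟩ hcon
      · exact .inr h
    · by_contra hcon
      refine sep_aux' h3 (Y := C) (a := u) (b := b m) ⟨c, hC⟩ ?_
        ⟨v, fun h => hCv v h rfl, huv.ne', (hbv m hm.im).symm⟩
      intro x hx w hw
      rcases hnb x hx w hw with h | h | h | h
      · exact .inl h
      · exact .inr (.inl h)
      · exact absurd ⟨x, hx, w, h, hw⟩ hcon
      · exact .inr (.inr h)
  have connp : ∀ p, (p = u ∨ p = v) → Conn G ((B 0 \ {u}) ∪ {p}) := by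
    intro p hp
    rw [conn_iff]
    refine ⟨⟨p, .inr rfl⟩, ?_⟩
    intro A hA hn hAcl
    have hcp : ∀ c ∈ B 0, c ≠ u → ∃ C, c ∈ C ∧ C ⊆ B 0 \ {u} ∧ Conn G C ∧ ct G C {p} := by
      intro c hc hcu
      obtain ⟨C, m, h1, h2, h3, h4, _, _, _, h5, h6⟩ := comp c hc hcu
      refine ⟨C, h1, fun x hx => ⟨h2 hx, fun h => h3 ((show x = u from h) ▸ hx)⟩, h4, ?_⟩
      rcases hp with rfl | rfl <;> assumption
    have hpA : p ∈ A := by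
      obtain ⟨a, ha⟩ := hn
      rcases hA ha with h | h
      · obtain ⟨C, h1, h2, h3, x, hx, y, hy, h⟩ := hcp a h.1 h.2
        have hCA := h3.closed (A := A) ⟨a, ha, h1⟩ (fun s hs _ t ht hst => hAcl s hs t (.inl (h2 ht)) hst)
        obtain rfl : y = p := hy
        exact hAcl x (hCA hx) y (.inr rfl) h
      · exact (show a = p from h) ▸ ha
    rintro c (hc | hc)
    · obtain ⟨C, h1, h2, h3, x, hx, y, hy, h⟩ := hcp c hc.1 hc.2
      obtain rfl : y = p := hy
      have hxA := hAcl y hpA x (.inl (h2 hx)) h.symm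
      exact h3.closed (A := A) ⟨x, hxA, hx⟩ (fun s hs _ t ht hst => hAcl s hs t (.inl (h2 ht)) hst) h1
    · exact (show c = p from hc) ▸ hpA
  have hnotall : ∀ p q, (p = u ∧ q = v ∨ p = v ∧ q = u) →
      ∃ i, i ≠ 0 ∧ ¬ ct G ((B 0 \ {u}) ∪ {p}) {b i} := by
    intro p q hpq
    by_contra hcon
    push Not at hcon
    have hpuv : p = u ∨ p = v := by rcases hpq with h | h; exacts [.inl h.1, .inr h.1]
    have hpb : ∀ i, i ≠ 0 → b i ≠ p := fun i hi => by
      rcases hpuv with rfl | rfl; exacts [hbu i hi, hbv i hi]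
    have hqb : ∀ i, i ≠ 0 → q ≠ b i := fun i hi => by
      rcases hpq with h | h <;> rw [h.2]; exacts [(hbv i hi).symm, (hbu i hi).symm]
    obtain ⟨q', hq'⟩ := hiso q
    have hqs : q ∉ ((B 0 \ {u}) ∪ {p}) := by
      rintro (h | h)
      · rcases hpq with h' | h'
        · exact hvB 0 (h'.2 ▸ h.1)
        · exact h.2 h'.2
      · rcases hpq with ⟨h1, h2⟩ | ⟨h1, h2⟩
        · exact huv.ne (h1 ▸ h2 ▸ h.symm)
        · exact huv.ne (h1 ▸ h2 ▸ h)
    have hdis : ∀ i, i ≠ 0 → Disjoint ((B 0 \ {u}) ∪ {p}) {b i} := fun i hi => by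
      rw [Set.disjoint_singleton_right]
      rintro (h | h)
      · exact hb0 i hi h.1
      · exact hpb i hi h
    refine no_K5 hG hq' (s0 := (B 0 \ {u}) ∪ {p}) (s1 := {b 1}) (s2 := {b 2}) (s3 := {b 3})
      (s4 := {b 4}) ?_ ?_ ?_ ?_
    · simp only [List.mem_cons, forall_eq_or_imp, List.not_mem_nil,
        IsEmpty.forall_iff, implies_true, and_true]
      exact ⟨connp p hpuv, conn_singleton _, conn_singleton _, conn_singleton _, conn_singleton _⟩
    · simp only [List.pairwise_cons, List.mem_cons, forall_eq_or_imp, List.not_mem_nil,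
        IsEmpty.forall_iff, implies_true, and_true, List.Pairwise.nil, Set.disjoint_singleton]
      refine ⟨⟨hdis _ (by decide), hdis _ (by decide), hdis _ (by decide), hdis _ (by decide)⟩,
        ⟨?_, ?_, ?_⟩, ⟨?_, ?_⟩, ?_⟩ <;> exact hbne _ _ (by decide) (by decide) (by decide)
    · simp only [List.mem_cons, forall_eq_or_imp, List.not_mem_nil,
        IsEmpty.forall_iff, implies_true, and_true, Set.mem_singleton_iff]
      refine ⟨hqs, ?_, ?_, ?_, ?_⟩ <;> exact hqb _ (by decide)
    · simp only [List.pairwise_cons, List.mem_cons, forall_eq_or_imp, List.not_mem_nil,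
        IsEmpty.forall_iff, implies_true, and_true, List.Pairwise.nil]
      have hh : ∀ i j, i ≠ 0 → j ≠ 0 → i ≠ j → ct G {b i} {b j} := fun i j hi hj hij =>
        ⟨_, rfl, _, rfl, hbadj i j hi hj hij⟩
      refine ⟨⟨hcon _ (by decide), hcon _ (by decide), hcon _ (by decide), hcon _ (by decide)⟩,
        ⟨?_, ?_, ?_⟩, ⟨?_, ?_⟩, ?_⟩ <;> exact hh _ _ (by decide) (by decide) (by decide)
  obtain ⟨i, hi0, hi⟩ := hnotall u v (.inl ⟨rfl, rfl⟩)
  obtain ⟨j, hj0, hj⟩ := hnotall v u (.inr ⟨rfl, rfl⟩)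
  have hor : ∀ l, l ≠ 0 → ct G ((B 0 \ {u}) ∪ {u}) {b l} ∨ ct G ((B 0 \ {u}) ∪ {v}) {b l} := by
    intro l hl
    obtain ⟨x, hx, y, hy, h⟩ := K5_ct hB (show (0 : Fin 5) ≠ l from Ne.symm hl)
    rw [hb l hl] at hy
    obtain rfl : y = b l := hy
    by_cases hxu : x = u
    · subst hxu
      rcases ((contract_adj _ _).1 h).2.2.2 with h | h | h
      · exact .inl ⟨x, .inr rfl, _, rfl, h⟩
      · exact .inr ⟨v, .inr rfl, _, rfl, h.2⟩
      · exact absurd h.1 (hbu l hl)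
    · exact .inl ⟨x, .inl ⟨hx, hxu⟩, _, rfl, (contract_adj_iff hxu (hbu l hl) (fun h : x = v => hvB 0 (h ▸ hx)) (hbv l hl)).1 h⟩
  have hij : i ≠ j := by
    rintro rfl
    rcases hor i hi0 with h | h
    · exact hi h
    · exact hj h
  have hvi : G.Adj v (b i) := by
    obtain ⟨x, hx | hx, y, rfl, h⟩ := (hor i hi0).resolve_left hi
    · exact absurd ⟨x, .inl hx, _, rfl, h⟩ hi
    · exact (show x = v from hx) ▸ h
  have huj : G.Adj u (b j) := by
    obtain ⟨x, hx | hx, y, rfl, h⟩ := (hor j hj0).resolve_right hj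
    · exact absurd ⟨x, .inl hx, _, rfl, h⟩ hj
    · exact (show x = u from hx) ▸ h
  by_cases hcomp : ∃ c ∈ B 0, c ≠ u
  · exfalso
    obtain ⟨c, hc, hcu⟩ := hcomp
    obtain ⟨C, m, hcC, hCB, huC, cC, hm0, hcl, hctC, hCu, hCv⟩ := comp c hc hcu
    have hCs : C ⊆ B 0 \ {u} := fun x hx => ⟨hCB hx, fun h => huC ((show x = u from h) ▸ hx)⟩
    have hCm : ct G C {b m} := (hctC m hm0).2 rfl
    have hmi : m ≠ i := fun h => hi ((h ▸ hCm).mono (hCs.trans Set.subset_union_left))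
    have hmj : m ≠ j := fun h => hj ((h ▸ hCm).mono (hCs.trans Set.subset_union_left))
    obtain ⟨l, hl0, hli, hlj, hlm, -⟩ := fin5_pick i j m hi0 hj0 hm0 hij hmi hmj
    have key : ∀ p q (i j : Fin 5), (p = u ∧ q = v ∨ p = v ∧ q = u) → i ≠ 0 → j ≠ 0 → i ≠ j → m ≠ i → m ≠ j →
        l ≠ i → l ≠ j → G.Adj q (b i) → G.Adj p (b j) →
        ct G ((B 0 \ {u}) ∪ {p}) {b l} → False := by
      intro p q i j hpq hi0 hj0 hij hmi hmj hli hlj hqi hpj hpl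
      have hpadj : G.Adj p q := by rcases hpq with ⟨rfl, rfl⟩ | ⟨rfl, rfl⟩; exacts [huv, huv.symm]
      have hCp : ct G C {p} := by rcases hpq with ⟨rfl, rfl⟩ | ⟨rfl, rfl⟩ <;> assumption
      have hCq : ct G C {q} := by rcases hpq with ⟨rfl, rfl⟩ | ⟨rfl, rfl⟩ <;> assumption
      have hpn : p ∉ B 0 \ {u} := by
        rcases hpq with ⟨rfl, rfl⟩ | ⟨rfl, rfl⟩
        · exact fun h => h.2 rfl
        · exact fun h => hvB 0 h.1
      have hqn : q ∉ B 0 \ {u} := by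
        rcases hpq with ⟨rfl, rfl⟩ | ⟨rfl, rfl⟩
        · exact fun h => hvB 0 h.1
        · exact fun h => h.2 rfl
      have hpb : ∀ i, i ≠ 0 → p ≠ b i := fun i hi' => by
        rcases hpq with ⟨h, -⟩ | ⟨h, -⟩ <;> rw [h]; exacts [(hbu i hi').symm, (hbv i hi').symm]
      have hqb : ∀ i, i ≠ 0 → b i ≠ q := fun i hi' => by
        rcases hpq with ⟨-, h⟩ | ⟨-, h⟩ <;> rw [h]; exacts [hbv i hi', hbu i hi']
      have hU : ∃ D, D ⊆ (B 0 \ {u}) ∧ Disjoint D C ∧ Conn G (D ∪ {p}) ∧ ct G (D ∪ {p}) {b l} := by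
        obtain ⟨x, hx | hx, y, rfl, h⟩ := hpl
        · obtain ⟨D, m', hxD, hDB, huD, cD, hm0', hcl', hctD, hDu, hDv⟩ := comp x hx.1 hx.2
          refine ⟨D, fun x hx => ⟨hDB hx, fun h => huD ((show x = u from h) ▸ hx)⟩, ?_, ?_, ?_⟩
          · by_contra hnd
            rw [Set.not_disjoint_iff] at hnd
            obtain ⟨z, hzD, hzC⟩ := hnd
            have hDC : D ⊆ C := cD.closed (A := C) ⟨z, hzC, hzD⟩ (fun s hs hsD t ht hst =>
              hcl s hs t (hDB ht) (fun h => huD (h ▸ ht)) hst)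
            exact hlm ((hctC l hl0).1 ⟨x, hDC hxD, _, rfl, h⟩)
          · have : ct G D {p} := by rcases hpq with ⟨rfl, rfl⟩ | ⟨rfl, rfl⟩ <;> assumption
            obtain ⟨s, hs, t, ht, hst⟩ := this
            exact cD.union_adj (conn_singleton p) hs ht hst
          · exact ⟨x, .inl hxD, _, rfl, h⟩
        · refine ⟨∅, Set.empty_subset _, Set.empty_disjoint _, ?_, ?_⟩
          · rw [Set.empty_union]; exact conn_singleton _
          · exact ⟨x, .inr hx, _, rfl, h⟩
      obtain ⟨D, hDs, hDC, cU, hUl⟩ := hU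
      have hh : ∀ i j, i ≠ 0 → j ≠ 0 → i ≠ j → ct G {b i} {b j} := fun i j hi hj hij =>
        ⟨_, rfl, _, rfl, hbadj i j hi hj hij⟩
      have hUb : ∀ i, i ≠ 0 → Disjoint (D ∪ {p}) {b i} := fun i hi => by
        rw [Set.disjoint_singleton_right]
        rintro (h | h)
        · exact hb0 i hi (hDs h).1
        · exact hpb i hi h.symm
      have hbC : ∀ i, i ≠ 0 → Disjoint {b i} C := fun i hi => by
        rw [Set.disjoint_singleton_left]
        exact fun h => hb0 i hi (hCB h)
      refine no_K5h hG (s0 := D ∪ {p}) (s1 := {b i}) (s2 := {b m}) (s3 := {b j}) (s4 := {b l})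
        (t0 := {q}) (t1 := C) ?_ ?_ ⟨p, .inr rfl, _, rfl, hpj⟩ hUl (hh _ _ hi0 hm0 hmi.symm)
        (hh _ _ hi0 hj0 hij) (hh _ _ hi0 hl0 hli.symm) (hh _ _ hm0 hj0 hmj) (hh _ _ hm0 hl0 hlm.symm)
        (hh _ _ hj0 hl0 hlj.symm) ⟨q, rfl, p, .inr rfl, hpadj.symm⟩ ⟨q, rfl, _, rfl, hqi⟩ ?_ hCm hCq.symm
      · simp only [List.mem_cons, forall_eq_or_imp, List.not_mem_nil,
          IsEmpty.forall_iff, implies_true, and_true]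
        exact ⟨cU, conn_singleton _, conn_singleton _, conn_singleton _, conn_singleton _,
          conn_singleton _, cC⟩
      · simp only [List.pairwise_cons, List.mem_cons, forall_eq_or_imp, List.not_mem_nil,
          IsEmpty.forall_iff, implies_true, and_true, List.Pairwise.nil, Set.disjoint_singleton]
        refine ⟨⟨hUb _ hi0, hUb _ hm0, hUb _ hj0, hUb _ hl0, ?_, ?_⟩,
          ⟨hbne _ _ hi0 hm0 hmi.symm, hbne _ _ hi0 hj0 hij, hbne _ _ hi0 hl0 hli.symm, hqb _ hi0, hbC _ hi0⟩,
          ⟨hbne _ _ hm0 hj0 hmj, hbne _ _ hm0 hl0 hlm.symm, hqb _ hm0, hbC _ hm0⟩,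
          ⟨hbne _ _ hj0 hl0 hlj.symm, hqb _ hj0, hbC _ hj0⟩, ⟨hqb _ hl0, hbC _ hl0⟩, ?_⟩
        · rw [Set.disjoint_singleton_right]
          rintro (h | h)
          · exact hqn (hDs h)
          · exact hpadj.ne h.symm
        · rw [Set.disjoint_union_left]
          exact ⟨hDC, Set.disjoint_singleton_left.2 (fun h => hpn (hCs h))⟩
        · exact Set.disjoint_singleton_left.2 (fun h => hqn (hCs h))
      · obtain ⟨s, hs, t, ht, hst⟩ := hCp
        exact ⟨s, hs, t, .inr ht, hst⟩
    rcases hor l hl0 with h | h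
    · exact key u v i j (.inl ⟨rfl, rfl⟩) hi0 hj0 hij hmi hmj hli hlj hvi huj h
    · exact key v u j i (.inr ⟨rfl, rfl⟩) hj0 hi0 hij.symm hmj hmi hlj hli huj hvi h
  · push Not at hcomp
    obtain ⟨m, hm0, hmi, hmj⟩ := fin5_pick' i j hi0 hj0 hij
    obtain ⟨l, hl0, hli, hlj, hlm, hcov⟩ := fin5_pick i j m hi0 hj0 hm0 hij hmi hmj
    refine six_planar b (i := i) (j := j) (k := m) (l := l) ?_ (fun h => hi ⟨u, .inr rfl, _, rfl, h⟩)
      (fun h => hj ⟨v, .inr rfl, _, rfl, h⟩)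
    intro x
    by_cases hx : x = v
    · exact .inr (.inl hx)
    obtain ⟨t, ht⟩ := hspan x hx
    rcases hcov t with rfl | h
    · exact .inl (hcomp x ht)
    · have hx' : t ≠ 0 := by rcases h with rfl | rfl | rfl | rfl <;> assumption
      rw [hb t hx'] at ht
      obtain rfl : x = b t := ht
      rcases h with rfl | rfl | rfl | rfl
      · exact .inr (.inr (.inl rfl))
      · exact .inr (.inr (.inr (.inl rfl)))
      · exact .inr (.inr (.inr (.inr (.inl rfl))))
      · exact .inr (.inr (.inr (.inr (.inr rfl))))
end k5case

open SimpleGraph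

section lists
variable {V : Type*} {G : SimpleGraph V}

/-- Number of occurrences of `z` in `l`. -/
noncomputable def ctn (l : List V) (z : V) : ℕ := by classical exact l.count z

/-- Indicator of equality. -/
noncomputable def one (x z : V) : ℕ := by classical exact if x = z then 1 else 0

theorem ctn_nil (z : V) : ctn ([] : List V) z = 0 := by simp [ctn]
theorem ctn_cons (x : V) (l : List V) (z : V) : ctn (x :: l) z = one x z + ctn l z := by
  classical
  simp only [ctn, one, List.count_cons, beq_iff_eq]; omega
theorem ctn_append (l l' : List V) (z : V) : ctn (l ++ l') z = ctn l z + ctn l' z := by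
  simp [ctn]
theorem ctn_reverse (l : List V) (z : V) : ctn l.reverse z = ctn l z := by simp [ctn]
theorem ctn_pos {l : List V} {z : V} : z ∈ l ↔ 0 < ctn l z := by
  classical
  simp [ctn, List.count_pos_iff]
theorem one_self (x : V) : one x x = 1 := by simp [one]
theorem one_pos' {x z : V} : 0 < one x z ↔ z = x := by
  classical
  simp only [one]; split_ifs with h
  · simp [h]
  · simp [Ne.symm h]

theorem nodup_of_ctn {l : List V} (h : ∀ z, ctn l z ≤ 1) : l.Nodup := by
  classical
  rw [List.nodup_iff_count_le_one]
  exact h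

theorem ctn_of_nodup {l : List V} (h : l.Nodup) (z : V) : ctn l z ≤ 1 := by
  classical
  exact List.nodup_iff_count_le_one.1 h z

/-- `x, l, y` is a walk. -/
def Pth (G : SimpleGraph V) (x : V) (l : List V) (y : V) : Prop :=
  List.IsChain G.Adj (x :: (l ++ [y]))

theorem pth_nil {x y : V} : Pth G x [] y ↔ G.Adj x y := by simp [Pth]

theorem chain_mid {z : V} {l1 l2 : List V} : List.IsChain G.Adj (l1 ++ z :: l2) ↔
    List.IsChain G.Adj (l1 ++ [z]) ∧ List.IsChain G.Adj (z :: l2) := List.isChain_split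

theorem pth_split {x y z : V} {l1 l2 : List V} :
    Pth G x (l1 ++ z :: l2) y ↔ Pth G x l1 z ∧ Pth G z l2 y := by
  unfold Pth
  rw [show x :: (l1 ++ z :: l2 ++ [y]) = (x :: l1) ++ z :: (l2 ++ [y]) by simp, chain_mid]
  simp

theorem Pth.rev {x y : V} {l : List V} (h : Pth G x l y) : Pth G y l.reverse x := by
  unfold Pth at *
  have : y :: (l.reverse ++ [x]) = (x :: (l ++ [y])).reverse := by simp
  rw [this, List.isChain_reverse]
  exact h.imp fun a b h => h.symm

theorem Pth.chain_left {x y : V} {l : List V} (h : Pth G x l y) : List.IsChain G.Adj (x :: l) := by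
  unfold Pth at h
  rw [show x :: (l ++ [y]) = (x :: l) ++ [y] by simp] at h
  exact h.left_of_append

theorem Pth.ends {x y : V} {l : List V} (h : Pth G x l y) : ∃ p ∈ x :: l, G.Adj p y := by
  induction l generalizing x with
  | nil => exact ⟨x, by simp, pth_nil.1 h⟩
  | cons a l ih =>
    obtain ⟨p, hp, h'⟩ := ih (x := a) ((pth_split (l1 := [])).1 h).2
    exact ⟨p, List.mem_cons_of_mem _ hp, h'⟩

/-- The vertex set of a list. -/
def LS (l : List V) : Set V := {z | z ∈ l}

theorem conn_chain {l : List V} {x : V} (h : List.IsChain G.Adj (x :: l)) : Conn G (LS (x :: l)) := by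
  induction l generalizing x with
  | nil => simpa [LS] using conn_singleton (G := G) x
  | cons a l ih =>
    rw [List.isChain_cons_cons] at h
    have : LS (x :: a :: l) = {x} ∪ LS (a :: l) := by ext z; simp [LS]
    rw [this]
    exact (conn_singleton x).union_adj (ih h.2) rfl (show a ∈ LS (a :: l) by simp [LS]) h.1

theorem conn_star {l1 l2 l3 : List V} {x : V} (h1 : List.IsChain G.Adj (x :: l1))
    (h2 : List.IsChain G.Adj (x :: l2)) (h3 : List.IsChain G.Adj (x :: l3)) :
    Conn G (LS (x :: (l1 ++ l2 ++ l3))) := by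
  have : LS (x :: (l1 ++ l2 ++ l3)) = (LS (x :: l1) ∪ LS (x :: l2)) ∪ LS (x :: l3) := by
    ext z; simp only [LS, List.mem_cons, List.mem_append, Set.mem_setOf_eq, Set.mem_union]; tauto
  rw [this]
  exact ((conn_chain h1).union_inter (conn_chain h2) ⟨x, by simp [LS], by simp [LS]⟩).union_inter
    (conn_chain h3) ⟨x, by simp [LS], by simp [LS]⟩

theorem disj_LS {l l' : List V} (h : ∀ z, ctn l z + ctn l' z ≤ 1) : Disjoint (LS l) (LS l') := by
  rw [Set.disjoint_left]
  intro z hz hz'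
  have h1 := ctn_pos.1 hz
  have h2 := ctn_pos.1 hz'
  have := h z
  omega

theorem not_mem_LS {l : List V} {z : V} (h : ctn l z = 0) : z ∉ LS l := fun hz => by
  have := ctn_pos.1 (show z ∈ l from hz); omega

/-- Data of a subdivision of `K₃,₃`. -/
structure Dat (V : Type*) where
  v1 : V
  v2 : V
  v3 : V
  va : V
  vb : V
  vc : V
  p1a : List V
  p1b : List V
  p1c : List V
  p2a : List V
  p2b : List V
  p2c : List V
  p3a : List V
  p3b : List V
  p3c : List V

/-- `D` is a subdivision of `K₃,₃` in `G`. -/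
structure SubK (G : SimpleGraph V) (D : Dat V) : Prop where
  h1a : Pth G D.v1 D.p1a D.va
  h1b : Pth G D.v1 D.p1b D.vb
  h1c : Pth G D.v1 D.p1c D.vc
  h2a : Pth G D.v2 D.p2a D.va
  h2b : Pth G D.v2 D.p2b D.vb
  h2c : Pth G D.v2 D.p2c D.vc
  h3a : Pth G D.v3 D.p3a D.va
  h3b : Pth G D.v3 D.p3b D.vb
  h3c : Pth G D.v3 D.p3c D.vc
  cnt : ∀ z, one D.v1 z + one D.v2 z + one D.v3 z + one D.va z + one D.vb z + one D.vc z +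
    ctn D.p1a z + ctn D.p1b z + ctn D.p1c z + ctn D.p2a z + ctn D.p2b z + ctn D.p2c z +
    ctn D.p3a z + ctn D.p3b z + ctn D.p3c z ≤ 1

def swap23 (D : Dat V) : Dat V :=
  ⟨D.v1, D.v3, D.v2, D.va, D.vb, D.vc, D.p1a, D.p1b, D.p1c, D.p3a, D.p3b, D.p3c, D.p2a, D.p2b, D.p2c⟩
def swap12 (D : Dat V) : Dat V :=
  ⟨D.v2, D.v1, D.v3, D.va, D.vb, D.vc, D.p2a, D.p2b, D.p2c, D.p1a, D.p1b, D.p1c, D.p3a, D.p3b, D.p3c⟩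
def swapBC (D : Dat V) : Dat V :=
  ⟨D.v1, D.v2, D.v3, D.va, D.vc, D.vb, D.p1a, D.p1c, D.p1b, D.p2a, D.p2c, D.p2b, D.p3a, D.p3c, D.p3b⟩
def swapAC (D : Dat V) : Dat V :=
  ⟨D.v1, D.v2, D.v3, D.vc, D.vb, D.va, D.p1c, D.p1b, D.p1a, D.p2c, D.p2b, D.p2a, D.p3c, D.p3b, D.p3a⟩
def swapS (D : Dat V) : Dat V :=
  ⟨D.va, D.vb, D.vc, D.v1, D.v2, D.v3, D.p1a.reverse, D.p2a.reverse, D.p3a.reverse,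
    D.p1b.reverse, D.p2b.reverse, D.p3b.reverse, D.p1c.reverse, D.p2c.reverse, D.p3c.reverse⟩

theorem SubK.swap23 {D : Dat V} (h : SubK G D) : SubK G (swap23 D) :=
  ⟨h.h1a, h.h1b, h.h1c, h.h3a, h.h3b, h.h3c, h.h2a, h.h2b, h.h2c, fun z => by
    have := h.cnt z; dsimp only [_root_.swap23]; omega⟩
theorem SubK.swap12 {D : Dat V} (h : SubK G D) : SubK G (swap12 D) :=
  ⟨h.h2a, h.h2b, h.h2c, h.h1a, h.h1b, h.h1c, h.h3a, h.h3b, h.h3c, fun z => by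
    have := h.cnt z; dsimp only [_root_.swap12]; omega⟩
theorem SubK.swapBC {D : Dat V} (h : SubK G D) : SubK G (swapBC D) :=
  ⟨h.h1a, h.h1c, h.h1b, h.h2a, h.h2c, h.h2b, h.h3a, h.h3c, h.h3b, fun z => by
    have := h.cnt z; dsimp only [_root_.swapBC]; omega⟩
theorem SubK.swapAC {D : Dat V} (h : SubK G D) : SubK G (swapAC D) :=
  ⟨h.h1c, h.h1b, h.h1a, h.h2c, h.h2b, h.h2a, h.h3c, h.h3b, h.h3a, fun z => by
    have := h.cnt z; dsimp only [_root_.swapAC]; omega⟩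
theorem SubK.swapS {D : Dat V} (h : SubK G D) : SubK G (swapS D) :=
  ⟨h.h1a.rev, h.h2a.rev, h.h3a.rev, h.h1b.rev, h.h2b.rev, h.h3b.rev, h.h1c.rev, h.h2c.rev, h.h3c.rev,
   fun z => by
    have := h.cnt z; simp only [_root_.swapS, ctn_reverse]; omega⟩

theorem ct_of_pth {x y : V} {l : List V} (h : Pth G x l y) {X : List V} (hX : ∀ z ∈ x :: l, z ∈ X) :
    ct G (LS X) (LS [y]) := by
  obtain ⟨p, hp, h⟩ := h.ends
  exact ⟨p, hX p hp, y, by simp [LS], h⟩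

theorem SubK.span (hG : HFree G) {D : Dat V} (h : SubK G D) {z z' : V} (hz : G.Adj z z') :
    one D.v1 z + one D.v2 z + one D.v3 z + one D.va z + one D.vb z + one D.vc z +
    ctn D.p1a z + ctn D.p1b z + ctn D.p1c z + ctn D.p2a z + ctn D.p2b z + ctn D.p2c z +
    ctn D.p3a z + ctn D.p3b z + ctn D.p3c z = 1 := by
  by_contra hne
  have hc := h.cnt
  have h0 := hc z
  refine no_K33 hG hz (a0 := LS (D.v1 :: (D.p1a ++ D.p1b ++ D.p1c)))
    (a1 := LS (D.v2 :: (D.p2a ++ D.p2b ++ D.p2c))) (a2 := LS (D.v3 :: (D.p3a ++ D.p3b ++ D.p3c)))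
    (b0 := LS [D.va]) (b1 := LS [D.vb]) (b2 := LS [D.vc]) ?_ ?_ ?_ ?_
  · simp only [List.mem_cons, forall_eq_or_imp, List.not_mem_nil,
        IsEmpty.forall_iff, implies_true, and_true]
    exact ⟨conn_star h.h1a.chain_left h.h1b.chain_left h.h1c.chain_left, conn_star h.h2a.chain_left h.h2b.chain_left h.h2c.chain_left,
      conn_star h.h3a.chain_left h.h3b.chain_left h.h3c.chain_left, conn_chain (by simp), conn_chain (by simp),
      conn_chain (by simp)⟩
  · simp only [List.pairwise_cons, List.mem_cons, forall_eq_or_imp, List.not_mem_nil,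
        IsEmpty.forall_iff, implies_true, and_true, List.Pairwise.nil]
    refine ⟨⟨?_, ?_, ?_, ?_, ?_⟩, ⟨?_, ?_, ?_, ?_⟩, ⟨?_, ?_, ?_⟩, ⟨?_, ?_⟩, ?_⟩ <;>
    · refine disj_LS fun z => ?_
      have := hc z
      simp only [ctn_cons, ctn_append, ctn_nil]
      omega
  · simp only [List.mem_cons, forall_eq_or_imp, List.not_mem_nil,
        IsEmpty.forall_iff, implies_true, and_true]
    refine ⟨?_, ?_, ?_, ?_, ?_, ?_⟩ <;>
    · refine not_mem_LS ?_
      simp only [ctn_cons, ctn_append, ctn_nil]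
      omega
  · simp only [List.mem_cons, forall_eq_or_imp, List.not_mem_nil,
        IsEmpty.forall_iff, implies_true, and_true]
    refine ⟨⟨ct_of_pth h.h1a ?_, ct_of_pth h.h1b ?_, ct_of_pth h.h1c ?_⟩,
      ⟨ct_of_pth h.h2a ?_, ct_of_pth h.h2b ?_, ct_of_pth h.h2c ?_⟩,
      ⟨ct_of_pth h.h3a ?_, ct_of_pth h.h3b ?_, ct_of_pth h.h3c ?_⟩⟩ <;>
    · simp only [List.mem_cons, List.mem_append]; tauto

theorem SubK.noH (hG : HFree G) {D : Dat V} (h : SubK G D) {x y : V} (hx : x ∈ D.p1b) (hy : y ∈ D.p1c) :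
    ¬ G.Adj x y := by
  intro hxy
  have hc := h.cnt
  obtain ⟨s, t, hst⟩ := List.append_of_mem hx
  obtain ⟨s', t', hst'⟩ := List.append_of_mem hy
  have h1b := h.h1b
  have h1c := h.h1c
  rw [hst] at h1b hc
  rw [hst'] at h1c hc
  rw [pth_split] at h1b h1c
  simp only [ctn_cons, ctn_append] at hc
  refine no_K33h hG (a0 := LS (D.v1 :: (D.p1a ++ s ++ s')))
    (a1 := LS (D.v2 :: (D.p2a ++ D.p2b ++ D.p2c))) (a2 := LS (D.v3 :: (D.p3a ++ D.p3b ++ D.p3c)))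
    (b0 := LS (D.vb :: t.reverse)) (b1 := LS (D.vc :: t'.reverse)) (b2 := LS [D.va]) (t0 := LS [x]) (t1 := LS [y])
    ?_ ?_ ?_ ?_ ?_ ?_ ?_ ?_ ?_ ?_ ?_ ?_ ?_ ?_
  · simp only [List.mem_cons, forall_eq_or_imp, List.not_mem_nil,
        IsEmpty.forall_iff, implies_true, and_true]
    exact ⟨conn_star h.h1a.chain_left h1b.1.chain_left h1c.1.chain_left, conn_star h.h2a.chain_left h.h2b.chain_left h.h2c.chain_left,
      conn_star h.h3a.chain_left h.h3b.chain_left h.h3c.chain_left, conn_chain h1b.2.rev.chain_left, conn_chain h1c.2.rev.chain_left,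
      conn_chain (by simp), conn_chain (by simp), conn_chain (by simp)⟩
  · simp only [List.pairwise_cons, List.mem_cons, forall_eq_or_imp, List.not_mem_nil,
        IsEmpty.forall_iff, implies_true, and_true, List.Pairwise.nil]
    refine ⟨⟨?_, ?_, ?_, ?_, ?_, ?_, ?_⟩, ⟨?_, ?_, ?_, ?_, ?_, ?_⟩, ⟨?_, ?_, ?_, ?_, ?_⟩,
      ⟨?_, ?_, ?_, ?_⟩, ⟨?_, ?_, ?_⟩, ⟨?_, ?_⟩, ?_⟩ <;>
    · refine disj_LS fun z => ?_
      have := hc z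
      simp only [ctn_cons, ctn_append, ctn_nil, ctn_reverse]
      omega
  · exact ct_of_pth h.h1a (by simp only [List.mem_cons, List.mem_append]; tauto)
  · obtain ⟨p, hp, h⟩ := h.h2b.ends
    exact ⟨p, by simp only [LS, Set.mem_setOf_eq, List.mem_cons, List.mem_append] at *; tauto, D.vb, by simp [LS], h⟩
  · obtain ⟨p, hp, h⟩ := h.h2c.ends
    exact ⟨p, by simp only [LS, Set.mem_setOf_eq, List.mem_cons, List.mem_append] at *; tauto, D.vc, by simp [LS], h⟩
  · exact ct_of_pth h.h2a (by simp only [List.mem_cons, List.mem_append]; tauto)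
  · obtain ⟨p, hp, h⟩ := h.h3b.ends
    exact ⟨p, by simp only [LS, Set.mem_setOf_eq, List.mem_cons, List.mem_append] at *; tauto, D.vb, by simp [LS], h⟩
  · obtain ⟨p, hp, h⟩ := h.h3c.ends
    exact ⟨p, by simp only [LS, Set.mem_setOf_eq, List.mem_cons, List.mem_append] at *; tauto, D.vc, by simp [LS], h⟩
  · exact ct_of_pth h.h3a (by simp only [List.mem_cons, List.mem_append]; tauto)
  · refine (ct_of_pth h1b.1 ?_).symm
    simp only [List.mem_cons, List.mem_append]; tauto
  · refine (ct_of_pth h1b.2.rev ?_).symm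
    exact fun z hz => hz
  · refine (ct_of_pth h1c.1 ?_).symm
    simp only [List.mem_cons, List.mem_append]; tauto
  · refine (ct_of_pth h1c.2.rev ?_).symm
    exact fun z hz => hz
  · exact ⟨x, by simp [LS], y, by simp [LS], hxy⟩
end lists

open SimpleGraph

section extremal
variable {V : Type*} {G : SimpleGraph V}

theorem SubK.short [Finite V] (h3 : KConnected G 3) (hG : HFree G) {D : Dat V} (h : SubK G D) {l : List V}
    (hl : Pth G D.v1 l D.vb) (hle : ∀ z, ctn l z ≤ ctn D.p1b z) {z : V} (hz : z ∈ D.p1b) : z ∈ l := by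
  have h' : SubK G { D with p1b := l } :=
    ⟨h.h1a, hl, h.h1c, h.h2a, h.h2b, h.h2c, h.h3a, h.h3b, h.h3c, fun w => by
      have h1 := h.cnt w; have h2 := hle w; dsimp only; omega⟩
  obtain ⟨w, hw⟩ := has_nbr h3 z
  have h1 := h'.span hG hw
  have h2 := h.cnt z
  have h3 := hle z
  have h4 := ctn_pos.1 hz
  rw [ctn_pos]
  dsimp only at h1
  omega

/-- The edge `uv` occurs on the list `l`. -/
def HasE (u v : V) (l : List V) : Prop := [u, v] <:+: l ∨ [v, u] <:+: l

theorem HasE.rev {u v : V} {l : List V} (h : HasE u v l) : HasE u v l.reverse := by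
  rcases h with h | h
  · obtain ⟨a, b, rfl⟩ := h
    right; exact ⟨b.reverse, a.reverse, by simp⟩
  · obtain ⟨a, b, rfl⟩ := h
    left; exact ⟨b.reverse, a.reverse, by simp⟩

theorem HasE.mono {u v : V} {l l' : List V} (h : HasE u v l) (hl : l <:+: l') : HasE u v l' :=
  h.imp (fun h => h.trans hl) (fun h => h.trans hl)

structure Good (G : SimpleGraph V) (u v : V) (D : Dat V) : Prop where
  sub : SubK G D
  ne : D.p1a ≠ []
  hE : HasE u v (D.v1 :: (D.p1a ++ [D.va]))

def psum (D : Dat V) : ℕ := D.p1b.length + D.p1c.length + D.p2a.length + D.p3a.length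

structure Opt (G : SimpleGraph V) (u v : V) (D : Dat V) : Prop where
  good : Good G u v D
  len : ∀ D', Good G u v D' → D'.p1a.length ≤ D.p1a.length
  sum : ∀ D', Good G u v D' → D'.p1a.length = D.p1a.length → psum D ≤ psum D'

variable {u v : V}

theorem Good.swap23 {D : Dat V} (h : Good G u v D) : Good G u v (swap23 D) :=
  ⟨h.sub.swap23, h.ne, h.hE⟩
theorem Good.swapBC {D : Dat V} (h : Good G u v D) : Good G u v (swapBC D) :=
  ⟨h.sub.swapBC, h.ne, h.hE⟩
theorem Good.swapS {D : Dat V} (h : Good G u v D) : Good G u v (swapS D) :=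
  ⟨h.sub.swapS, by simpa [_root_.swapS] using h.ne, by simpa [_root_.swapS] using h.hE.rev⟩

theorem Opt.swap23 {D : Dat V} (h : Opt G u v D) : Opt G u v (swap23 D) :=
  ⟨h.good.swap23, h.len, fun D' g e => by
    have := h.sum D' g e; simp only [psum, _root_.swap23] at *; omega⟩
theorem Opt.swapBC {D : Dat V} (h : Opt G u v D) : Opt G u v (swapBC D) :=
  ⟨h.good.swapBC, h.len, fun D' g e => by
    have := h.sum D' g e; simp only [psum, _root_.swapBC] at *; omega⟩
theorem Opt.swapS {D : Dat V} (h : Opt G u v D) : Opt G u v (swapS D) :=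
  ⟨h.good.swapS, fun D' g => by simpa [_root_.swapS] using h.len D' g, fun D' g e => by
    have := h.sum D' g (by simpa [_root_.swapS] using e)
    simp only [psum, _root_.swapS, List.length_reverse] at *; omega⟩

theorem exists_opt [Finite V] (h : ∃ D, Good G u v D) : ∃ D, Opt G u v D := by
  classical
  have : Fintype V := Fintype.ofFinite V
  obtain ⟨D0, h0, h1⟩ := exists_max_of (fun D => Good G u v D) (fun D => if Good G u v D then D.p1a.length else 0)
    (Fintype.card V) (fun D => by
      split_ifs with g
      · refine List.Nodup.length_le_card (nodup_of_ctn fun z => ?_)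
        have := g.sub.cnt z; omega
      · omega) h
  have hm : ∀ D', Good G u v D' → D'.p1a.length ≤ D0.p1a.length := fun D' g => by
    simpa [g, h0] using h1 D' g
  let P : ℕ → Prop := fun n => ∃ D, Good G u v D ∧ D.p1a.length = D0.p1a.length ∧ psum D = n
  have hP : ∃ n, P n := ⟨psum D0, D0, h0, rfl, rfl⟩
  obtain ⟨D, g, hl, hs⟩ := Nat.find_spec hP
  exact ⟨D, g, fun D' g' => by rw [hl]; exact hm D' g', fun D' g' e => by
    rw [hs]; exact Nat.find_min' hP ⟨D', g', e.trans hl, rfl⟩⟩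

theorem Good.dropped [Finite V] (h3 : KConnected G 3) (hG : HFree G) {D D' : Dat V} (h : Good G u v D)
    (h' : SubK G D') (hlt : ∀ z ∈ D.p1a,
     one D'.v1 z + one D'.v2 z + one D'.v3 z + one D'.va z + one D'.vb z + one D'.vc z +
    ctn D'.p1a z + ctn D'.p1b z + ctn D'.p1c z + ctn D'.p2a z + ctn D'.p2b z + ctn D'.p2c z +
    ctn D'.p3a z + ctn D'.p3b z + ctn D'.p3c z = 0) : False := by
  obtain ⟨z, hz⟩ := List.exists_mem_of_ne_nil _ h.ne
  obtain ⟨w, hw⟩ := has_nbr h3 z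
  have h1 := h'.span hG hw
  have h2 := hlt z hz
  omega

theorem Opt.side2 [Finite V] (h3 : KConnected G 3) (hG : HFree G) {D : Dat V} (h : Opt G u v D)
    {s t : List V} {x y : V} (hb : D.p1b = s ++ x :: t) (hxy : G.Adj x y)
    (hy : y = D.v2 ∨ y ∈ D.p2a ∨ y ∈ D.p2b ∨ y ∈ D.p2c) : False := by
  have g := h.good.sub
  have hc := g.cnt
  have h1b := g.h1b
  rw [hb] at h1b hc
  rw [pth_split] at h1b
  simp only [ctn_cons, ctn_append] at hc
  rcases hy with rfl | hy | hy | hy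
  · have := h.sum { D with vb := x, p1b := s, p2b := [], p3b := D.p3b ++ D.vb :: t.reverse }
      ⟨⟨g.h1a, h1b.1, g.h1c, g.h2a, pth_nil.2 hxy.symm, g.h2c, g.h3a, pth_split.2 ⟨g.h3b, h1b.2.rev⟩, g.h3c,
        fun z => by
          have := hc z
          simp only [ctn_cons, ctn_append, ctn_nil, ctn_reverse]; omega⟩, h.good.ne, h.good.hE⟩ rfl
    simp only [psum, hb, List.length_append, List.length_cons] at this
    omega
  · obtain ⟨w1, w2, hw⟩ := List.append_of_mem hy
    have h2a := g.h2a
    rw [hw] at h2a hc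
    rw [pth_split] at h2a
    simp only [ctn_cons, ctn_append] at hc
    refine h.good.dropped h3 hG (D' := { D with v1 := x, va := y, p1a := [], p1b := t, p1c := s.reverse ++ D.v1 :: D.p1c, p2a := w1, p3a := D.p3a ++ D.va :: w2.reverse})
      ⟨pth_nil.2 hxy, h1b.2, pth_split.2 ⟨h1b.1.rev, g.h1c⟩, h2a.1, g.h2b, g.h2c, pth_split.2 ⟨g.h3a, h2a.2.rev⟩, g.h3b, g.h3c, fun z => ?_⟩ fun z hz => ?_
    · have := hc z
      simp only [ctn_cons, ctn_append, ctn_nil, ctn_reverse]; omega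
    · have := hc z
      rw [ctn_pos] at hz
      simp only [ctn_cons, ctn_append, ctn_nil, ctn_reverse]; omega
  · refine (g.swapS.swap12.swapAC).noH hG (x := y) (y := x) ?_ ?_ hxy.symm
    · simpa [_root_.swapS, _root_.swap12, _root_.swapAC] using hy
    · simp [_root_.swapS, _root_.swap12, _root_.swapAC, hb]
  · obtain ⟨w1, w2, hw⟩ := List.append_of_mem hy
    have h2c := g.h2c
    rw [hw] at h2c hc
    rw [pth_split] at h2c
    simp only [ctn_cons, ctn_append] at hc
    have := h.len { D with v1 := x, vc := y, p1a := s.reverse ++ D.v1 :: D.p1a, p1b := t, p1c := [], p2c := w1, p3c := D.p3c ++ D.vc :: w2.reverse}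
      ⟨⟨pth_split.2 ⟨h1b.1.rev, g.h1a⟩, h1b.2, pth_nil.2 hxy, g.h2a, g.h2b, h2c.1, g.h3a, g.h3b, pth_split.2 ⟨g.h3c, h2c.2.rev⟩, fun z => by
        have := hc z
        simp only [ctn_cons, ctn_append, ctn_nil, ctn_reverse]; omega⟩, by simp, h.good.hE.mono
          ⟨x :: s.reverse, [], by simp⟩⟩
    simp only [List.length_append, List.length_cons] at this
    omega

set_option maxHeartbeats 2000000 in
theorem Opt.p1b_nil [Finite V] (h3 : KConnected G 3) (hG : HFree G) {D : Dat V} (h : Opt G u v D) :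
    D.p1b = [] := by
  by_contra hne
  obtain ⟨x, hx⟩ := List.exists_mem_of_ne_nil _ hne
  obtain ⟨s, t, hb⟩ := List.append_of_mem hx
  have g := h.good.sub
  have hc := g.cnt
  have h1b := g.h1b
  rw [hb] at h1b hc
  rw [pth_split] at h1b
  simp only [ctn_cons, ctn_append] at hc
  have hxx := hc x
  rw [one_self] at hxx
  have hx1 : x ∉ D.v1 :: s := fun hm => by
    rw [ctn_pos, ctn_cons] at hm; omega
  have hx2 : x ∉ t ++ [D.vb] := fun hm => by
    rw [ctn_pos, ctn_append, ctn_cons, ctn_nil] at hm; omega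
  obtain ⟨y, hxy, hya, hyb⟩ := deg3 h3 (x := x) (a := (D.v1 :: s).getLast (by simp))
    (b := (t ++ [D.vb]).head (by simp)) (fun e => hx1 (e ▸ List.getLast_mem _))
    (fun e => hx2 (e ▸ List.head_mem _))
  have hsp := g.span hG hxy.symm
  have hyx : y ≠ x := hxy.ne'
  have hyx' : one x y = 0 := by
    by_contra h0
    exact hyx (one_pos'.1 (Nat.pos_of_ne_zero h0))
  have hsh := fun {l : List V} (hl : Pth G D.v1 l D.vb) (hle : ∀ z, ctn l z ≤ ctn D.p1b z) (z : V)
    (hz : z ∈ D.p1b) => g.short h3 hG hl hle hz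
  have c1 : y ≠ D.v1 := by
    rintro rfl
    have h1 := hsh (l := x :: t) ((pth_split (l1 := [])).2 ⟨pth_nil.2 hxy.symm, h1b.2⟩)
      (fun z => by simp only [hb, ctn_cons, ctn_append]; omega)
    cases s with
    | nil => simp at hya
    | cons w s =>
      have h2 := h1 w (by simp [hb])
      have h3 := hc w
      rw [ctn_pos, ctn_cons] at h2
      rw [ctn_cons, one_self] at h3
      omega
  have c2 : y ≠ D.vb := by
    rintro rfl
    have h1 := hsh (l := s ++ [x]) (pth_split.2 ⟨h1b.1, pth_nil.2 hxy⟩)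
      (fun z => by simp only [hb, ctn_cons, ctn_append, ctn_nil]; omega)
    cases t with
    | nil => simp at hyb
    | cons w s =>
      have h2 := h1 w (by simp [hb])
      have h3 := hc w
      rw [ctn_pos, ctn_append, ctn_cons, ctn_nil] at h2
      rw [ctn_cons, one_self] at h3
      omega
  have c3 : y ∉ s := by
    intro hy
    obtain ⟨s1, s2, rfl⟩ := List.append_of_mem hy
    have h1 := hsh (l := s1 ++ y :: x :: t) (pth_split.2 ⟨(pth_split.1 h1b.1).1,
      (pth_split (l1 := [])).2 ⟨pth_nil.2 hxy.symm, h1b.2⟩⟩)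
      (fun z => by simp only [hb, ctn_cons, ctn_append]; omega)
    cases s2 with
    | nil => simp at hya
    | cons w s =>
      have h2 := h1 w (by simp [hb])
      have h3 := hc w
      rw [ctn_pos, ctn_append, ctn_cons, ctn_cons] at h2
      simp only [ctn_append, ctn_cons, one_self] at h3
      omega
  have c4 : y ∉ t := by
    intro hy
    obtain ⟨s1, s2, rfl⟩ := List.append_of_mem hy
    have h1 := hsh (l := s ++ x :: y :: s2) (pth_split.2 ⟨h1b.1,
      (pth_split (l1 := [])).2 ⟨pth_nil.2 hxy, (pth_split.1 h1b.2).2⟩⟩)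
      (fun z => by simp only [hb, ctn_cons, ctn_append]; omega)
    cases s1 with
    | nil => simp at hyb
    | cons w s =>
      have h2 := h1 w (by simp [hb])
      have h3 := hc w
      rw [ctn_pos, ctn_append, ctn_cons, ctn_cons] at h2
      simp only [ctn_append, ctn_cons, one_self] at h3
      omega
  have c5 : y ∉ D.p1c := fun hy => g.noH hG hx hy hxy
  have c6 : y ∉ D.p1a := fun hy => g.swapAC.noH hG hx hy hxy
  have c7 : y ≠ D.va := by
    rintro rfl
    refine h.good.dropped h3 hG (D' := { D with v1 := x, p1a := [], p1b := t, p1c := s.reverse ++ D.v1 :: D.p1c})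
      ⟨pth_nil.2 hxy, h1b.2, pth_split.2 ⟨h1b.1.rev, g.h1c⟩, g.h2a, g.h2b, g.h2c, g.h3a, g.h3b, g.h3c, fun z => ?_⟩ fun z hz => ?_
    · have := hc z
      simp only [ctn_cons, ctn_append, ctn_nil, ctn_reverse]; omega
    · have := hc z
      rw [ctn_pos] at hz
      simp only [ctn_cons, ctn_append, ctn_nil, ctn_reverse]; omega
  have c8 : y ≠ D.vc := by
    rintro rfl
    have := h.len { D with v1 := x, p1a := s.reverse ++ D.v1 :: D.p1a, p1b := t, p1c := [] }
      ⟨⟨pth_split.2 ⟨h1b.1.rev, g.h1a⟩, h1b.2, pth_nil.2 hxy, g.h2a, g.h2b, g.h2c, g.h3a, g.h3b, g.h3c, fun z => by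
        have := hc z
        simp only [ctn_cons, ctn_append, ctn_nil, ctn_reverse]; omega⟩, by simp, h.good.hE.mono
          ⟨x :: s.reverse, [], by simp⟩⟩
    simp only [List.length_append, List.length_cons] at this
    omega
  have c9 := fun hy => h.side2 h3 hG hb hxy (y := y) hy
  have c10 := fun hy => h.swap23.side2 h3 hG hb hxy (y := y) hy
  simp only [hb, ctn_append, ctn_cons] at hsp
  rw [Ne, ← one_pos'] at c1 c2 c7 c8
  rw [ctn_pos] at c3 c4 c5 c6
  simp only [_root_.swap23, ← one_pos', ctn_pos, imp_false] at c9 c10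
  omega

theorem Opt.nil [Finite V] (h3 : KConnected G 3) (hG : HFree G) {D : Dat V} (h : Opt G u v D) :
    D.p1b = [] ∧ D.p1c = [] ∧ D.p2a = [] ∧ D.p3a = [] :=
  ⟨h.p1b_nil h3 hG, h.swapBC.p1b_nil h3 hG, by simpa [_root_.swapS] using h.swapS.p1b_nil h3 hG, by
    simpa [_root_.swapS, _root_.swapBC] using h.swapS.swapBC.p1b_nil h3 hG⟩
end extremal

open SimpleGraph

section existence
variable {V : Type*} {G : SimpleGraph V}

theorem exists_path_list {S : Set V} (h : Conn G S) {x y : V} (hx : x ∈ S) (hy : y ∈ S) :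
    ∃ l : List V, l.head? = some x ∧ l.getLast? = some y ∧ List.IsChain G.Adj l ∧ l.Nodup ∧
      ∀ z ∈ l, z ∈ S := by
  classical
  obtain ⟨w, hw⟩ := h.exists_walk hx hy
  refine ⟨w.bypass.support, ?_, ?_, w.bypass.isChain_adj_support, (w.bypass_isPath).support_nodup,
    fun z hz => hw z (w.support_bypass_subset hz)⟩
  · rw [List.head?_eq_some_head w.bypass.support_ne_nil, Walk.head_support]
  · rw [List.getLast?_eq_some_getLast w.bypass.support_ne_nil, Walk.getLast_support]

theorem first_hit {P : V → Prop} {l : List V} (h : ∃ z ∈ l, P z) :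
    ∃ s o r, l = s ++ o :: r ∧ P o ∧ ∀ z ∈ s, ¬ P z := by
  induction l with
  | nil => simp at h
  | cons a l ih =>
    by_cases ha : P a
    · exact ⟨[], a, l, rfl, ha, by simp⟩
    · obtain ⟨z, hz, hP⟩ := h
      obtain ⟨s, o, r, rfl, h1, h2⟩ := ih ⟨z, by
        rcases List.mem_cons.1 hz with rfl | h
        · exact absurd hP ha
        · exact h, hP⟩
      refine ⟨a :: s, o, r, rfl, h1, ?_⟩
      intro z hz
      rcases List.mem_cons.1 hz with rfl | h
      · exact ha
      · exact h2 z h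

def Leg (G : SimpleGraph V) (o : V) (m : List V) (t : V) : Prop :=
  List.IsChain G.Adj (o :: m) ∧ (o :: m).getLast? = some t

theorem Leg.join {o o' t t' : V} {m m' : List V} (h : Leg G o m t) (h' : Leg G o' m' t')
    (ht : G.Adj t t') : Pth G o (m ++ m'.reverse) o' := by
  unfold Pth
  rw [show o :: (m ++ m'.reverse ++ [o']) = (o :: m) ++ (o' :: m').reverse by simp, List.isChain_append]
  refine ⟨h.1, ?_, ?_⟩
  · rw [List.isChain_reverse]
    exact h'.1.imp fun a b h => h.symm
  · rw [h.2, List.head?_reverse, h'.2]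
    simpa using ht

theorem tripod {S : Set V} (h : Conn G S) {t1 t2 t3 : V} (h1 : t1 ∈ S) (h2 : t2 ∈ S) (h3 : t3 ∈ S) :
    ∃ o m1 m2 m3, Leg G o m1 t1 ∧ Leg G o m2 t2 ∧ Leg G o m3 t3 ∧
      ∀ z, one o z + ctn m1 z + ctn m2 z + ctn m3 z ≤ 1 ∧
        (0 < one o z + ctn m1 z + ctn m2 z + ctn m3 z → z ∈ S) := by
  obtain ⟨p, p1, p2, p3, p4, p5⟩ := exists_path_list h h1 h2
  obtain ⟨q, q1, q2, q3, q4, q5⟩ := exists_path_list h h3 h1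
  have h1p : t1 ∈ p := List.mem_of_mem_head? p1
  obtain ⟨s, o, r, rfl, hop, hs⟩ := first_hit (P := fun z => z ∈ p) (l := q)
    ⟨t1, List.mem_of_mem_getLast? q2, h1p⟩
  obtain ⟨a, b, rfl⟩ := List.append_of_mem hop
  refine ⟨o, a.reverse, b, s.reverse, ⟨?_, ?_⟩, ⟨?_, ?_⟩, ⟨?_, ?_⟩, ?_⟩
  · have := (chain_mid.1 p3).1
    rw [show o :: a.reverse = (a ++ [o]).reverse by simp, List.isChain_reverse]
    exact this.imp fun a b h => h.symm
  · rw [show o :: a.reverse = (a ++ [o]).reverse by simp, List.getLast?_reverse, ← p1]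
    cases a <;> simp
  · exact (chain_mid.1 p3).2
  · rw [← p2, List.getLast?_append, List.getLast?_eq_some_getLast (l := o :: b) (by simp)]; rfl
  · have := (chain_mid.1 q3).1
    rw [show o :: s.reverse = (s ++ [o]).reverse by simp, List.isChain_reverse]
    exact this.imp fun a b h => h.symm
  · rw [show o :: s.reverse = (s ++ [o]).reverse by simp, List.getLast?_reverse, ← q1]
    cases s <;> simp
  · intro z
    have c1 := ctn_of_nodup p4 z
    have c2 := ctn_of_nodup q4 z
    have c3 := hs z
    have c4 := p5 z
    have c5 := q5 z
    simp only [ctn_pos, ctn_append, ctn_cons, ctn_reverse] at *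
    refine ⟨?_, fun h => ?_⟩
    · by_cases h0 : 0 < ctn s z
      · have := c3 h0; omega
      · omega
    · by_cases h0 : 0 < ctn s z
      · exact c5 (by omega)
      · exact c4 (by omega)

theorem acc {f g : ℕ} {S T : Set V} {z : V} (hf : f ≤ 1 ∧ (0 < f → z ∈ S)) (hg : g ≤ 1 ∧ (0 < g → z ∈ T))
    (h : Disjoint S T) : f + g ≤ 1 ∧ (0 < f + g → z ∈ S ∪ T) := by
  have : z ∈ S → z ∉ T := fun hz => Set.disjoint_left.1 h hz
  refine ⟨?_, fun h0 => ?_⟩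
  · by_contra hc
    exact this (hf.2 (by omega)) (hg.2 (by omega))
  · by_cases h1 : 0 < f
    · exact Or.inl (hf.2 h1)
    · exact Or.inr (hg.2 (by omega))

theorem good_of_sets {u v : V} (huv : G.Adj u v) {X Y A1 A2 Ba Bb Bc : Set V}
    (hX : Conn G X) (hY : Conn G Y) (hA1 : Conn G A1) (hA2 : Conn G A2) (hBa : Conn G Ba)
    (hBb : Conn G Bb) (hBc : Conn G Bc)
    (hd : [X, Y, A1, A2, Ba, Bb, Bc].Pairwise Disjoint) (hu : u ∈ X) (hv : v ∈ Y)
    (hYa : ct G Y Ba) (hXb : ct G X Bb) (hXc : ct G X Bc)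
    (h1a : ct G A1 Ba) (h1b : ct G A1 Bb) (h1c : ct G A1 Bc)
    (h2a : ct G A2 Ba) (h2b : ct G A2 Bb) (h2c : ct G A2 Bc) : ∃ D, Good G u v D := by
  simp only [List.pairwise_cons, List.mem_cons, forall_eq_or_imp, List.not_mem_nil,
        IsEmpty.forall_iff, implies_true, and_true, List.Pairwise.nil] at hd
  obtain ⟨⟨d01, d02, d03, d04, d05, d06⟩, ⟨d12, d13, d14, d15, d16⟩, ⟨d23, d24, d25, d26⟩,
    ⟨d34, d35, d36⟩, ⟨d45, d46⟩, d56⟩ := hd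
  obtain ⟨ya, hya, ay, hay, eya⟩ := hYa
  obtain ⟨xb, hxb, bx, hbx, exb⟩ := hXb
  obtain ⟨xc, hxc, cx, hcx, exc⟩ := hXc
  obtain ⟨x1a, hx1a, a1, ha1, e1a⟩ := h1a
  obtain ⟨x1b, hx1b, b1, hb1, e1b⟩ := h1b
  obtain ⟨x1c, hx1c, c1, hc1, e1c⟩ := h1c
  obtain ⟨x2a, hx2a, a2, ha2, e2a⟩ := h2a
  obtain ⟨x2b, hx2b, b2, hb2, e2b⟩ := h2b
  obtain ⟨x2c, hx2c, c2, hc2, e2c⟩ := h2c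
  obtain ⟨o, ou, ob, oc, lou, lob, loc, no⟩ := tripod hX hu hxb hxc
  obtain ⟨p, pa, pb, pc, lpa, lpb, lpc, np⟩ := tripod hA1 hx1a hx1b hx1c
  obtain ⟨q, qa, qb, qc, lqa, lqb, lqc, nq⟩ := tripod hA2 hx2a hx2b hx2c
  obtain ⟨a, a0, a1', a2', la0, la1, la2, na⟩ := tripod hBa hay ha1 ha2
  obtain ⟨b, b0, b1', b2', lb0, lb1, lb2, nb⟩ := tripod hBb hbx hb1 hb2
  obtain ⟨c, c0, c1', c2', lc0, lc1, lc2, nc⟩ := tripod hBc hcx hc1 hc2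
  obtain ⟨l, l1, l2, l3, l4, l5⟩ := exists_path_list hY hv hya
  obtain ⟨l', rfl⟩ : ∃ l', l = v :: l' := by
    cases l with
    | nil => simp at l1
    | cons w l' => exact ⟨l', by simp at l1; rw [l1]⟩
  refine ⟨⟨o, p, q, a, b, c, ou ++ v :: (l' ++ a0.reverse), ob ++ b0.reverse, oc ++ c0.reverse,
    pa ++ a1'.reverse, pb ++ b1'.reverse, pc ++ c1'.reverse, qa ++ a2'.reverse, qb ++ b2'.reverse,
    qc ++ c2'.reverse⟩, ⟨?_, lob.join lb0 exb, loc.join lc0 exc, lpa.join la1 e1a, lpb.join lb1 e1b,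
      lpc.join lc1 e1c, lqa.join la2 e2a, lqb.join lb2 e2b, lqc.join lc2 e2c, fun z => ?_⟩, by simp, ?_⟩
  · refine pth_split.2 ⟨?_, Leg.join ⟨l3, l2⟩ la0 eya⟩
    simpa using lou.join (o' := v) (m' := []) (t' := v) ⟨by simp, by simp⟩ huv
  · have hl : ctn (v :: l') z ≤ 1 ∧ (0 < ctn (v :: l') z → z ∈ Y) :=
      ⟨ctn_of_nodup l4 z, fun h => l5 z (ctn_pos.2 h)⟩
    have h1 := acc (no z) hl d01
    have h2 := acc h1 (np z) (Set.disjoint_union_left.2 ⟨d02, d12⟩)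
    have h3 := acc h2 (nq z) (Set.disjoint_union_left.2 ⟨Set.disjoint_union_left.2 ⟨d03, d13⟩, d23⟩)
    have h4 := acc h3 (na z) (Set.disjoint_union_left.2 ⟨Set.disjoint_union_left.2
      ⟨Set.disjoint_union_left.2 ⟨d04, d14⟩, d24⟩, d34⟩)
    have h5 := acc h4 (nb z) (Set.disjoint_union_left.2 ⟨Set.disjoint_union_left.2
      ⟨Set.disjoint_union_left.2 ⟨Set.disjoint_union_left.2 ⟨d05, d15⟩, d25⟩, d35⟩, d45⟩)
    have h6 := (acc h5 (nc z) (Set.disjoint_union_left.2 ⟨Set.disjoint_union_left.2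
      ⟨Set.disjoint_union_left.2 ⟨Set.disjoint_union_left.2 ⟨Set.disjoint_union_left.2 
        ⟨d06, d16⟩, d26⟩, d36⟩, d46⟩, d56⟩)).1
    simp only [ctn_append, ctn_cons, ctn_reverse] at h6 ⊢
    omega
  · left
    have h1 : o :: ou = (o :: ou).dropLast ++ [u] := (List.dropLast_append_getLast? _ lou.2).symm
    refine ⟨(o :: ou).dropLast, l' ++ a0.reverse ++ [a], ?_⟩
    have : (o :: ou).dropLast ++ [u, v] = ((o :: ou).dropLast ++ [u]) ++ [v] := by simp
    rw [this, ← h1]; simp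

theorem HasE.symm {u v : V} {l : List V} (h : HasE u v l) : HasE v u l := Or.symm h
theorem Good.symm {u v : V} {D : Dat V} (h : Good G u v D) : Good G v u D := ⟨h.sub, h.ne, h.hE.symm⟩

theorem good_of_sets' {u v : V} (hG : HFree G) (huv : G.Adj u v) {S A1 A2 Ba Bb Bc : Set V}
    (hS : Conn G S) (hA1 : Conn G A1) (hA2 : Conn G A2) (hBa : Conn G Ba)
    (hBb : Conn G Bb) (hBc : Conn G Bc)
    (hd : [S, A1, A2, Ba, Bb, Bc].Pairwise Disjoint) (hu : u ∈ S) (hv : v ∈ S)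
    (h0a : ct G S Ba) (h0b : ct G S Bb) (h0c : ct G S Bc)
    (h1a : ct G A1 Ba) (h1b : ct G A1 Bb) (h1c : ct G A1 Bc)
    (h2a : ct G A2 Ba) (h2b : ct G A2 Bb) (h2c : ct G A2 Bc) : ∃ D, Good G u v D := by
  obtain ⟨X, Y, rfl, dXY, huX, hvY, hX, hY⟩ := conn_split hS hu hv huv.ne
  simp only [List.pairwise_cons, List.mem_cons, forall_eq_or_imp, List.not_mem_nil,
        IsEmpty.forall_iff, implies_true, and_true, List.Pairwise.nil, Set.disjoint_union_left] at hd
  obtain ⟨⟨⟨d02, d12⟩, ⟨d03, d13⟩, ⟨d04, d14⟩, ⟨d05, d15⟩, ⟨d06, d16⟩⟩, ⟨d23, d24, d25, d26⟩,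
    ⟨d34, d35, d36⟩, ⟨d45, d46⟩, d56⟩ := hd
  have key : ∀ {X Y : Set V} {u v : V}, G.Adj u v → u ∈ X → v ∈ Y → Disjoint X Y →
     Disjoint Y A1 → Disjoint Y A2 → Disjoint Y Ba → Disjoint Y Bb → Disjoint Y Bc →
     Disjoint X A1 → Disjoint X A2 → Disjoint X Ba → Disjoint X Bb → Disjoint X Bc → Conn G X →
     ct G X Ba → ct G X Bb → ct G X Bc → False := by
    intro X Y u v huv hu hv dXY y1 y2 y3 y4 y5 x1 x2 x3 x4 x5 hX ka kb kc
    refine no_K33 hG huv.symm (a0 := X) (a1 := A1) (a2 := A2) (b0 := Ba) (b1 := Bb) (b2 := Bc) ?_ ?_ ?_ ?_ <;>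
    simp only [List.pairwise_cons, List.mem_cons, forall_eq_or_imp, List.not_mem_nil,
        IsEmpty.forall_iff, implies_true, and_true, List.Pairwise.nil]
    · exact ⟨hX, hA1, hA2, hBa, hBb, hBc⟩
    · exact ⟨⟨x1, x2, x3, x4, x5⟩, ⟨d23, d24, d25, d26⟩, ⟨d34, d35, d36⟩, ⟨d45, d46⟩, d56⟩
    · exact ⟨Set.disjoint_right.1 dXY hv, Set.disjoint_left.1 y1 hv, Set.disjoint_left.1 y2 hv,
        Set.disjoint_left.1 y3 hv, Set.disjoint_left.1 y4 hv, Set.disjoint_left.1 y5 hv⟩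
    · exact ⟨⟨ka, kb, kc⟩, ⟨h1a, h1b, h1c⟩, ⟨h2a, h2b, h2c⟩⟩
  have kX := key huv huX hvY dXY d12 d13 d14 d15 d16 d02 d03 d04 d05 d06 hX
  have kY := key huv.symm hvY huX dXY.symm d02 d03 d04 d05 d06 d12 d13 d14 d15 d16 hY
  clear key
  rw [ct_union] at h0a h0b h0c
  rcases h0a with ka | ka <;> rcases h0b with kb | kb <;> rcases h0c with kc | kc
  · exact (kX ka kb kc).elim
  · refine good_of_sets huv hX hY hA1 hA2 hBc hBa hBb ?_ huX hvY kc ka kb h1c h1a h1b h2c h2a h2b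
    simp only [List.pairwise_cons, List.mem_cons, forall_eq_or_imp, List.not_mem_nil,
        IsEmpty.forall_iff, implies_true, and_true, List.Pairwise.nil]
    exact ⟨⟨dXY, d02, d03, d06, d04, d05⟩, ⟨d12, d13, d16, d14, d15⟩, ⟨d23, d26, d24, d25⟩, ⟨d36, d34, d35⟩, ⟨d46.symm, d56.symm⟩, d45⟩
  · refine good_of_sets huv hX hY hA1 hA2 hBb hBa hBc ?_ huX hvY kb ka kc h1b h1a h1c h2b h2a h2c
    simp only [List.pairwise_cons, List.mem_cons, forall_eq_or_imp, List.not_mem_nil,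
        IsEmpty.forall_iff, implies_true, and_true, List.Pairwise.nil]
    exact ⟨⟨dXY, d02, d03, d05, d04, d06⟩, ⟨d12, d13, d15, d14, d16⟩, ⟨d23, d25, d24, d26⟩, ⟨d35, d34, d36⟩, ⟨d45.symm, d56⟩, d46⟩
  · refine (good_of_sets huv.symm hY hX hA1 hA2 hBa hBb hBc ?_ hvY huX ka kb kc h1a h1b h1c h2a h2b h2c).imp fun _ h => h.symm
    simp only [List.pairwise_cons, List.mem_cons, forall_eq_or_imp, List.not_mem_nil,
        IsEmpty.forall_iff, implies_true, and_true, List.Pairwise.nil]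
    exact ⟨⟨dXY.symm, d12, d13, d14, d15, d16⟩, ⟨d02, d03, d04, d05, d06⟩, ⟨d23, d24, d25, d26⟩, ⟨d34, d35, d36⟩, ⟨d45, d46⟩, d56⟩
  · refine good_of_sets huv hX hY hA1 hA2 hBa hBb hBc ?_ huX hvY ka kb kc h1a h1b h1c h2a h2b h2c
    simp only [List.pairwise_cons, List.mem_cons, forall_eq_or_imp, List.not_mem_nil,
        IsEmpty.forall_iff, implies_true, and_true, List.Pairwise.nil]
    exact ⟨⟨dXY, d02, d03, d04, d05, d06⟩, ⟨d12, d13, d14, d15, d16⟩, ⟨d23, d24, d25, d26⟩, ⟨d34, d35, d36⟩, ⟨d45, d46⟩, d56⟩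
  · refine (good_of_sets huv.symm hY hX hA1 hA2 hBb hBa hBc ?_ hvY huX kb ka kc h1b h1a h1c h2b h2a h2c).imp fun _ h => h.symm
    simp only [List.pairwise_cons, List.mem_cons, forall_eq_or_imp, List.not_mem_nil,
        IsEmpty.forall_iff, implies_true, and_true, List.Pairwise.nil]
    exact ⟨⟨dXY.symm, d12, d13, d15, d14, d16⟩, ⟨d02, d03, d05, d04, d06⟩, ⟨d23, d25, d24, d26⟩, ⟨d35, d34, d36⟩, ⟨d45.symm, d56⟩, d46⟩
  · refine (good_of_sets huv.symm hY hX hA1 hA2 hBc hBa hBb ?_ hvY huX kc ka kb h1c h1a h1b h2c h2a h2b).imp fun _ h => h.symm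
    simp only [List.pairwise_cons, List.mem_cons, forall_eq_or_imp, List.not_mem_nil,
        IsEmpty.forall_iff, implies_true, and_true, List.Pairwise.nil]
    exact ⟨⟨dXY.symm, d12, d13, d16, d14, d15⟩, ⟨d02, d03, d06, d04, d05⟩, ⟨d23, d26, d24, d25⟩, ⟨d36, d34, d35⟩, ⟨d46.symm, d56.symm⟩, d45⟩
  · exact (kY ka kb kc).elim

theorem K33_frame (w : Fin 3 ⊕ Fin 3) : ∃ a1 a2 b0 b1 b2 : Fin 3 ⊕ Fin 3, [w, a1, a2, b0, b1, b2].Nodup ∧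
    ∀ S ∈ [w, a1, a2], ∀ T ∈ [b0, b1, b2], K33.Adj S T := by
  rcases w with i | i
  · refine ⟨.inl (i+1), .inl (i+2), .inr 0, .inr 1, .inr 2, ?_, ?_⟩
    · fin_cases i <;> decide
    · simp [K33_adj_iff]
  · refine ⟨.inr (i+1), .inr (i+2), .inl 0, .inl 1, .inl 2, ?_, ?_⟩
    · fin_cases i <;> decide
    · simp [K33_adj_iff]

theorem exists_good {u v : V} [Finite V] (h3 : KConnected G 3) (hG : HFree G) (huv : G.Adj u v)
    (hm : IsMinor K33 (contractEdge G u v)) : ∃ D, Good G u v D := by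
  obtain ⟨B, hB⟩ := isMinor_iff.1 hm
  have hM := contract_lift huv K33_nbr hB
  have hvB := contract_not_mem K33_nbr hB
  obtain ⟨w, hw⟩ := spanning33 hG hM huv
  have huw : u ∈ B w := by
    rcases hw with hw | ⟨e, _⟩
    · exact hw
    · exact absurd e huv.ne
  obtain ⟨a1, a2, b0, b1, b2, hnd, had⟩ := K33_frame w
  simp only [List.pairwise_cons, List.mem_cons, forall_eq_or_imp, List.not_mem_nil,
        IsEmpty.forall_iff, implies_true, and_true, List.Pairwise.nil, List.Nodup] at hnd had
  obtain ⟨hc, hd, ha⟩ := hM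
  obtain ⟨⟨n1, n2, n3, n4, n5⟩, ⟨n6, n7, n8, n9⟩, ⟨n10, n11, n12⟩, ⟨n13, n14⟩, n15⟩ := hnd
  obtain ⟨⟨e1, e2, e3⟩, ⟨e4, e5, e6⟩, ⟨e7, e8, e9⟩⟩ := had
  refine good_of_sets' hG huv (hc w) (hc a1) (hc a2) (hc b0) (hc b1) (hc b2) ?_ (Or.inl huw) (Or.inr ⟨rfl, huw⟩)
    (ha _ _ e1) (ha _ _ e2) (ha _ _ e3) (ha _ _ e4) (ha _ _ e5) (ha _ _ e6) (ha _ _ e7) (ha _ _ e8) (ha _ _ e9)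
  simp only [List.pairwise_cons, List.mem_cons, forall_eq_or_imp, List.not_mem_nil,
        IsEmpty.forall_iff, implies_true, and_true, List.Pairwise.nil]
  exact ⟨⟨hd _ _ n1, hd _ _ n2, hd _ _ n3, hd _ _ n4, hd _ _ n5⟩, ⟨hd _ _ n6, hd _ _ n7, hd _ _ n8, hd _ _ n9⟩,
    ⟨hd _ _ n10, hd _ _ n11, hd _ _ n12⟩, ⟨hd _ _ n13, hd _ _ n14⟩, hd _ _ n15⟩
end existence

open SimpleGraph

/-- A path `l 0, …, l k` together with a cycle `r` of length `N`. -/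
structure Rg {V : Type*} (G : SimpleGraph V) where
  k : ℤ
  N : ℤ
  β : ℤ
  γ : ℤ
  δ : ℤ
  l : ℤ → V
  r : ℤ → V
  hk : 2 ≤ k
  hβ : 0 < β
  hγ : β < γ
  hδ : γ < δ
  hN : δ < N
  lad : ∀ j, 0 ≤ j → j < k → G.Adj (l j) (l (j + 1))
  rad : ∀ p, G.Adj (r p) (r (p + 1))
  per : ∀ p, r (p + N) = r p
  linj : ∀ a b, 0 ≤ a → a < b → b ≤ k → l a ≠ l b
  rinj : ∀ p q, p < q → q < p + N → r p ≠ r q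
  lr : ∀ j p, 0 ≤ j → j ≤ k → l j ≠ r p
  cov : ∀ z, (∃ j, 0 ≤ j ∧ j ≤ k ∧ z = l j) ∨ ∃ p, z = r p
  a1 : G.Adj (l 0) (r β)
  a2 : G.Adj (l 0) (r δ)
  a3 : G.Adj (l k) (r 0)
  a4 : G.Adj (l k) (r γ)

namespace Rg
variable {V : Type*} {G : SimpleGraph V} (D : Rg G)

/-- Quarter rotation, exchanging the ends of the path. -/
def rot : Rg G where
  k := D.k
  N := D.N
  β := D.γ - D.β
  γ := D.δ - D.β
  δ := D.N - D.β
  l := fun j => D.l (D.k - j)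
  r := fun p => D.r (p + D.β)
  hk := D.hk
  hβ := by have := D.hγ; omega
  hγ := by have := D.hδ; omega
  hδ := by have := D.hN; omega
  hN := by have := D.hβ; omega
  lad := fun j h1 h2 => by
    have := D.lad (D.k - (j + 1)) (by omega) (by omega)
    rw [show D.k - (j + 1) + 1 = D.k - j by ring] at this
    exact this.symm
  rad := fun p => by
    have := D.rad (p + D.β)
    rwa [show p + D.β + 1 = p + 1 + D.β by ring] at this
  per := fun p => by
    rw [show p + D.N + D.β = p + D.β + D.N by ring]; exact D.per _
  linj := fun a b h1 h2 h3 => (D.linj (D.k - b) (D.k - a) (by omega) (by omega) (by omega)).symm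
  rinj := fun p q h1 h2 => D.rinj _ _ (by omega) (by omega)
  lr := fun j p h1 h2 => D.lr _ _ (by omega) (by omega)
  cov := fun z => by
    rcases D.cov z with ⟨j, h1, h2, rfl⟩ | ⟨p, rfl⟩
    · exact Or.inl ⟨D.k - j, by omega, by omega, by congr 1; ring⟩
    · exact Or.inr ⟨p - D.β, by congr 1; ring⟩
  a1 := by have := D.a4; simpa using this
  a2 := by
    have := D.a3; have h := D.per 0
    simp only [sub_zero, sub_add_cancel]
    rw [zero_add] at h; rwa [h]
  a3 := by have := D.a1; simpa using this
  a4 := by have := D.a2; simpa using this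

/-- Reflection of the cycle. -/
def ref : Rg G where
  k := D.k
  N := D.N
  β := D.N - D.δ
  γ := D.N - D.γ
  δ := D.N - D.β
  l := D.l
  r := fun p => D.r (-p)
  hk := D.hk
  hβ := by have := D.hN; omega
  hγ := by have := D.hδ; omega
  hδ := by have := D.hγ; omega
  hN := by have := D.hβ; omega
  lad := D.lad
  rad := fun p => by
    have := D.rad (-(p + 1))
    rw [show -(p + 1) + 1 = -p by ring] at this
    exact this.symm
  per := fun p => by
    have := D.per (-(p + D.N))
    rw [show -(p + D.N) + D.N = -p by ring] at this
    exact this.symm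
  linj := D.linj
  rinj := fun p q h1 h2 => (D.rinj _ _ (by omega) (by omega)).symm
  lr := fun j p h1 h2 => D.lr _ _ (by omega) (by omega)
  cov := fun z => by
    rcases D.cov z with h | ⟨p, rfl⟩
    · exact Or.inl h
    · exact Or.inr ⟨- p, by simp⟩
  a1 := by
    have := D.a2; have h := D.per (-(D.N - D.δ))
    rw [show -(D.N - D.δ) + D.N = D.δ by ring] at h
    rwa [← h]
  a2 := by
    have := D.a1; have h := D.per (-(D.N - D.β))
    rw [show -(D.N - D.β) + D.N = D.β by ring] at h
    rwa [← h]
  a3 := by have := D.a3; simpa using this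
  a4 := by
    have := D.a4; have h := D.per (-(D.N - D.γ))
    rw [show -(D.N - D.γ) + D.N = D.γ by ring] at h
    rwa [← h]

/-- An arc of the cycle. -/
def arc (a b : ℤ) : Set V := D.r '' Set.Ico a b

/-- A segment of the path. -/
def seg (a b : ℤ) : Set V := D.l '' Set.Icc a b

variable {D}

theorem mem_arc {a b p : ℤ} (h : a ≤ p) (h' : p < b) : D.r p ∈ D.arc a b := ⟨p, ⟨h, h'⟩, rfl⟩
theorem mem_seg {a b p : ℤ} (h : a ≤ p) (h' : p ≤ b) : D.l p ∈ D.seg a b := ⟨p, ⟨h, h'⟩, rfl⟩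

theorem conn_arc {a b : ℤ} (h : a < b) : Conn G (D.arc a b) := by
  obtain ⟨n, rfl⟩ : ∃ n : ℕ, b = a + 1 + n := ⟨(b - a - 1).toNat, by omega⟩
  clear h
  induction n with
  | zero =>
    have : D.arc a (a + 1 + (0 : ℕ)) = {D.r a} := by
      ext z; simp only [arc, Set.mem_image, Set.mem_Ico, Set.mem_singleton_iff]
      constructor
      · rintro ⟨p, ⟨h1, h2⟩, rfl⟩; congr 1; push_cast at h2; omega
      · rintro rfl; exact ⟨a, ⟨le_refl _, by push_cast; omega⟩, rfl⟩
    rw [this]; exact conn_singleton _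
  | succ n ih =>
    have : D.arc a (a + 1 + ((n + 1 : ℕ) : ℤ)) = D.arc a (a + 1 + n) ∪ {D.r (a + n + 1)} := by
      ext z; simp only [arc, Set.mem_image, Set.mem_Ico, Set.mem_singleton_iff, Set.mem_union]
      constructor
      · rintro ⟨p, ⟨h1, h2⟩, rfl⟩
        push_cast at h2
        by_cases hp : p < a + 1 + n
        · exact Or.inl ⟨p, ⟨h1, hp⟩, rfl⟩
        · right; congr 1; omega
      · rintro (⟨p, ⟨h1, h2⟩, rfl⟩ | rfl)
        · exact ⟨p, ⟨h1, by push_cast; omega⟩, rfl⟩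
        · exact ⟨_, ⟨by omega, by push_cast; omega⟩, rfl⟩
    rw [this]
    exact ih.union_adj (conn_singleton _) (mem_arc (p := a + n) (by omega) (by omega)) rfl (D.rad _)

theorem conn_seg {a b : ℤ} (h : a ≤ b) (ha : 0 ≤ a) (hb : b ≤ D.k) : Conn G (D.seg a b) := by
  obtain ⟨n, rfl⟩ : ∃ n : ℕ, b = a + n := ⟨(b - a).toNat, by omega⟩
  clear h
  induction n with
  | zero =>
    have : D.seg a (a + (0 : ℕ)) = {D.l a} := by
      ext z; simp only [seg, Set.mem_image, Set.mem_Icc, Set.mem_singleton_iff]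
      constructor
      · rintro ⟨p, ⟨h1, h2⟩, rfl⟩; congr 1; push_cast at h2; omega
      · rintro rfl; exact ⟨a, ⟨le_refl _, by push_cast; omega⟩, rfl⟩
    rw [this]; exact conn_singleton _
  | succ n ih =>
    push_cast at hb
    have : D.seg a (a + ((n + 1 : ℕ) : ℤ)) = D.seg a (a + n) ∪ {D.l (a + n + 1)} := by
      ext z; simp only [seg, Set.mem_image, Set.mem_Icc, Set.mem_singleton_iff, Set.mem_union]
      constructor
      · rintro ⟨p, ⟨h1, h2⟩, rfl⟩
        push_cast at h2
        by_cases hp : p ≤ a + n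
        · exact Or.inl ⟨p, ⟨h1, hp⟩, rfl⟩
        · right; congr 1; omega
      · rintro (⟨p, ⟨h1, h2⟩, rfl⟩ | rfl)
        · exact ⟨p, ⟨h1, by push_cast; omega⟩, rfl⟩
        · exact ⟨_, ⟨by omega, by push_cast; omega⟩, rfl⟩
    rw [this]
    exact (ih (by omega)).union_adj (conn_singleton _) (mem_seg (p := a + n) (by omega) (by omega)) rfl
      (D.lad _ (by omega) (by omega))

theorem dAA {a b a' b' : ℤ} (h : (b ≤ a' ∧ b' ≤ a + D.N) ∨ (b' ≤ a ∧ b ≤ a' + D.N)) :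
    Disjoint (D.arc a b) (D.arc a' b') := by
  rw [Set.disjoint_left]
  rintro _ ⟨p, ⟨h1, h2⟩, rfl⟩ ⟨q, ⟨h3, h4⟩, e⟩
  rcases h with h | h
  · exact D.rinj p q (by omega) (by omega) e.symm
  · exact D.rinj q p (by omega) (by omega) e

theorem dSS {a b a' b' : ℤ} (h : (0 ≤ a ∧ b < a' ∧ b' ≤ D.k) ∨ (0 ≤ a' ∧ b' < a ∧ b ≤ D.k)) :
    Disjoint (D.seg a b) (D.seg a' b') := by
  rw [Set.disjoint_left]
  rintro _ ⟨p, ⟨h1, h2⟩, rfl⟩ ⟨q, ⟨h3, h4⟩, e⟩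
  rcases h with h | h
  · exact D.linj p q (by omega) (by omega) (by omega) e.symm
  · exact D.linj q p (by omega) (by omega) (by omega) e

theorem dSA {a b a' b' : ℤ} (h : 0 ≤ a ∧ b ≤ D.k) : Disjoint (D.seg a b) (D.arc a' b') := by
  rw [Set.disjoint_left]
  rintro _ ⟨p, ⟨h1, h2⟩, rfl⟩ ⟨q, ⟨h3, h4⟩, e⟩
  exact D.lr p q (by omega) (by omega) e.symm

theorem dAS {a b a' b' : ℤ} (h : 0 ≤ a ∧ b ≤ D.k) : Disjoint (D.arc a' b') (D.seg a b) := (dSA h).symm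

theorem nA {a b p : ℤ} (h : (p < a ∧ b ≤ p + D.N) ∨ (b ≤ p ∧ p < a + D.N)) : D.r p ∉ D.arc a b := by
  rintro ⟨q, ⟨h3, h4⟩, e⟩
  rcases h with h | h
  · exact D.rinj p q (by omega) (by omega) e.symm
  · exact D.rinj q p (by omega) (by omega) e

theorem nA' {a b p : ℤ} (h : 0 ≤ p ∧ p ≤ D.k) : D.l p ∉ D.arc a b := by
  rintro ⟨q, ⟨h3, h4⟩, e⟩
  exact D.lr p q (by omega) (by omega) e.symm

theorem nS' {a b p : ℤ} (h : 0 ≤ a ∧ b ≤ D.k) : D.r p ∉ D.seg a b := by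
  rintro ⟨q, ⟨h3, h4⟩, e⟩
  exact D.lr q p (by omega) (by omega) e

theorem nS {a b p : ℤ} (h : (0 ≤ p ∧ p < a ∧ b ≤ D.k) ∨ (0 ≤ a ∧ b < p ∧ p ≤ D.k)) : D.l p ∉ D.seg a b := by
  rintro ⟨q, ⟨h3, h4⟩, e⟩
  rcases h with h | h
  · exact D.linj p q (by omega) (by omega) (by omega) e.symm
  · exact D.linj q p (by omega) (by omega) (by omega) e

theorem per' (p : ℤ) : D.r (p - D.N) = D.r p := by
  have := D.per (p - D.N)
  rw [sub_add_cancel] at this; exact this.symm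

theorem ctAA {a b a' b' : ℤ} (h : a < b) (h' : a' < b') (h0 : b = a' ∨ b = a' + D.N ∨ b' = a ∨ b' = a + D.N) :
    ct G (D.arc a b) (D.arc a' b') := by
  have e1 := D.rad (b - 1)
  have e2 := D.rad (b' - 1)
  rw [sub_add_cancel] at e1 e2
  rcases h0 with rfl | rfl | rfl | rfl
  · exact ⟨_, mem_arc (p := b - 1) (by omega) (by omega), _, mem_arc (p := b) (by omega) (by omega), e1⟩
  · rw [D.per] at e1
    exact ⟨_, mem_arc (by omega) (by omega), _, mem_arc (by omega) (by omega), e1⟩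
  · exact ⟨_, mem_arc (p := b') (by omega) (by omega), _, mem_arc (p := b' - 1) (by omega) (by omega), e2.symm⟩
  · rw [D.per] at e2
    exact ⟨_, mem_arc (by omega) (by omega), _, mem_arc (p := a + D.N - 1) (by omega) (by omega), e2.symm⟩

theorem ctSS {a b a' b' : ℤ} (ha : 0 ≤ a ∧ a ≤ b ∧ a' ≤ b' ∧ b' ≤ D.k) (h : b + 1 = a') :
    ct G (D.seg a b) (D.seg a' b') := by
  subst h
  exact ⟨_, mem_seg (p := b) (by omega) (by omega), _, mem_seg (p := b + 1) (by omega) (by omega),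
    D.lad b (by omega) (by omega)⟩

theorem ctSA {a b a' b' j p : ℤ} (e : G.Adj (D.l j) (D.r p)) (h : a ≤ j ∧ j ≤ b) (h' : a' ≤ p ∧ p < b') :
    ct G (D.seg a b) (D.arc a' b') := ⟨_, mem_seg h.1 h.2, _, mem_arc h'.1 h'.2, e⟩

theorem ctAS {a b a' b' j p : ℤ} (e : G.Adj (D.l j) (D.r p)) (h : a ≤ j ∧ j ≤ b) (h' : a' ≤ p ∧ p < b') :
    ct G (D.arc a' b') (D.seg a b) := (ctSA e h h').symm

theorem ctC {a b a' b' p q : ℤ} (e : G.Adj (D.r p) (D.r q)) (h : a ≤ p ∧ p < b) (h' : a' ≤ q ∧ q < b') :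
    ct G (D.arc a b) (D.arc a' b') := ⟨_, mem_arc h.1 h.2, _, mem_arc h'.1 h'.2, e⟩

theorem lnbr {j : ℤ} (h0 : 0 ≤ j) (h1 : j ≤ D.k) : ∃ z', G.Adj (D.l j) z' := by
  by_cases h : j < D.k
  · exact ⟨_, D.lad j h0 h⟩
  · have := D.hk
    have := D.lad (j - 1) (by omega) (by omega)
    rw [sub_add_cancel] at this; exact ⟨_, this.symm⟩

/-- The four arcs given by alternating attachments. -/
theorem hexa (hG : HFree G) {a b a' b' : ℤ} (ha : 0 ≤ a ∧ a ≤ b ∧ b < a' ∧ a' ≤ b' ∧ b' ≤ D.k)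
    (hct : ct G (D.seg a b) (D.seg a' b')) {j : ℤ} (hj : 0 ≤ j ∧ j ≤ D.k)
    (hj' : j < a ∨ (b < j ∧ j < a') ∨ b' < j)
    {p0 p1 p2 p3 j0 j1 j2 j3 : ℤ} (h01 : p0 < p1) (h12 : p1 < p2) (h23 : p2 < p3) (h30 : p3 < p0 + D.N)
    (e0 : G.Adj (D.l j0) (D.r p0)) (e1 : G.Adj (D.l j1) (D.r p1)) (e2 : G.Adj (D.l j2) (D.r p2))
    (e3 : G.Adj (D.l j3) (D.r p3)) (k0 : a ≤ j0 ∧ j0 ≤ b) (k2 : a ≤ j2 ∧ j2 ≤ b)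
    (k1 : a' ≤ j1 ∧ j1 ≤ b') (k3 : a' ≤ j3 ∧ j3 ≤ b') : False := by
  obtain ⟨z', hz⟩ := D.lnbr hj.1 hj.2
  refine no_K33 hG hz (a0 := D.seg a b) (a1 := D.arc p1 p2) (a2 := D.arc p3 (p0 + D.N))
    (b0 := D.seg a' b') (b1 := D.arc p0 p1) (b2 := D.arc p2 p3) ?_ ?_ ?_ ?_ <;>
    simp only [List.pairwise_cons, List.mem_cons, forall_eq_or_imp, List.not_mem_nil,
        IsEmpty.forall_iff, implies_true, and_true, List.Pairwise.nil]
  · exact ⟨conn_seg (by omega) (by omega) (by omega), conn_arc (by omega), conn_arc (by omega),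
      conn_seg (by omega) (by omega) (by omega), conn_arc (by omega), conn_arc (by omega)⟩
  · refine ⟨⟨?_, ?_, ?_, ?_, ?_⟩, ⟨?_, ?_, ?_, ?_⟩, ⟨?_, ?_, ?_⟩, ⟨?_, ?_⟩, ?_⟩ <;>
    first
    | exact dAA (by omega)
    | exact dSS (by omega)
    | exact dSA (by omega)
    | exact dAS (by omega)
  · refine ⟨?_, ?_, ?_, ?_, ?_, ?_⟩ <;>
    first
    | exact nS (by omega)
    | exact nA' (by omega)
  · refine ⟨⟨hct, ctSA e0 (by omega) (by omega), ctSA e2 (by omega) (by omega)⟩,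
      ⟨ctAS e1 (by omega) (by omega), ctAA (by omega) (by omega) (by omega), ctAA (by omega) (by omega) (by omega)⟩,
      ⟨ctAS e3 (by omega) (by omega), ctAA (by omega) (by omega) (by omega), ctAA (by omega) (by omega) (by omega)⟩⟩

theorem noLL (hG : HFree G) {a b : ℤ} (ha : 0 ≤ a) (hab : a + 2 ≤ b) (hb : b ≤ D.k) :
    ¬ G.Adj (D.l a) (D.l b) := by
  intro h
  have := D.hβ; have := D.hγ; have := D.hδ; have := D.hN; have := D.hk
  have e3 := D.a3
  rw [← D.per, zero_add] at e3
  exact hexa (D := D) hG (a := 0) (b := a) (a' := b) (b' := D.k) (by omega)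
    ⟨_, mem_seg (p := a) (by omega) (by omega), _, mem_seg (p := b) (by omega) (by omega), h⟩ (j := a + 1)
    (by omega) (by omega) D.hγ D.hδ D.hN (by omega) D.a1 D.a4 D.a2 e3 (by omega) (by omega) (by omega) (by omega)
attribute [irreducible] arc seg

end Rg

open SimpleGraph

namespace Rg
variable {V : Type*} {G : SimpleGraph V} {D : Rg G}

theorem a3N : G.Adj (D.l D.k) (D.r D.N) := by
  have e3 := D.a3
  rwa [← D.per, zero_add] at e3

theorem quarter1 (D : Rg G) (hG : HFree G) {p q : ℤ} (h0 : 0 ≤ p) (h1 : p + 2 ≤ q) (h2 : q ≤ D.β) :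
    ¬ G.Adj (D.r p) (D.r q) := by
  intro e
  have := D.hβ; have := D.hγ; have := D.hδ; have := D.hN; have := D.hk
  refine no_K33 hG (D.rad (p + 1)) (a0 := D.seg 0 (D.k - 1)) (a1 := D.arc 0 (p + 1)) (a2 := D.arc D.γ D.δ)
    (b0 := D.seg D.k D.k) (b1 := D.arc q D.γ) (b2 := D.arc D.δ D.N) ?_ ?_ ?_ ?_ <;>
    simp only [List.pairwise_cons, List.mem_cons, forall_eq_or_imp, List.not_mem_nil,
        IsEmpty.forall_iff, implies_true, and_true, List.Pairwise.nil]
  · exact ⟨conn_seg (by omega) (by omega) (by omega), conn_arc (by omega), conn_arc (by omega),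
      conn_seg (by omega) (by omega) (by omega), conn_arc (by omega), conn_arc (by omega)⟩
  · refine ⟨⟨?_, ?_, ?_, ?_, ?_⟩, ⟨?_, ?_, ?_, ?_⟩, ⟨?_, ?_, ?_⟩, ⟨?_, ?_⟩, ?_⟩ <;>
    first
    | exact dAA (by omega)
    | exact dSS (by omega)
    | exact dSA (by omega)
    | exact dAS (by omega)
  · refine ⟨?_, ?_, ?_, ?_, ?_, ?_⟩ <;>
    first
    | exact nS' (by omega)
    | exact nA (by omega)
  · refine ⟨⟨ctSS (by omega) (by omega), ctSA D.a1 (by omega) (by omega), ctSA D.a2 (by omega) (by omega)⟩,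
      ⟨ctAS D.a3 (by omega) (by omega), ctC e (by omega) (by omega), ctAA (by omega) (by omega) (by omega)⟩,
      ⟨ctAS D.a4 (by omega) (by omega), ctAA (by omega) (by omega) (by omega), ctAA (by omega) (by omega) (by omega)⟩⟩

set_option maxHeartbeats 2000000 in
theorem adjacent1 (D : Rg G) (hG : HFree G) {p q : ℤ} (h0 : 0 < p) (h1 : p < D.β) (h2 : D.β < q) (h3 : q < D.γ) :
    ¬ G.Adj (D.r p) (D.r q) := by
  intro e
  have := D.hβ; have := D.hγ; have := D.hδ; have := D.hN; have := D.hk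
  refine no_K33h hG (a0 := D.arc (p + 1) q) (t0 := D.arc p (p + 1)) (t1 := D.arc q (q + 1))
    (b0 := D.arc 0 p) (b1 := D.arc (q + 1) D.δ) (b2 := D.seg 0 (D.k - 1)) (a1 := D.seg D.k D.k)
    (a2 := D.arc D.δ D.N) ?_ ?_
    (ctAS D.a1 (by omega) (by omega)) (ctSA D.a3 (by omega) (by omega)) (ctSA D.a4 (by omega) (by omega))
    (ctSS (by omega) (by omega)).symm
    (ctAA (by omega) (by omega) (by omega)) (ctAA (by omega) (by omega) (by omega))
    (ctAS D.a2 (by omega) (by omega)) (ctAA (by omega) (by omega) (by omega)) (ctAA (by omega) (by omega) (by omega))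
    (ctAA (by omega) (by omega) (by omega)) (ctAA (by omega) (by omega) (by omega)) (ctC e (by omega) (by omega)) <;>
    simp only [List.pairwise_cons, List.mem_cons, forall_eq_or_imp, List.not_mem_nil,
        IsEmpty.forall_iff, implies_true, and_true, List.Pairwise.nil]
  · refine ⟨?_, ?_, ?_, ?_, ?_, ?_, ?_, ?_⟩ <;>
    first
    | exact conn_seg (by omega) (by omega) (by omega)
    | exact conn_arc (by omega)
  · refine ⟨⟨?_, ?_, ?_, ?_, ?_, ?_, ?_⟩, ⟨?_, ?_, ?_, ?_, ?_, ?_⟩, ⟨?_, ?_, ?_, ?_, ?_⟩,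
      ⟨?_, ?_, ?_, ?_⟩, ⟨?_, ?_, ?_⟩, ⟨?_, ?_⟩, ?_⟩ <;>
    first
    | exact dAA (by omega)
    | exact dSS (by omega)
    | exact dSA (by omega)
    | exact dAS (by omega)

theorem opposite1 (D : Rg G) (hG : HFree G) {p q : ℤ} (h0 : 0 < p) (h1 : p < D.β) (h2 : D.γ < q) (h3 : q < D.δ) :
    ¬ G.Adj (D.r p) (D.r q) := by
  intro e
  have := D.hβ; have := D.hγ; have := D.hδ; have := D.hN; have := D.hk
  obtain ⟨z', hz⟩ := D.lnbr (j := 1) (by omega) (by omega)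
  refine no_K33 hG hz (a0 := D.seg D.k D.k ∪ D.arc 0 p) (a1 := D.seg 0 0 ∪ D.arc D.β D.γ) (a2 := D.arc q D.δ)
    (b0 := D.arc p D.β) (b1 := D.arc D.γ q) (b2 := D.arc D.δ D.N) ?_ ?_ ?_ ?_ <;>
    simp only [List.pairwise_cons, List.mem_cons, forall_eq_or_imp, List.not_mem_nil,
        IsEmpty.forall_iff, implies_true, and_true, List.Pairwise.nil, Set.mem_union, not_or,
        Set.disjoint_union_left, Set.disjoint_union_right]
  · refine ⟨(conn_seg (by omega) (by omega) (by omega)).union_adj (conn_arc (by omega)) (mem_seg (by omega) (by omega)) (mem_arc (by omega) (by omega)) D.a3,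
     (conn_seg (by omega) (by omega) (by omega)).union_adj (conn_arc (by omega)) (mem_seg (by omega) (by omega)) (mem_arc (by omega) (by omega)) D.a1,
     conn_arc (by omega), conn_arc (by omega), conn_arc (by omega), conn_arc (by omega)⟩
  · refine ⟨⟨⟨⟨?_, ?_⟩, ⟨?_, ?_⟩⟩, ⟨?_, ?_⟩, ⟨?_, ?_⟩, ⟨?_, ?_⟩, ⟨?_, ?_⟩⟩,
      ⟨⟨?_, ?_⟩, ⟨?_, ?_⟩, ⟨?_, ?_⟩, ⟨?_, ?_⟩⟩, ⟨?_, ?_, ?_⟩, ⟨?_, ?_⟩, ?_⟩ <;>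
    first
    | exact dAA (by omega)
    | exact dSS (by omega)
    | exact dSA (by omega)
    | exact dAS (by omega)
  · refine ⟨⟨?_, ?_⟩, ⟨?_, ?_⟩, ?_, ?_, ?_, ?_⟩ <;>
    first
    | exact nS (by omega)
    | exact nA' (by omega)
  · refine ⟨⟨ct_union.2 (Or.inr (ctAA (by omega) (by omega) (by omega))), ct_union.2 (Or.inl (ctSA D.a4 (by omega) (by omega))),
       ct_union.2 (Or.inr (ctAA (by omega) (by omega) (by omega)))⟩,
      ⟨ct_union.2 (Or.inr (ctAA (by omega) (by omega) (by omega))), ct_union.2 (Or.inr (ctAA (by omega) (by omega) (by omega))),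
       ct_union.2 (Or.inl (ctSA D.a2 (by omega) (by omega)))⟩,
      ⟨ctC e.symm (by omega) (by omega), ctAA (by omega) (by omega) (by omega), ctAA (by omega) (by omega) (by omega)⟩⟩

/-- A chord from the first open quarter to `r γ` forces the second quarter to be trivial. -/
theorem empty1 (D : Rg G) (hG : HFree G) {p : ℤ} (h0 : 0 < p) (h1 : p < D.β) (e : G.Adj (D.r p) (D.r D.γ)) :
    D.γ = D.β + 1 := by
  by_contra hne
  have := D.hβ; have := D.hγ; have := D.hδ; have := D.hN; have := D.hk
  refine no_K33 hG (D.rad (D.β + 1)) (a0 := D.seg 0 (D.k - 1) ∪ D.arc (p + 1) (D.β + 1)) (a1 := D.arc 0 p)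
    (a2 := D.arc D.γ D.δ)
    (b0 := D.seg D.k D.k) (b1 := D.arc p (p + 1)) (b2 := D.arc D.δ D.N) ?_ ?_ ?_ ?_ <;>
    simp only [List.pairwise_cons, List.mem_cons, forall_eq_or_imp, List.not_mem_nil,
        IsEmpty.forall_iff, implies_true, and_true, List.Pairwise.nil, Set.mem_union, not_or,
        Set.disjoint_union_left, Set.disjoint_union_right]
  · exact ⟨(conn_seg (by omega) (by omega) (by omega)).union_adj (conn_arc (by omega)) (mem_seg (by omega) (by omega)) (mem_arc (by omega) (by omega)) D.a1,
      conn_arc (by omega), conn_arc (by omega),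
      conn_seg (by omega) (by omega) (by omega), conn_arc (by omega), conn_arc (by omega)⟩
  · refine ⟨⟨⟨?_, ?_⟩, ⟨?_, ?_⟩, ⟨?_, ?_⟩, ⟨?_, ?_⟩, ⟨?_, ?_⟩⟩, ⟨?_, ?_, ?_, ?_⟩, ⟨?_, ?_, ?_⟩, ⟨?_, ?_⟩, ?_⟩ <;>
    first
    | exact dAA (by omega)
    | exact dSS (by omega)
    | exact dSA (by omega)
    | exact dAS (by omega)
  · refine ⟨⟨?_, ?_⟩, ?_, ?_, ?_, ?_, ?_⟩ <;>
    first
    | exact nS' (by omega)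
    | exact nA (by omega)
  · refine ⟨⟨ct_union.2 (Or.inl (ctSS (by omega) (by omega))), ct_union.2 (Or.inr (ctAA (by omega) (by omega) (by omega))),
        ct_union.2 (Or.inl (ctSA D.a2 (by omega) (by omega)))⟩,
      ⟨ctAS D.a3 (by omega) (by omega), ctAA (by omega) (by omega) (by omega), ctAA (by omega) (by omega) (by omega)⟩,
      ⟨ctAS D.a4 (by omega) (by omega), ctC e.symm (by omega) (by omega), ctAA (by omega) (by omega) (by omega)⟩⟩

set_option maxHeartbeats 2000000 in
theorem side1 (D : Rg G) (hG : HFree G) {p s j : ℤ} (h0 : 0 < p) (h1 : p < D.β) (e : G.Adj (D.r p) (D.r D.γ))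
    (hj : 1 ≤ j) (hj' : j ≤ D.k) (hs : p < s) (hs' : s < D.γ) : ¬ G.Adj (D.l j) (D.r s) := by
  intro f
  have hE := D.empty1 hG h0 h1 e
  have := D.hβ; have := D.hγ; have := D.hδ; have := D.hN; have := D.hk
  by_cases hjk : j = D.k
  · subst hjk
    obtain ⟨z', hz⟩ := D.lnbr (j := 1) (by omega) (by omega)
    refine no_K33 hG hz (a0 := D.seg 0 0 ∪ D.arc (p + 1) (D.β + 1)) (a1 := D.arc 0 p)
      (a2 := D.arc D.γ D.δ)
      (b0 := D.seg D.k D.k) (b1 := D.arc p (p + 1)) (b2 := D.arc D.δ D.N) ?_ ?_ ?_ ?_ <;>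
      simp only [List.pairwise_cons, List.mem_cons, forall_eq_or_imp, List.not_mem_nil,
          IsEmpty.forall_iff, implies_true, and_true, List.Pairwise.nil, Set.mem_union, not_or,
          Set.disjoint_union_left, Set.disjoint_union_right]
    · exact ⟨(conn_seg (by omega) (by omega) (by omega)).union_adj (conn_arc (by omega)) (mem_seg (by omega) (by omega)) (mem_arc (by omega) (by omega)) D.a1,
        conn_arc (by omega), conn_arc (by omega),
        conn_seg (by omega) (by omega) (by omega), conn_arc (by omega), conn_arc (by omega)⟩
    · refine ⟨⟨⟨?_, ?_⟩, ⟨?_, ?_⟩, ⟨?_, ?_⟩, ⟨?_, ?_⟩, ⟨?_, ?_⟩⟩, ⟨?_, ?_, ?_, ?_⟩, ⟨?_, ?_, ?_⟩, ⟨?_, ?_⟩, ?_⟩ <;>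
      first
      | exact dAA (by omega)
      | exact dSS (by omega)
      | exact dSA (by omega)
      | exact dAS (by omega)
    · refine ⟨⟨?_, ?_⟩, ?_, ?_, ?_, ?_, ?_⟩ <;>
      first
      | exact nS (by omega)
      | exact nA' (by omega)
    · refine ⟨⟨ct_union.2 (Or.inr (ctAS f (by omega) (by omega))), ct_union.2 (Or.inr (ctAA (by omega) (by omega) (by omega))),
          ct_union.2 (Or.inl (ctSA D.a2 (by omega) (by omega)))⟩,
        ⟨ctAS D.a3 (by omega) (by omega), ctAA (by omega) (by omega) (by omega), ctAA (by omega) (by omega) (by omega)⟩,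
        ⟨ctAS D.a4 (by omega) (by omega), ctC e.symm (by omega) (by omega), ctAA (by omega) (by omega) (by omega)⟩⟩
  · refine no_K33h hG (a0 := D.seg 0 0) (t0 := D.seg 1 (D.k - 1)) (t1 := D.arc (p + 1) (D.β + 1))
      (a1 := D.arc 0 p) (a2 := D.arc D.γ D.δ) (b0 := D.seg D.k D.k) (b1 := D.arc p (p + 1))
      (b2 := D.arc D.δ D.N) ?_ ?_
      (ctSA D.a2 (by omega) (by omega)) (ctAS D.a3 (by omega) (by omega))
      (ctAA (by omega) (by omega) (by omega)) (ctAA (by omega) (by omega) (by omega))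
      (ctAS D.a4 (by omega) (by omega)) (ctC e.symm (by omega) (by omega)) (ctAA (by omega) (by omega) (by omega))
      (ctSS (by omega) (by omega)).symm (ctSS (by omega) (by omega)) (ctAS D.a1 (by omega) (by omega))
      (ctAA (by omega) (by omega) (by omega)) (ctSA f (by omega) (by omega)) <;>
      simp only [List.pairwise_cons, List.mem_cons, forall_eq_or_imp, List.not_mem_nil,
          IsEmpty.forall_iff, implies_true, and_true, List.Pairwise.nil]
    · refine ⟨?_, ?_, ?_, ?_, ?_, ?_, ?_, ?_⟩ <;>
      first
      | exact conn_seg (by omega) (by omega) (by omega)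
      | exact conn_arc (by omega)
    · refine ⟨⟨?_, ?_, ?_, ?_, ?_, ?_, ?_⟩, ⟨?_, ?_, ?_, ?_, ?_, ?_⟩, ⟨?_, ?_, ?_, ?_, ?_⟩,
        ⟨?_, ?_, ?_, ?_⟩, ⟨?_, ?_, ?_⟩, ⟨?_, ?_⟩, ?_⟩ <;>
      first
      | exact dAA (by omega)
      | exact dSS (by omega)
      | exact dSA (by omega)
      | exact dAS (by omega)

set_option maxHeartbeats 2000000 in
theorem mid_aux (D : Rg G) (hG : HFree G) (e : G.Adj (D.r 0) (D.r D.γ)) {s s' j : ℤ}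
    (hj : 1 ≤ j) (hj' : j < D.k) (hs0 : 0 < s) (hs : s < D.γ) (hs' : D.γ < s') (hs'' : s' < D.N)
    (f : G.Adj (D.l j) (D.r s)) (f' : G.Adj (D.l D.k) (D.r s')) : False := by
  have := D.hβ; have := D.hγ; have := D.hδ; have := D.hN; have := D.hk
  refine no_K5h hG (s0 := D.arc 1 D.γ) (t0 := D.seg 1 (D.k - 1)) (s1 := D.seg D.k D.k) (t1 := D.seg 0 0)
    (s2 := D.arc (D.γ + 1) D.N) (s3 := D.arc 0 1) (s4 := D.arc D.γ (D.γ + 1)) ?_ ?_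
    (ctAA (by omega) (by omega) (by omega)) (ctAA (by omega) (by omega) (by omega))
    (ctSA f' (by omega) (by omega)) (ctSA D.a3 (by omega) (by omega)) (ctSA D.a4 (by omega) (by omega))
    (ctAA (by omega) (by omega) (by omega)) (ctAA (by omega) (by omega) (by omega))
    (ctC e (by omega) (by omega)) (ctSA f (by omega) (by omega)) (ctSS (by omega) (by omega))
    (ctSA D.a1 (by omega) (by omega)) (ctSA D.a2 (by omega) (by omega)) (ctSS (by omega) (by omega)).symm <;>
    simp only [List.pairwise_cons, List.mem_cons, forall_eq_or_imp, List.not_mem_nil,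
        IsEmpty.forall_iff, implies_true, and_true, List.Pairwise.nil]
  · refine ⟨?_, ?_, ?_, ?_, ?_, ?_, ?_⟩ <;>
    first
    | exact conn_seg (by omega) (by omega) (by omega)
    | exact conn_arc (by omega)
  · refine ⟨⟨?_, ?_, ?_, ?_, ?_, ?_⟩, ⟨?_, ?_, ?_, ?_, ?_⟩,
      ⟨?_, ?_, ?_, ?_⟩, ⟨?_, ?_, ?_⟩, ⟨?_, ?_⟩, ?_⟩ <;>
    first
    | exact dAA (by omega)
    | exact dSS (by omega)
    | exact dSA (by omega)
    | exact dAS (by omega)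

theorem mid (D : Rg G) (hG : HFree G) (e : G.Adj (D.r 0) (D.r D.γ)) {s s' j j' : ℤ}
    (hj : 1 ≤ j ∧ j ≤ D.k) (hj' : 1 ≤ j' ∧ j' ≤ D.k) (hs0 : 0 < s) (hs : s < D.γ) (hs' : D.γ < s') (hs'' : s' < D.N)
    (f : G.Adj (D.l j) (D.r s)) (f' : G.Adj (D.l j') (D.r s')) : False := by
  have := D.hβ; have := D.hγ; have := D.hδ; have := D.hN; have := D.hk
  by_cases hjk : j = D.k
  · subst hjk
    by_cases hjk' : j' = D.k
    · subst hjk'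
      obtain ⟨z', hz⟩ := D.lnbr (j := 1) (by omega) (by omega)
      refine no_K5 hG hz (s0 := D.seg D.k D.k) (s1 := D.arc 0 1) (s2 := D.arc D.γ (D.γ + 1))
        (s3 := D.seg 0 0 ∪ D.arc 1 D.γ) (s4 := D.arc (D.γ + 1) D.N) ?_ ?_ ?_ ?_ <;>
        simp only [List.pairwise_cons, List.mem_cons, forall_eq_or_imp, List.not_mem_nil,
          IsEmpty.forall_iff, implies_true, and_true, List.Pairwise.nil, Set.mem_union, not_or,
          Set.disjoint_union_left, Set.disjoint_union_right]
      · exact ⟨conn_seg (by omega) (by omega) (by omega), conn_arc (by omega), conn_arc (by omega),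
          (conn_seg (by omega) (by omega) (by omega)).union_adj (conn_arc (by omega)) (mem_seg (by omega) (by omega)) (mem_arc (by omega) (by omega)) D.a1,
          conn_arc (by omega)⟩
      · refine ⟨⟨?_, ?_, ⟨?_, ?_⟩, ?_⟩, ⟨?_, ⟨?_, ?_⟩, ?_⟩, ⟨⟨?_, ?_⟩, ?_⟩, ⟨?_, ?_⟩⟩ <;>
        first
        | exact dAA (by omega)
        | exact dSS (by omega)
        | exact dSA (by omega)
        | exact dAS (by omega)
      · refine ⟨?_, ?_, ?_, ⟨?_, ?_⟩, ?_⟩ <;>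
        first
        | exact nS (by omega)
        | exact nA' (by omega)
      · refine ⟨⟨ctSA D.a3 (by omega) (by omega), ctSA D.a4 (by omega) (by omega),
           (ct_union.2 (Or.inr (ctAS f (by omega) (by omega)))).symm, ctSA f' (by omega) (by omega)⟩,
          ⟨ctC e (by omega) (by omega), (ct_union.2 (Or.inr (ctAA (by omega) (by omega) (by omega)))).symm,
            ctAA (by omega) (by omega) (by omega)⟩,
          ⟨(ct_union.2 (Or.inr (ctAA (by omega) (by omega) (by omega)))).symm,
            ctAA (by omega) (by omega) (by omega)⟩, ct_union.2 (Or.inl (ctSA D.a2 (by omega) (by omega)))⟩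
    · have e' : G.Adj (D.ref.r 0) (D.ref.r D.ref.γ) := by
        have h := D.per (-(D.N - D.γ))
        rw [show -(D.N - D.γ) + D.N = D.γ by ring] at h
        simp only [ref, neg_zero, ← h]; exact e
      refine D.ref.mid_aux hG e' (s := D.N - s') (s' := D.N - s) (j := j') hj'.1 (lt_of_le_of_ne hj'.2 hjk')
        (by omega) (by simp only [ref]; omega) (by simp only [ref]; omega) (by simp only [ref]; omega) ?_ ?_
      · have h := D.per (-(D.N - s'))
        rw [show -(D.N - s') + D.N = s' by ring] at h
        simp only [ref, ← h]; exact f'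
      · have h := D.per (-(D.N - s))
        rw [show -(D.N - s) + D.N = s by ring] at h
        simp only [ref, ← h]; exact f
  · by_cases hjk' : j' = D.k
    · subst hjk'
      exact D.mid_aux hG e hj.1 (by omega) hs0 hs hs' hs'' f f'
    · exact hexa (D := D) hG (a := 1) (b := D.k - 1) (a' := D.k) (b' := D.k) (by omega)
        (ctSS (by omega) (by omega)) (j := 0) (by omega) (by omega) hs hs' hs'' (by omega) f D.a4 f' a3N
        (by omega) (by omega) (by omega) (by omega)

theorem common3 (hG : HFree G) {a b c j : ℤ} (ha : 0 ≤ a ∧ a ≤ b ∧ b + 1 ≤ c ∧ c ≤ D.k)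
    (hj : 0 ≤ j ∧ j ≤ D.k) (hj' : j < a ∨ c < j) {t p q j0 j1 j2 m0 m1 m2 : ℤ} (h01 : t < p) (h12 : p < q)
    (h20 : q < t + D.N)
    (e0 : G.Adj (D.l j0) (D.r t)) (e1 : G.Adj (D.l j1) (D.r p)) (e2 : G.Adj (D.l j2) (D.r q))
    (f0 : G.Adj (D.l m0) (D.r t)) (f1 : G.Adj (D.l m1) (D.r p)) (f2 : G.Adj (D.l m2) (D.r q))
    (k0 : a ≤ j0 ∧ j0 ≤ b) (k1 : a ≤ j1 ∧ j1 ≤ b) (k2 : a ≤ j2 ∧ j2 ≤ b)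
    (n0 : b + 1 ≤ m0 ∧ m0 ≤ c) (n1 : b + 1 ≤ m1 ∧ m1 ≤ c) (n2 : b + 1 ≤ m2 ∧ m2 ≤ c) : False := by
  obtain ⟨z', hz⟩ := D.lnbr hj.1 hj.2
  refine no_K5 hG hz (s0 := D.seg a b) (s1 := D.seg (b + 1) c) (s2 := D.arc t p) (s3 := D.arc p q)
    (s4 := D.arc q (t + D.N)) ?_ ?_ ?_ ?_ <;>
    simp only [List.pairwise_cons, List.mem_cons, forall_eq_or_imp, List.not_mem_nil,
        IsEmpty.forall_iff, implies_true, and_true, List.Pairwise.nil]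
  · refine ⟨?_, ?_, ?_, ?_, ?_⟩ <;>
    first
    | exact conn_seg (by omega) (by omega) (by omega)
    | exact conn_arc (by omega)
  · refine ⟨⟨?_, ?_, ?_, ?_⟩, ⟨?_, ?_, ?_⟩, ⟨?_, ?_⟩, ?_⟩ <;>
    first
    | exact dAA (by omega)
    | exact dSS (by omega)
    | exact dSA (by omega)
    | exact dAS (by omega)
  · refine ⟨?_, ?_, ?_, ?_, ?_⟩ <;>
    first
    | exact nS (by omega)
    | exact nA' (by omega)
  · exact ⟨⟨ctSS (by omega) rfl, ctSA e0 (by omega) (by omega), ctSA e1 (by omega) (by omega), ctSA e2 (by omega) (by omega)⟩,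
      ⟨ctSA f0 (by omega) (by omega), ctSA f1 (by omega) (by omega), ctSA f2 (by omega) (by omega)⟩,
      ⟨ctAA (by omega) (by omega) (by omega), ctAA (by omega) (by omega) (by omega)⟩, ctAA (by omega) (by omega) (by omega)⟩

/-- `t, q` are attachments of both outer segments and `p` of the middle one. -/
theorem middle (hG : HFree G) {a b c d j : ℤ} (ha : 0 ≤ a ∧ a ≤ b ∧ b + 1 ≤ c ∧ c + 1 ≤ d ∧ d ≤ D.k)
    (hj : 0 ≤ j ∧ j ≤ D.k) (hj' : j < a ∨ d < j) {t p q j0 j1 j2 m0 m2 : ℤ} (h01 : t < p) (h12 : p < q)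
    (h20 : q < t + D.N)
    (e0 : G.Adj (D.l j0) (D.r t)) (e1 : G.Adj (D.l j1) (D.r p)) (e2 : G.Adj (D.l j2) (D.r q))
    (f0 : G.Adj (D.l m0) (D.r t)) (f2 : G.Adj (D.l m2) (D.r q))
    (k0 : a ≤ j0 ∧ j0 ≤ b) (k1 : b + 1 ≤ j1 ∧ j1 ≤ c) (k2 : a ≤ j2 ∧ j2 ≤ b)
    (n0 : c + 1 ≤ m0 ∧ m0 ≤ d) (n2 : c + 1 ≤ m2 ∧ m2 ≤ d) : False := by
  obtain ⟨z', hz⟩ := D.lnbr hj.1 hj.2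
  refine no_K33 hG hz (a0 := D.seg a b) (a1 := D.seg (c + 1) d) (a2 := D.arc p q) (b0 := D.seg (b + 1) c)
    (b1 := D.arc t p) (b2 := D.arc q (t + D.N)) ?_ ?_ ?_ ?_ <;>
    simp only [List.pairwise_cons, List.mem_cons, forall_eq_or_imp, List.not_mem_nil,
        IsEmpty.forall_iff, implies_true, and_true, List.Pairwise.nil]
  · refine ⟨?_, ?_, ?_, ?_, ?_, ?_⟩ <;>
    first
    | exact conn_seg (by omega) (by omega) (by omega)
    | exact conn_arc (by omega)
  · refine ⟨⟨?_, ?_, ?_, ?_, ?_⟩, ⟨?_, ?_, ?_, ?_⟩, ⟨?_, ?_, ?_⟩, ⟨?_, ?_⟩, ?_⟩ <;>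
    first
    | exact dAA (by omega)
    | exact dSS (by omega)
    | exact dSA (by omega)
    | exact dAS (by omega)
  · refine ⟨?_, ?_, ?_, ?_, ?_, ?_⟩ <;>
    first
    | exact nS (by omega)
    | exact nA' (by omega)
  · exact ⟨⟨ctSS (by omega) rfl, ctSA e0 (by omega) (by omega), ctSA e2 (by omega) (by omega)⟩,
      ⟨(ctSS (by omega) rfl).symm, ctSA f0 (by omega) (by omega), ctSA f2 (by omega) (by omega)⟩,
      ⟨ctAS e1 (by omega) (by omega), ctAA (by omega) (by omega) (by omega), ctAA (by omega) (by omega) (by omega)⟩⟩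
end Rg

open SimpleGraph

namespace Rg
variable {V : Type*} {G : SimpleGraph V} (D : Rg G)

theorem same {p p' : ℤ} (h : p = p' ∨ p = p' + D.N ∨ p' = p + D.N) : D.r p = D.r p' := by
  rcases h with rfl | rfl | rfl
  · rfl
  · exact D.per _
  · exact (D.per _).symm

theorem rr {p q p' q' : ℤ} (e : G.Adj (D.r p) (D.r q)) (h : p = p' ∨ p = p' + D.N ∨ p' = p + D.N)
    (h' : q = q' ∨ q = q' + D.N ∨ q' = q + D.N) : G.Adj (D.r p') (D.r q') := by
  rwa [← D.same h, ← D.same h']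

theorem tt {j p j' p' : ℤ} (e : G.Adj (D.l j) (D.r p)) (h : j = j')
    (h' : p = p' ∨ p = p' + D.N ∨ p' = p + D.N) : G.Adj (D.l j') (D.r p') := by
  rwa [← D.same h', ← h]

theorem pos : 0 < D.β ∧ D.β < D.γ ∧ D.γ < D.δ ∧ D.δ < D.N ∧ 2 ≤ D.k :=
  ⟨D.hβ, D.hγ, D.hδ, D.hN, D.hk⟩

theorem rotF : D.rot.k = D.k ∧ D.rot.N = D.N ∧ D.rot.β = D.γ - D.β ∧ D.rot.γ = D.δ - D.β ∧ D.rot.δ = D.N - D.β :=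
  ⟨rfl, rfl, rfl, rfl, rfl⟩

theorem refF : D.ref.k = D.k ∧ D.ref.N = D.N ∧ D.ref.β = D.N - D.δ ∧ D.ref.γ = D.N - D.γ ∧ D.ref.δ = D.N - D.β :=
  ⟨rfl, rfl, rfl, rfl, rfl⟩

theorem rot_r (p : ℤ) : D.rot.r p = D.r (p + D.β) := rfl
theorem rot_l (p : ℤ) : D.rot.l p = D.l (D.k - p) := rfl
theorem ref_r (p : ℤ) : D.ref.r p = D.r (-p) := rfl
theorem ref_l (p : ℤ) : D.ref.l p = D.l p := rfl

variable {D}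
theorem rotA {p q p' q' : ℤ} (e : G.Adj (D.r p) (D.r q))
    (h : p' + D.β = p ∨ p' + D.β = p + D.N ∨ p' + D.β + D.N = p)
    (h' : q' + D.β = q ∨ q' + D.β = q + D.N ∨ q' + D.β + D.N = q) : G.Adj (D.rot.r p') (D.rot.r q') := by
  rw [rot_r, rot_r]; exact D.rr e (by omega) (by omega)

theorem refA {p q p' q' : ℤ} (e : G.Adj (D.r p) (D.r q))
    (h : -p' = p ∨ -p' = p + D.N ∨ -p' + D.N = p)
    (h' : -q' = q ∨ -q' = q + D.N ∨ -q' + D.N = q) : G.Adj (D.ref.r p') (D.ref.r q') := by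
  rw [ref_r, ref_r]; exact D.rr e (by omega) (by omega)

theorem rotT {j p j' p' : ℤ} (e : G.Adj (D.l j) (D.r p)) (hj : D.k - j' = j)
    (h : p' + D.β = p ∨ p' + D.β = p + D.N ∨ p' + D.β + D.N = p) : G.Adj (D.rot.l j') (D.rot.r p') := by
  rw [rot_r, rot_l]; exact D.tt e (by omega) (by omega)

theorem refT {j p p' : ℤ} (e : G.Adj (D.l j) (D.r p))
    (h : -p' = p ∨ -p' = p + D.N ∨ -p' + D.N = p) : G.Adj (D.ref.l j) (D.ref.r p') := by
  rw [ref_r, ref_l]; exact D.tt e (by omega) (by omega)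

variable (D)
-- chords inside a closed quarter
theorem quarter2 (hG : HFree G) {p q : ℤ} (h0 : D.β ≤ p) (h1 : p + 2 ≤ q) (h2 : q ≤ D.γ) :
    ¬ G.Adj (D.r p) (D.r q) := fun e => by
  have := D.pos; have := D.rotF
  exact D.rot.quarter1 hG (p := p - D.β) (q := q - D.β) (by omega) (by omega) (by omega)
    (rotA e (by omega) (by omega))

theorem quarter3 (hG : HFree G) {p q : ℤ} (h0 : D.γ ≤ p) (h1 : p + 2 ≤ q) (h2 : q ≤ D.δ) :
    ¬ G.Adj (D.r p) (D.r q) := fun e => by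
  have := D.pos; have := D.rotF
  exact D.rot.quarter2 hG (p := p - D.β) (q := q - D.β) (by omega) (by omega) (by omega)
    (rotA e (by omega) (by omega))

theorem quarter4 (hG : HFree G) {p q : ℤ} (h0 : D.δ ≤ p) (h1 : p + 2 ≤ q) (h2 : q ≤ D.N) :
    ¬ G.Adj (D.r p) (D.r q) := fun e => by
  have := D.pos; have := D.rotF
  exact D.rot.quarter3 hG (p := p - D.β) (q := q - D.β) (by omega) (by omega) (by omega)
    (rotA e (by omega) (by omega))

theorem adjacent2 (hG : HFree G) {p q : ℤ} (h0 : D.β < p) (h1 : p < D.γ) (h2 : D.γ < q) (h3 : q < D.δ) :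
    ¬ G.Adj (D.r p) (D.r q) := fun e => by
  have := D.pos; have := D.rotF
  exact D.rot.adjacent1 hG (p := p - D.β) (q := q - D.β) (by omega) (by omega) (by omega) (by omega)
    (rotA e (by omega) (by omega))

theorem adjacent3 (hG : HFree G) {p q : ℤ} (h0 : D.γ < p) (h1 : p < D.δ) (h2 : D.δ < q) (h3 : q < D.N) :
    ¬ G.Adj (D.r p) (D.r q) := fun e => by
  have := D.pos; have := D.rotF
  exact D.rot.adjacent2 hG (p := p - D.β) (q := q - D.β) (by omega) (by omega) (by omega) (by omega)
    (rotA e (by omega) (by omega))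

theorem adjacent4 (hG : HFree G) {p q : ℤ} (h0 : 0 < p) (h1 : p < D.β) (h2 : D.δ < q) (h3 : q < D.N) :
    ¬ G.Adj (D.r p) (D.r q) := fun e => by
  have := D.pos; have := D.rotF
  exact D.rot.adjacent3 hG (p := q - D.β) (q := p + D.N - D.β) (by omega) (by omega) (by omega) (by omega)
    (rotA e.symm (by omega) (by omega))

theorem opposite2 (hG : HFree G) {p q : ℤ} (h0 : D.β < p) (h1 : p < D.γ) (h2 : D.δ < q) (h3 : q < D.N) :
    ¬ G.Adj (D.r p) (D.r q) := fun e => by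
  have := D.pos; have := D.rotF
  exact D.rot.opposite1 hG (p := p - D.β) (q := q - D.β) (by omega) (by omega) (by omega) (by omega)
    (rotA e (by omega) (by omega))

theorem empty2 (hG : HFree G) {q : ℤ} (h0 : D.δ < q) (h1 : q < D.N) (e : G.Adj (D.r D.γ) (D.r q)) :
    D.δ = D.γ + 1 := by
  have := D.pos; have := D.refF
  have := D.ref.empty1 hG (p := D.N - q) (by omega) (by omega) (refA e.symm (by omega) (by omega))
  omega

theorem empty1r (hG : HFree G) {p : ℤ} (h0 : D.β < p) (h1 : p < D.γ) (e : G.Adj (D.r p) (D.r D.δ)) :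
    D.δ = D.γ + 1 := by
  have := D.pos; have := D.rotF
  have := D.rot.empty1 hG (p := p - D.β) (by omega) (by omega) (rotA e (by omega) (by omega))
  omega

theorem empty2r (hG : HFree G) {p : ℤ} (h0 : 0 < p) (h1 : p < D.β) (e : G.Adj (D.r p) (D.r D.δ)) :
    D.N = D.δ + 1 := by
  have := D.pos; have := D.rotF
  have := D.rot.empty2 hG (q := p + D.N - D.β) (by omega) (by omega) (rotA e.symm (by omega) (by omega))
  omega

/-- Chords drawn on the side of `l k`. -/
def CA (p q : ℤ) : Prop := (p = 0 ∧ D.β < q ∧ q < D.δ) ∨ (q = D.γ ∧ 0 ≤ p ∧ p < D.β) ∨ (p = D.γ ∧ D.δ < q ∧ q < D.N)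
/-- Chords drawn on the side of `l 0`. -/
def CB (p q : ℤ) : Prop := (p = D.β ∧ D.γ < q ∧ q < D.N) ∨ (q = D.δ ∧ 0 < p ∧ p < D.γ)

theorem chord (hG : HFree G) {p q : ℤ} (h0 : 0 ≤ p) (h1 : p + 2 ≤ q) (h2 : q < D.N) (h3 : ¬ (p = 0 ∧ q = D.N - 1))
    (e : G.Adj (D.r p) (D.r q)) : D.CA p q ∨ D.CB p q := by
  by_contra hc
  unfold CA CB at hc
  have := D.pos
  rcases (by omega : p = 0 ∨ (0 < p ∧ p < D.β) ∨ p = D.β ∨ (D.β < p ∧ p < D.γ) ∨ p = D.γ ∨ (D.γ < p ∧ p < D.δ) ∨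
      D.δ ≤ p) with c | c | c | c | c | c | c
  · have t1 : ¬ q ≤ D.β := fun a => D.quarter1 hG (by omega) h1 a e
    have t2 : ¬ D.δ ≤ q := fun b => D.quarter4 hG (p := q) (q := D.N) b (by omega) le_rfl
      (D.rr e.symm (by omega) (by omega))
    omega
  · have t1 : ¬ q ≤ D.β := fun a => D.quarter1 hG (by omega) h1 a e
    have t2 : ¬ (D.β < q ∧ q < D.γ) := fun a => D.adjacent1 hG c.1 c.2 a.1 a.2 e
    have t3 : ¬ (D.γ < q ∧ q < D.δ) := fun a => D.opposite1 hG c.1 c.2 a.1 a.2 e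
    have t4 : ¬ (D.δ < q) := fun a => D.adjacent4 hG c.1 c.2 a h2 e
    omega
  · have t1 : ¬ q ≤ D.γ := fun a => D.quarter2 hG (by omega) h1 a e
    omega
  · have t1 : ¬ q ≤ D.γ := fun a => D.quarter2 hG (by omega) h1 a e
    have t2 : ¬ (D.γ < q ∧ q < D.δ) := fun a => D.adjacent2 hG c.1 c.2 a.1 a.2 e
    have t3 : ¬ (D.δ < q) := fun a => D.opposite2 hG c.1 c.2 a h2 e
    omega
  · have t1 : ¬ q ≤ D.δ := fun a => D.quarter3 hG (by omega) h1 a e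
    omega
  · have t1 : ¬ q ≤ D.δ := fun a => D.quarter3 hG (by omega) h1 a e
    have t3 : ¬ (D.δ < q) := fun a => D.adjacent3 hG c.1 c.2 a h2 e
    omega
  · exact D.quarter4 hG c h1 h2.le e

theorem ncA (hG : HFree G) {p q p' q' : ℤ} (h : D.CA p q) (h' : D.CA p' q') (e : G.Adj (D.r p) (D.r q))
    (e' : G.Adj (D.r p') (D.r q')) (h1 : p < p') (h2 : p' < q) (h3 : q < q') : False := by
  have := D.pos
  unfold CA at h h'
  have a1 : q' = D.γ → 0 < p' → p' < D.β → D.γ = D.β + 1 := fun a b c => D.empty1 hG b c (by rwa [← a])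
  have a2 : p' = D.γ → D.δ < q' → q' < D.N → D.δ = D.γ + 1 := fun a b c => D.empty2 hG b c (by rwa [← a])
  omega

theorem ncB (hG : HFree G) {p q p' q' : ℤ} (h : D.CB p q) (h' : D.CB p' q') (e : G.Adj (D.r p) (D.r q))
    (e' : G.Adj (D.r p') (D.r q')) (h1 : p < p') (h2 : p' < q) (h3 : q < q') : False := by
  have := D.pos
  unfold CB at h h'
  have a1 : q' = D.δ → D.β < p' → p' < D.γ → D.δ = D.γ + 1 := fun a b c => D.empty1r hG b c (by rwa [← a])
  have a2 : q = D.δ → 0 < p → p < D.β → D.N = D.δ + 1 := fun a b c => D.empty2r hG b c (by rwa [← a])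
  omega

theorem side2 (hG : HFree G) {q s j : ℤ} (h0 : D.δ < q) (h1 : q < D.N) (e : G.Adj (D.r D.γ) (D.r q))
    (hj : 1 ≤ j) (hj' : j ≤ D.k) (hs : D.γ < s) (hs' : s < q) : ¬ G.Adj (D.l j) (D.r s) := fun f => by
  have := D.pos; have := D.refF
  exact D.ref.side1 hG (p := D.N - q) (s := D.N - s) (by omega) (by omega) (refA e.symm (by omega) (by omega))
    hj (by omega) (by omega) (by omega) (refT f (by omega))

theorem side3 (hG : HFree G) {q s j : ℤ} (h0 : D.γ < q) (h1 : q < D.δ) (e : G.Adj (D.r 0) (D.r q))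
    (hj : 1 ≤ j) (hj' : j ≤ D.k) (hs : q < s) (hs' : s < D.N) : ¬ G.Adj (D.l j) (D.r s) := fun f => by
  have := D.pos; have := D.rotF; have := D.rot.rotF
  exact D.rot.rot.side1 hG (p := q - D.γ) (s := s - D.γ) (by omega) (by omega)
    (rotA (p := q - D.β) (q := D.N - D.β) (rotA e.symm (by omega) (by omega)) (by omega) (by omega))
    hj (by omega) (by omega) (by omega)
    (rotT (p := s - D.β) (j := D.k - j) (rotT f (by omega) (by omega)) (by omega) (by omega))

theorem side4 (hG : HFree G) {q s j : ℤ} (h0 : D.β < q) (h1 : q < D.γ) (e : G.Adj (D.r 0) (D.r q))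
    (hj : 1 ≤ j) (hj' : j ≤ D.k) (hs : 0 < s) (hs' : s < q) : ¬ G.Adj (D.l j) (D.r s) := fun f => by
  have := D.pos; have := D.refF
  exact D.ref.side3 hG (q := D.N - q) (s := D.N - s) (by omega) (by omega) (refA e (by omega) (by omega))
    hj (by omega) (by omega) (by omega) (refT f (by omega))

theorem sepA (hG : HFree G) {p q s s' j j' : ℤ} (h : D.CA p q) (e : G.Adj (D.r p) (D.r q))
    (hj : 1 ≤ j ∧ j ≤ D.k) (hj' : 1 ≤ j' ∧ j' ≤ D.k) (hs : p < s ∧ s < q)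
    (hs' : (0 ≤ s' ∧ s' < p) ∨ (q < s' ∧ s' < D.N))
    (f : G.Adj (D.l j) (D.r s)) (f' : G.Adj (D.l j') (D.r s')) : False := by
  have hp := D.pos
  rcases h with ⟨rfl, h1, h2⟩ | ⟨rfl, h1, h2⟩ | ⟨rfl, h1, h2⟩
  · rcases lt_trichotomy q D.γ with h3 | rfl | h3
    · exact D.side4 hG h1 h3 e hj.1 hj.2 hs.1 hs.2 f
    · exact D.mid hG e hj hj' hs.1 hs.2 (by omega) (by omega) f f'
    · exact D.side3 hG h3 h2 e hj'.1 hj'.2 (by omega) (by omega) f'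
  · rcases h1.eq_or_lt with rfl | h3
    · exact D.mid hG e hj hj' hs.1 hs.2 (by omega) (by omega) f f'
    · exact D.side1 hG h3 h2 e hj.1 hj.2 hs.1 hs.2 f
  · exact D.side2 hG h1 h2 e hj.1 hj.2 hs.1 hs.2 f

theorem sepB (hG : HFree G) {p q s s' j j' : ℤ} (h : D.CB p q) (e : G.Adj (D.r p) (D.r q))
    (hj : 0 ≤ j ∧ j < D.k) (hj' : 0 ≤ j' ∧ j' < D.k) (hs : p < s ∧ s < q)
    (hs' : (0 ≤ s' ∧ s' < p) ∨ (q < s' ∧ s' < D.N))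
    (f : G.Adj (D.l j) (D.r s)) (f' : G.Adj (D.l j') (D.r s')) : False := by
  have hp := D.pos; have hr := D.rotF
  unfold CB at h
  have key : ∀ x : ℤ, ∃ y, (y + D.β = x ∧ D.β ≤ x) ∨ (y + D.β = x + D.N ∧ x < D.β) := fun x => by
    by_cases hx : D.β ≤ x
    · exact ⟨x - D.β, by omega⟩
    · exact ⟨x + D.N - D.β, by omega⟩
  obtain ⟨s1, h1⟩ := key s
  obtain ⟨s2, h2⟩ := key s'
  have f1 : G.Adj (D.rot.l (D.k - j)) (D.rot.r s1) := rotT f (by omega) (by omega)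
  have f2 : G.Adj (D.rot.l (D.k - j')) (D.rot.r s2) := rotT f' (by omega) (by omega)
  by_cases hc : D.β ≤ p
  · exact D.rot.sepA hG (p := p - D.β) (q := q - D.β) (by unfold CA; omega) (rotA e (by omega) (by omega))
      (by omega) (by omega) (by omega) (by omega) f1 f2
  · exact D.rot.sepA hG (p := q - D.β) (q := p + D.N - D.β) (by unfold CA; omega)
      (rotA e.symm (by omega) (by omega))
      (by omega) (by omega) (by omega) (by omega) f2 f1

end Rg

open SimpleGraph

structure OS (T : ℤ → ℤ → Prop) (N i : ℤ) : Prop where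
  hN : 0 < N
  per : ∀ j p, T j (p + N) ↔ T j p
  alt : ∀ b p0 p1 p2 p3 j0 j1 j2 j3, p0 < p1 → p1 < p2 → p2 < p3 → p3 < p0 + N → T j0 p0 → T j1 p1 → T j2 p2 →
    T j3 p3 → (0 ≤ j0 ∧ j0 ≤ b) → (b < j1 ∧ j1 ≤ i) → (0 ≤ j2 ∧ j2 ≤ b) → (b < j3 ∧ j3 ≤ i) → False
  com : ∀ b t p q j0 j1 j2 m0 m1 m2, t < p → p < q → q < t + N → T j0 t → T j1 p → T j2 q → T m0 t → T m1 p →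
    T m2 q → (0 ≤ j0 ∧ j0 ≤ b) → (0 ≤ j1 ∧ j1 ≤ b) → (0 ≤ j2 ∧ j2 ≤ b) →
    (b < m0 ∧ m0 ≤ i) → (b < m1 ∧ m1 ≤ i) → (b < m2 ∧ m2 ≤ i) → False
  mid : ∀ b c t p q j0 j1 j2 m0 m2, t < p → p < q → q < t + N → T j0 t → T j1 p → T j2 q → T m0 t →
    T m2 q → (0 ≤ j0 ∧ j0 ≤ b) → (b < j1 ∧ j1 ≤ c) → (0 ≤ j2 ∧ j2 ≤ b) →
    (c < m0 ∧ m0 ≤ i) → (c < m2 ∧ m2 ≤ i) → False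

namespace OS
variable {T : ℤ → ℤ → Prop} {N i : ℤ}

theorem per' (h : OS T N i) {j p : ℤ} (hp : T j p) : T j (p + N) := (h.per _ _).2 hp

theorem perN (h : OS T N i) {j p : ℤ} (hp : T j p) : T j (p - N) := by
  have := h.per j (p - N)
  rw [sub_add_cancel] at this
  exact this.1 hp

theorem refl (h : OS T N i) : OS (fun j p => T j (-p)) N i where
  hN := h.hN
  per j p := by
    have := h.per j (-(p + N))
    rw [show -(p + N) + N = -p by ring] at this
    exact this.symm
  alt b p0 p1 p2 p3 j0 j1 j2 j3 h1 h2 h3 h4 t0 t1 t2 t3 k0 k1 k2 k3 :=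
    h.alt b (-p2) (-p1) (-p0) (-p3 + N) j2 j1 j0 j3 (by omega) (by omega) (by omega) (by omega) t2 t1 t0
      (h.per' t3) k2 k1 k0 k3
  com b t p q j0 j1 j2 m0 m1 m2 h1 h2 h3 t0 t1 t2 s0 s1 s2 k0 k1 k2 n0 n1 n2 :=
    h.com b (-q) (-p) (-t) j2 j1 j0 m2 m1 m0 (by omega) (by omega) (by omega) t2 t1 t0 s2 s1 s0 k2 k1 k0 n2 n1 n0
  mid b c t p q j0 j1 j2 m0 m2 h1 h2 h3 t0 t1 t2 s0 s2 k0 k1 k2 n0 n2 :=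
    h.mid b c (-q) (-p) (-t) j2 j1 j0 m2 m0 (by omega) (by omega) (by omega) t2 t1 t0 s2 s0 k2 k1 k0 n2 n0

theorem core (h : OS T N i) {j j' t p q q' p' mt mq m : ℤ} (hjj : j ≤ j') (hi : j' ≤ i) (h1 : t < p) (h2 : p < q)
    (h3 : q < t + N) (h4 : t < q') (h5 : q' < p') (h6 : p' < t + N) (tt : T i t) (t0 : T mt t) (tp : T j p)
    (tq : T mq q) (tp' : T j' p') (tq' : T m q') (k0 : 0 ≤ mt ∧ mt < j) (k1 : 0 ≤ mq ∧ mq < j)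
    (k2 : 0 ≤ m ∧ m < j') : False := by
  have tt' := h.per' tt
  rcases lt_or_ge q p' with c | c
  · exact h.alt (j - 1) t p q p' mt j mq j' h1 h2 c (by omega) t0 tp tq tp' (by omega) (by omega) (by omega) (by omega)
  rcases lt_or_ge m j with d | d
  · rcases c.lt_or_eq with c | rfl
    · exact h.alt (j - 1) q' p' q (t + N) m j' mq i (by omega) (by omega) (by omega) (by omega) tq' tp' tq tt'
        (by omega) (by omega) (by omega) (by omega)
    · rcases lt_trichotomy q' p with f | rfl | f
      · exact h.alt (j - 1) q' p p' (t + N) m j mq i (by omega) (by omega) (by omega) (by omega) tq' tp tq tt'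
          (by omega) (by omega) (by omega) (by omega)
      · exact h.com (j - 1) t q' p' mt m mq i j j' (by omega) (by omega) (by omega) t0 tq' tq tt tp tp'
          (by omega) (by omega) (by omega) (by omega) (by omega) (by omega)
      · exact h.alt (j - 1) t p q' p' mt j m j' (by omega) (by omega) (by omega) (by omega) t0 tp tq' tp'
          (by omega) (by omega) (by omega) (by omega)
  · rcases c.lt_or_eq with c | rfl
    · exact h.alt (j' - 1) q' p' q (t + N) m j' mq i (by omega) (by omega) (by omega) (by omega) tq' tp' tq tt'
        (by omega) (by omega) (by omega) (by omega)
    · exact h.mid (j - 1) (j' - 1) t q' p' mt m mq i j' (by omega) (by omega) (by omega) t0 tq' tq tt tp'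
        (by omega) (by omega) (by omega) (by omega) (by omega)

theorem order (h : OS T N i) {t : ℤ} (ht : T i t) :
    ∃ g, ∀ j p, 0 ≤ j → j ≤ i → T j p → g ≤ p → p < g + N →
      (∀ m q, 0 ≤ m → m < j → T m q → g ≤ q → q < g + N → q ≠ p → p < q) ∨
      (∀ m q, 0 ≤ m → m < j → T m q → g ≤ q → q < g + N → q ≠ p → q < p) := by
  by_contra hc
  push Not at hc
  have ht' := h.per' ht
  obtain ⟨j, p, hj, hj', tp, g1, g2, ⟨m1, q1, a1, a2, a3, a4, a5, a6, a7⟩, ⟨m2, q2, b1, b2, b3, b4, b5, b6, b7⟩⟩ := hc t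
  obtain ⟨j', p', hk, hk', tp', g1', g2', ⟨m1', q1', a1', a2', a3', a4', a5', a6', a7'⟩,
    ⟨m2', q2', b1', b2', b3', b4', b5', b6', b7'⟩⟩ := hc (t + 1)
  have e1 : q1 = t := by
    by_contra hne
    exact h.alt (j - 1) q1 p q2 (t + N) m1 j m2 i (by omega) (by omega) (by omega) (by omega) a3 tp b3 ht'
      (by omega) (by omega) (by omega) (by omega)
  have e2 : q2' = t + N := by
    by_contra hne
    exact h.alt (j' - 1) q1' p' q2' (t + N) m1' j' m2' i (by omega) (by omega) (by omega) (by omega) a3' tp' b3' ht'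
      (by omega) (by omega) (by omega) (by omega)
  subst e1
  subst e2
  rcases le_total j j' with c | c
  · exact h.core (t := q1) (p := p) (q := q2) (q' := q1') (p' := p') c hk' (by omega) (by omega) (by omega) (by omega)
      (by omega) (by omega) ht a3 tp b3 tp' a3' (by omega) (by omega) (by omega)
  · have hp : ∀ {j p}, T j p → T j (- (- p + N)) := fun {j p} hh => by
      rw [show -(-p + N) = p - N by ring]; exact h.perN hh
    have ht2 : T i (- (- q1)) := by rwa [neg_neg]
    have hb2 : T m2' (- (- q1)) := by
      have := h.perN b3'
      rwa [add_sub_cancel_right, ← neg_neg q1] at this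
    exact h.refl.core (t := -q1) (p := -p' + N) (q := -q1' + N) (q' := -q2 + N) (p' := -p + N) c hj' (by omega)
      (by omega) (by omega) (by omega)
      (by omega) (by omega) ht2 hb2 (hp tp') (hp a3') (hp tp) (hp b3) (by omega) (by omega) (by omega)

end OS

namespace Rg
variable {V : Type*} {G : SimpleGraph V} (D : Rg G)

theorem perAdj (x : V) (p : ℤ) : G.Adj x (D.r (p + D.N)) ↔ G.Adj x (D.r p) := by rw [D.per]

theorem os (hG : HFree G) {i : ℤ} (hi : 0 ≤ i) (hi' : i < D.k) : OS (fun j p => G.Adj (D.l j) (D.r p)) D.N i where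
  hN := by have := D.pos; omega
  per j p := D.perAdj _ _
  alt b p0 p1 p2 p3 j0 j1 j2 j3 h1 h2 h3 h4 t0 t1 t2 t3 k0 k1 k2 k3 :=
    hexa (D := D) hG (a := 0) (b := b) (a' := b + 1) (b' := i) (by omega) (ctSS (by omega) (by omega)) (j := D.k)
      (by omega) (by omega) h1 h2 h3 h4 t0 t1 t2 t3 k0 k2 (by omega) (by omega)
  com b t p q j0 j1 j2 m0 m1 m2 h1 h2 h3 t0 t1 t2 s0 s1 s2 k0 k1 k2 n0 n1 n2 :=
    common3 (D := D) hG (a := 0) (b := b) (c := i) (j := D.k) (by omega) (by omega) (by omega) h1 h2 h3 t0 t1 t2 s0 s1 s2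
      k0 k1 k2 n0 n1 n2
  mid b c t p q j0 j1 j2 m0 m2 h1 h2 h3 t0 t1 t2 s0 s2 k0 k1 k2 n0 n2 :=
    middle (D := D) hG (a := 0) (b := b) (c := c) (d := i) (j := D.k) (by omega) (by omega) (by omega) h1 h2 h3
      t0 t1 t2 s0 s2 k0 k1 k2 n0 n2

end Rg

open SimpleGraph

theorem dl_lt {V : Type*} {r : V → ℕ} {x y : V} (h : r x < r y) : dl r x y = 1 := if_pos h
theorem dl_gt {V : Type*} {r : V → ℕ} {x y : V} (h : r y < r x) : dl r x y = 0 := if_neg (by omega)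

open Classical in
theorem side_cert {V : Type*} {E : V → V → Prop} {I R : V → Prop} {f : V → ℤ} {rk : V → ℕ}
    (inj : Function.Injective rk)
    (hIR : ∀ x, I x → ¬ R x)
    (hE : ∀ x y, E x y → (I x ∨ R x) ∧ (I y ∨ R y))
    (sym : ∀ x y, E x y → E y x)
    (h1 : ∀ x y, I x → I y → E x y → f x = f y + 1 ∨ f y = f x + 1)
    (hf : ∀ x y, I x → I y → f x = f y → x = y)
    (rI : ∀ x y, I x → I y → f y < f x → rk x < rk y)
    (rR : ∀ x y, I x → R y → rk x < rk y)
    (sp : ∃ α β : V → V → ZMod 2, ∀ x y p q, I x → I y → R p → R q → E x p → E y q → f y < f x → p ≠ q →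
      dl rk p q = α x p + β y q)
    (rr : ∀ x y z w, R x → R y → R z → R w → E x y → E z w → x ≠ z → x ≠ w → y ≠ z → y ≠ w →
      dl rk x z + dl rk y z + dl rk x w + dl rk y w = 0)
    (se : ∀ x y q v q' v', R x → R y → E x y → I v → I v' → R q → R q' → E v q → E v' q' → q ≠ x → q ≠ y →
      q' ≠ x → q' ≠ y → dl rk x q + dl rk y q = dl rk x q' + dl rk y q') :
    ∃ ψ : V → V → V → ZMod 2, (∀ x y z, ¬ I z → ψ x y z = 0) ∧
      ∀ x y z w, E x y → E z w → x ≠ z → x ≠ w → y ≠ z → y ≠ w →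
        dl rk x z + dl rk y z + dl rk x w + dl rk y w = ψ x y z + ψ x y w + ψ z w x + ψ z w y := by
  obtain ⟨α, β, sp⟩ := sp
  obtain ⟨c, hc⟩ : ∃ c : V → V → ZMod 2, ∀ x y q v, R x → R y → E x y → I v → R q → E v q → q ≠ x → q ≠ y →
      dl rk x q + dl rk y q = c x y := by
    have : ∀ x y, ∃ c : ZMod 2, ∀ q v, R x → R y → E x y → I v → R q → E v q → q ≠ x → q ≠ y →
      dl rk x q + dl rk y q = c := by
      intro x y
      by_cases h : ∃ q v, R x ∧ R y ∧ E x y ∧ I v ∧ R q ∧ E v q ∧ q ≠ x ∧ q ≠ y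
      · obtain ⟨q, v, a1, a2, a3, a4, a5, a6, a7, a8⟩ := h
        exact ⟨_, fun q' v' _ _ _ b4 b5 b6 b7 b8 => se x y q' v' q v a1 a2 a3 b4 a4 b5 a5 b6 a6 b7 b8 a7 a8⟩
      · exact ⟨0, fun q v a1 a2 a3 a4 a5 a6 a7 a8 => (h ⟨q, v, a1, a2, a3, a4, a5, a6, a7, a8⟩).elim⟩
    choose c hc using this
    exact ⟨c, hc⟩
  let sk : V → V → V → ZMod 2 := fun x p z => if f z < f x then α x p else β x p
  obtain ⟨ψ, p0, pRR, pIR, pRI, pII⟩ : ∃ ψ : V → V → V → ZMod 2, (∀ x y z, ¬ I z → ψ x y z = 0) ∧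
      (∀ x y z, I z → R x → R y → ψ x y z = c x y) ∧ (∀ x y z, I z → I x → R y → ψ x y z = sk x y z) ∧
      (∀ x y z, I z → R x → I y → ψ x y z = sk y x z) ∧ (∀ x y z, I z → I x → I y → ψ x y z = 0) := by
    refine ⟨fun x y z => if ¬ I z then 0 else if R x ∧ R y then c x y else if R y then sk x y z else
      if R x then sk y x z else 0, fun x y z h => if_pos h, fun x y z h a b => ?_, fun x y z h a b => ?_,
      fun x y z h a b => ?_, fun x y z h a b => ?_⟩
    · simp only [h, a, b, not_true_eq_false, if_false, and_self, if_true]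
    · have := hIR x a
      simp only [h, this, b, not_true_eq_false, if_false, false_and, if_true]
    · have := hIR y b
      simp only [h, this, a, not_true_eq_false, if_false, and_false, if_true]
    · have := hIR y b
      have := hIR x a
      simp only [h, *, not_true_eq_false, if_false, and_false]
  refine ⟨ψ, p0, ?_⟩
  have nI : ∀ x y z, R z → ψ x y z = 0 := fun x y z hz => p0 x y z fun h => hIR z h hz
  have dI : ∀ x z, I x → I z → x ≠ z → dl rk x z = if f z < f x then 1 else 0 := by
    intro x z hx hz hne
    rcases lt_trichotomy (f z) (f x) with h | h | h
    · rw [if_pos h, dl_lt (rI x z hx hz h)]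
    · exact (hne (hf x z hx hz h.symm)).elim
    · rw [if_neg (by omega), dl_gt (rI z x hz hx h)]
  have d1 : ∀ x z, I x → R z → dl rk x z = 1 := fun x z hx hz => dl_lt (rR x z hx hz)
  have d0 : ∀ x z, I x → R z → dl rk z x = 0 := fun x z hx hz => dl_gt (rR x z hx hz)
  have fne : ∀ x z, I x → I z → x ≠ z → f x ≠ f z := fun x z hx hz hne h => hne (hf x z hx hz h)
  have C1 : ∀ x y z w, I x → I y → I z → I w → E x y → E z w → x ≠ z → x ≠ w → y ≠ z → y ≠ w →
      dl rk x z + dl rk y z + dl rk x w + dl rk y w = ψ x y z + ψ x y w + ψ z w x + ψ z w y := by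
    intro x y z w ix iy iz iw e e' n1 n2 n3 n4
    rw [dI x z ix iz n1, dI y z iy iz n3, dI x w ix iw n2, dI y w iy iw n4, pII x y z iz ix iy, pII x y w iw ix iy,
      pII z w x ix iz iw, pII z w y iy iz iw]
    have := h1 x y ix iy e
    have := h1 z w iz iw e'
    have := fne x z ix iz n1; have := fne x w ix iw n2; have := fne y z iy iz n3; have := fne y w iy iw n4
    split_ifs <;> first | omega | decide
  have C2 : ∀ x y z w, I x → I y → I z → R w → E x y → E z w → x ≠ z → x ≠ w → y ≠ z → y ≠ w →
      dl rk x z + dl rk y z + dl rk x w + dl rk y w = ψ x y z + ψ x y w + ψ z w x + ψ z w y := by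
    intro x y z w ix iy iz iw e e' n1 n2 n3 n4
    rw [dI x z ix iz n1, dI y z iy iz n3, d1 x w ix iw, d1 y w iy iw, pII x y z iz ix iy, nI x y w iw,
      pIR z w x ix iz iw, pIR z w y iy iz iw]
    have := h1 x y ix iy e
    have := fne x z ix iz n1; have := fne y z iy iz n3
    have hh : ∀ a : ZMod 2, 1 + 1 + 1 + 1 = 0 + 0 + a + a ∧ 0 + 0 + 1 + 1 = 0 + 0 + a + a := by decide
    simp only [sk]
    split_ifs <;> first | omega | exact (hh _).1 | exact (hh _).2
  have C3 : ∀ x y z w, I x → I y → R z → R w → E x y → E z w → x ≠ z → x ≠ w → y ≠ z → y ≠ w →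
      dl rk x z + dl rk y z + dl rk x w + dl rk y w = ψ x y z + ψ x y w + ψ z w x + ψ z w y := by
    intro x y z w ix iy iz iw e e' n1 n2 n3 n4
    rw [d1 x z ix iz, d1 y z iy iz, d1 x w ix iw, d1 y w iy iw, nI x y z iz, nI x y w iw,
      pRR z w x ix iz iw, pRR z w y iy iz iw]
    generalize c z w = a
    revert a; decide
  have C4 : ∀ x y z w, I x → R y → I z → R w → E x y → E z w → x ≠ z → x ≠ w → y ≠ z → y ≠ w →
      dl rk x z + dl rk y z + dl rk x w + dl rk y w = ψ x y z + ψ x y w + ψ z w x + ψ z w y := by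
    intro x y z w ix iy iz iw e e' n1 n2 n3 n4
    rw [dI x z ix iz n1, d0 z y iz iy, d1 x w ix iw, nI x y w iw, nI z w y iy, pIR x y z iz ix iy, pIR z w x ix iz iw]
    simp only [sk]
    rcases lt_or_gt_of_ne (fne x z ix iz n1) with h | h
    · have hh := sp z x w y iz ix iw iy e' e h n4.symm
      have h2 := dl_swap (r := rk) inj n4
      rw [if_neg (by omega), if_neg (by omega), if_pos h, h2, hh]
      generalize α z w = a
      generalize β x y = b
      revert a b; decide
    · have hh := sp x z y w ix iz iy iw e e' h n4
      rw [if_pos (by omega), if_pos (by omega), if_neg (by omega), hh]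
      generalize α x y = a
      generalize β z w = b
      revert a b; decide
  have C5 : ∀ x y z w, I x → R y → R z → R w → E x y → E z w → x ≠ z → x ≠ w → y ≠ z → y ≠ w →
      dl rk x z + dl rk y z + dl rk x w + dl rk y w = ψ x y z + ψ x y w + ψ z w x + ψ z w y := by
    intro x y z w ix iy iz iw e e' n1 n2 n3 n4
    have hh := hc z w y x iz iw e' ix iy e n3 n4
    rw [d1 x z ix iz, d1 x w ix iw, nI x y z iz, nI x y w iw, nI z w y iy, pRR z w x ix iz iw, ← hh,
      dl_swap (r := rk) inj n3, dl_swap (r := rk) inj n4]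
    generalize dl rk z y = a
    generalize dl rk w y = b
    revert a b; decide
  have C6 : ∀ x y z w, R x → R y → R z → R w → E x y → E z w → x ≠ z → x ≠ w → y ≠ z → y ≠ w →
      dl rk x z + dl rk y z + dl rk x w + dl rk y w = ψ x y z + ψ x y w + ψ z w x + ψ z w y := by
    intro x y z w ix iy iz iw e e' n1 n2 n3 n4
    rw [rr x y z w ix iy iz iw e e' n1 n2 n3 n4, nI _ _ _ ix, nI _ _ _ iy, nI _ _ _ iz, nI _ _ _ iw]
    decide
  have ps : ∀ x y z, I x → R y → ψ x y z = ψ y x z := by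
    intro x y z ix iy
    by_cases hz : I z
    · rw [pIR x y z hz ix iy, pRI y x z hz iy ix]
    · rw [p0 _ _ _ hz, p0 _ _ _ hz]
  -- symmetry reductions
  have sw : ∀ x y z w, x ≠ z → x ≠ w → y ≠ z → y ≠ w →
      dl rk z x + dl rk w x + dl rk z y + dl rk w y = ψ z w x + ψ z w y + ψ x y z + ψ x y w →
      dl rk x z + dl rk y z + dl rk x w + dl rk y w = ψ x y z + ψ x y w + ψ z w x + ψ z w y := by
    intro x y z w n1 n2 n3 n4 h
    rw [dl_swap (r := rk) inj n1, dl_swap (r := rk) inj n2, dl_swap (r := rk) inj n3, dl_swap (r := rk) inj n4]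
    have h' : ψ x y z + ψ x y w + ψ z w x + ψ z w y = dl rk z x + dl rk w x + dl rk z y + dl rk w y := by
      linear_combination -h
    rw [h']
    generalize dl rk z x = a1
    generalize dl rk w x = a2
    generalize dl rk z y = a3
    generalize dl rk w y = a4
    revert a1 a2 a3 a4; decide
  -- first edge II or IR or RR with arbitrary second edge
  have S1 : ∀ x y z w, I x → I y → E x y → E z w → x ≠ z → x ≠ w → y ≠ z → y ≠ w →
      dl rk x z + dl rk y z + dl rk x w + dl rk y w = ψ x y z + ψ x y w + ψ z w x + ψ z w y := by
    intro x y z w ix iy e e' n1 n2 n3 n4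
    obtain ⟨hz | hz, hw | hw⟩ := hE z w e'
    · exact C1 x y z w ix iy hz hw e e' n1 n2 n3 n4
    · exact C2 x y z w ix iy hz hw e e' n1 n2 n3 n4
    · have := C2 x y w z ix iy hw hz e (sym _ _ e') n2 n1 n4 n3
      rw [ps w z x hw hz, ps w z y hw hz] at this
      linear_combination this
    · exact C3 x y z w ix iy hz hw e e' n1 n2 n3 n4
  have S2 : ∀ x y z w, I x → R y → E x y → E z w → x ≠ z → x ≠ w → y ≠ z → y ≠ w →
      dl rk x z + dl rk y z + dl rk x w + dl rk y w = ψ x y z + ψ x y w + ψ z w x + ψ z w y := by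
    intro x y z w ix iy e e' n1 n2 n3 n4
    obtain ⟨hz | hz, hw | hw⟩ := hE z w e'
    · exact sw _ _ _ _ n1 n2 n3 n4 (C2 z w x y hz hw ix iy e' e n1.symm n3.symm n2.symm n4.symm)
    · exact C4 x y z w ix iy hz hw e e' n1 n2 n3 n4
    · have := C4 x y w z ix iy hw hz e (sym _ _ e') n2 n1 n4 n3
      rw [ps w z x hw hz, ps w z y hw hz] at this
      linear_combination this
    · exact C5 x y z w ix iy hz hw e e' n1 n2 n3 n4
  intro x y z w e e' n1 n2 n3 n4
  obtain ⟨hx | hx, hy | hy⟩ := hE x y e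
  · exact S1 x y z w hx hy e e' n1 n2 n3 n4
  · exact S2 x y z w hx hy e e' n1 n2 n3 n4
  · have := S2 y x z w hy hx (sym _ _ e) e' n3 n4 n1 n2
    rw [ps y x z hy hx, ps y x w hy hx] at this
    linear_combination this
  · obtain ⟨hz | hz, hw | hw⟩ := hE z w e'
    · exact sw _ _ _ _ n1 n2 n3 n4 (C3 z w x y hz hw hx hy e' e n1.symm n3.symm n2.symm n4.symm)
    · exact sw _ _ _ _ n1 n2 n3 n4 (C5 z w x y hz hw hx hy e' e n1.symm n3.symm n2.symm n4.symm)
    · refine sw _ _ _ _ n1 n2 n3 n4 ?_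
      have := C5 w z x y hw hz hx hy (sym _ _ e') e n2.symm n4.symm n1.symm n3.symm
      rw [ps w z x hw hz, ps w z y hw hz] at this
      linear_combination this
    · exact C6 x y z w hx hy hz hw e e' n1 n2 n3 n4

open Classical in
theorem glue_cert {V : Type*} {G : SimpleGraph V} {Ei Eo : V → V → Prop} {I O : V → Prop} {rk : V → ℕ}
    (inj : Function.Injective rk) (hE : ∀ x y, G.Adj x y → Ei x y ∨ Eo x y)
    (hi : ∀ x y, Ei x y → ¬ O x ∧ ¬ O y) (ho : ∀ x y, Eo x y → ¬ I x ∧ ¬ I y)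
    {ψ ψ' : V → V → V → ZMod 2} (p0 : ∀ x y z, ¬ I z → ψ x y z = 0) (p0' : ∀ x y z, ¬ O z → ψ' x y z = 0)
    (h : ∀ x y z w, Ei x y → Ei z w → x ≠ z → x ≠ w → y ≠ z → y ≠ w →
        dl rk x z + dl rk y z + dl rk x w + dl rk y w = ψ x y z + ψ x y w + ψ z w x + ψ z w y)
    (h' : ∀ x y z w, Eo x y → Eo z w → x ≠ z → x ≠ w → y ≠ z → y ≠ w →
        dl rk x z + dl rk y z + dl rk x w + dl rk y w = ψ' x y z + ψ' x y w + ψ' z w x + ψ' z w y) :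
    Cert G rk (fun x y z => if Ei x y then ψ x y z else dl rk x z + dl rk y z + ψ' x y z) := by
  intro x y z w e e' n1 n2 n3 n4
  have hs : dl rk z x + dl rk w x + dl rk z y + dl rk w y = dl rk x z + dl rk y z + dl rk x w + dl rk y w := by
    rw [dl_swap (r := rk) inj n1, dl_swap (r := rk) inj n2, dl_swap (r := rk) inj n3, dl_swap (r := rk) inj n4]
    generalize dl rk z x = a1
    generalize dl rk w x = a2
    generalize dl rk z y = a3
    generalize dl rk w y = a4
    revert a1 a2 a3 a4; decide
  have two : ∀ a : ZMod 2, a + a = 0 := by decide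
  by_cases c : Ei x y <;> by_cases c' : Ei z w <;> simp only [c, c', if_true, if_false]
  · exact h x y z w c c' n1 n2 n3 n4
  · have d := (hE z w e').resolve_left c'
    rw [p0 x y z (ho z w d).1, p0 x y w (ho z w d).2, p0' z w x (hi x y c).1, p0' z w y (hi x y c).2]
    linear_combination -hs
  · have d := (hE x y e).resolve_left c
    rw [p0 z w x (ho x y d).1, p0 z w y (ho x y d).2, p0' x y z (hi z w c').1, p0' x y w (hi z w c').2]
    ring
  · have d := (hE x y e).resolve_left c
    have d' := (hE z w e').resolve_left c'
    have := h' x y z w d d' n1 n2 n3 n4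
    have t := two (dl rk x z + dl rk y z + dl rk x w + dl rk y w)
    linear_combination this - t - hs

open SimpleGraph

theorem ring_part {V : Type*} {pos : V → ℤ} {rk : V → ℕ} {K N : ℤ} {E C : V → V → Prop} {J : V → Prop}
    (pinj : ∀ x y, pos x = pos y → x = y)
    (hrk : ∀ x, K < pos x → (rk x : ℤ) = pos x) (bd : ∀ x, pos x < K + 1 + N) (sym : ∀ x y, E x y → E y x)
    (shape : ∀ x y, K < pos x → K < pos y → E x y → pos x < pos y →
      pos y = pos x + 1 ∨ (pos x = K + 1 ∧ pos y = K + N) ∨ C x y)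
    (nc : ∀ x y z w, K < pos x → K < pos y → K < pos z → K < pos w → E x y → E z w → C x y → C z w →
      pos x < pos z → pos z < pos y → pos y < pos w → False)
    (sep : ∀ x y q v q' v', K < pos x → K < pos y → E x y → C x y → J v → J v' → K < pos q → K < pos q' →
      E v q → E v' q' → pos x < pos q → pos q < pos y → (pos q' < pos x ∨ pos y < pos q') → False) :
    (∀ x y z w, K < pos x → K < pos y → K < pos z → K < pos w → E x y → E z w → x ≠ z → x ≠ w → y ≠ z → y ≠ w →
      dl rk x z + dl rk y z + dl rk x w + dl rk y w = 0) ∧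
    (∀ x y q v q' v', K < pos x → K < pos y → E x y → J v → J v' → K < pos q → K < pos q' → E v q → E v' q' →
      q ≠ x → q ≠ y → q' ≠ x → q' ≠ y → dl rk x q + dl rk y q = dl rk x q' + dl rk y q') := by
  have hd : ∀ x y, K < pos x → K < pos y → dl rk x y = if pos x < pos y then 1 else 0 := by
    intro x y hx hy
    have := hrk x hx; have := hrk y hy
    unfold dl
    split_ifs <;> first | omega | rfl
  have pne : ∀ {x y}, x ≠ y → pos x ≠ pos y := fun h h' => h (pinj _ _ h')
  have il : ∀ x y z w, K < pos x → K < pos y → K < pos z → K < pos w → E x y → E z w → pos x < pos y →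
      pos z < pos w → pos x < pos z → pos z < pos y → pos y < pos w → False := by
    intro x y z w hx hy hz hw e e' l1 l2 l3 l4 l5
    have := bd w
    rcases shape x y hx hy e l1 with h | h | h
    · omega
    · omega
    rcases shape z w hz hw e' l2 with h' | h' | h'
    · omega
    · omega
    exact nc x y z w hx hy hz hw e e' h h' l3 l4 l5
  have key : ∀ x y z w, K < pos x → K < pos y → K < pos z → K < pos w → E x y → E z w → pos x < pos y →
      pos z < pos w → x ≠ z → x ≠ w → y ≠ z → y ≠ w →
      dl rk x z + dl rk y z + dl rk x w + dl rk y w = 0 := by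
    intro x y z w hx hy hz hw e e' l1 l2 n1 n2 n3 n4
    have a1 : ¬ (pos x < pos z ∧ pos z < pos y ∧ pos y < pos w) := fun h =>
      il x y z w hx hy hz hw e e' l1 l2 h.1 h.2.1 h.2.2
    have a2 : ¬ (pos z < pos x ∧ pos x < pos w ∧ pos w < pos y) := fun h =>
      il z w x y hz hw hx hy e' e l2 l1 h.1 h.2.1 h.2.2
    have b1 := pne n1; have b2 := pne n2; have b3 := pne n3; have b4 := pne n4
    rw [hd x z hx hz, hd y z hy hz, hd x w hx hw, hd y w hy hw]
    clear il shape nc sep hd pne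
    split_ifs <;> first | omega | decide
  have key2 : ∀ x y q v q' v', K < pos x → K < pos y → E x y → pos x < pos y → J v → J v' → K < pos q → K < pos q' →
      E v q → E v' q' → q ≠ x → q ≠ y → q' ≠ x → q' ≠ y → dl rk x q + dl rk y q = dl rk x q' + dl rk y q' := by
    intro x y q v q' v' hx hy e l1 jv jv' hq hq' f f' n1 n2 n3 n4
    have b1 := pne n1; have b2 := pne n2; have b3 := pne n3; have b4 := pne n4
    rw [hd x q hx hq, hd y q hy hq, hd x q' hx hq', hd y q' hy hq']
    have := bd q; have := bd q'
    rcases shape x y hx hy e l1 with h | h | h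
    · clear shape nc sep hd pne il key
      split_ifs <;> first | omega | decide
    · clear shape nc sep hd pne il key
      split_ifs <;> first | omega | decide
    · have s1 : ¬ (pos x < pos q ∧ pos q < pos y ∧ (pos q' < pos x ∨ pos y < pos q')) := fun hh =>
        sep x y q v q' v' hx hy e h jv jv' hq hq' f f' hh.1 hh.2.1 hh.2.2
      have s2 : ¬ (pos x < pos q' ∧ pos q' < pos y ∧ (pos q < pos x ∨ pos y < pos q)) := fun hh =>
        sep x y q' v' q v hx hy e h jv' jv hq' hq f' f hh.1 hh.2.1 hh.2.2
      clear shape nc sep hd pne il key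
      split_ifs <;> first | omega | decide
  constructor
  · intro x y z w hx hy hz hw e e' n1 n2 n3 n4
    by_cases hxy : x = y
    · subst hxy
      generalize dl rk x z = a
      generalize dl rk x w = b
      revert a b; decide
    by_cases hzw : z = w
    · subst hzw
      generalize dl rk x z = a
      generalize dl rk y z = b
      revert a b; decide
    rcases lt_or_gt_of_ne (pne hxy) with c | c <;> rcases lt_or_gt_of_ne (pne hzw) with d | d
    · exact key x y z w hx hy hz hw e e' c d n1 n2 n3 n4
    · linear_combination key x y w z hx hy hw hz e (sym _ _ e') c d n2 n1 n4 n3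
    · linear_combination key y x z w hy hx hz hw (sym _ _ e) e' c d n3 n4 n1 n2
    · linear_combination key y x w z hy hx hw hz (sym _ _ e) (sym _ _ e') c d n4 n3 n2 n1
  · intro x y q v q' v' hx hy e jv jv' hq hq' f f' n1 n2 n3 n4
    by_cases hxy : x = y
    · subst hxy
      generalize dl rk x q = a
      generalize dl rk x q' = b
      revert a b; decide
    rcases lt_or_gt_of_ne (pne hxy) with c | c
    · exact key2 x y q v q' v' hx hy e c jv jv' hq hq' f f' n1 n2 n3 n4
    · linear_combination key2 y x q v q' v' hy hx (sym _ _ e) c jv jv' hq hq' f f' n2 n1 n4 n3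

open Classical in
theorem spoke_base {V : Type*} {N : ℤ} {T : V → ℤ → Prop} (per : ∀ x p, T x p → T x (p + N))
    {W : V → V → Prop} {J : V → Prop} {g : ℤ} (g0 : 0 ≤ g) (g1 : g < N)
    (H : ∀ x p, J x → T x p → g ≤ p → p < g + N →
      (∀ y q, W y x → T y q → g ≤ q → q < g + N → q ≠ p → p < q) ∨
      (∀ y q, W y x → T y q → g ≤ q → q < g + N → q ≠ p → q < p)) :
    ∃ α β : V → ℤ → ZMod 2, ∀ x y p q, J x → W y x → 0 ≤ p → p < N → 0 ≤ q → q < N → T x p → T y q → p ≠ q →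
      (if p < q then (1 : ZMod 2) else 0) = α x p + β y q := by
  obtain ⟨sh, hsh⟩ : ∃ sh : ℤ → ℤ, ∀ p, (p < g ∧ sh p = p + N) ∨ (g ≤ p ∧ sh p = p) := by
    refine ⟨fun p => if p < g then p + N else p, fun p => ?_⟩
    by_cases h : p < g
    · left; exact ⟨h, if_pos h⟩
    · right; exact ⟨by omega, if_neg h⟩
  have tsh : ∀ x p, T x p → T x (sh p) := by
    intro x p h
    rcases hsh p with ⟨_, e⟩ | ⟨_, e⟩ <;> rw [e]
    · exact per _ _ h
    · exact h
  refine ⟨fun x p => (if (∀ y q, W y x → T y q → g ≤ q → q < g + N → q ≠ sh p → sh p < q) then 1 else 0) +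
    (if p < g then 1 else 0), fun y q => if q < g then 1 else 0, ?_⟩
  intro x y p q hx hy p0 p1 q0 q1 tp tq hne
  have hp := hsh p
  have hq := hsh q
  beta_reduce
  by_cases hall : ∀ y q, W y x → T y q → g ≤ q → q < g + N → q ≠ sh p → sh p < q
  · have := hall y (sh q) hy (tsh _ _ tq) (by omega) (by omega) (by omega)
    rw [if_pos hall]
    clear H hall
    split_ifs <;> first | omega | decide
  · have := (H x (sh p) hx (tsh _ _ tp) (by omega) (by omega)).resolve_left hall y (sh q) hy (tsh _ _ tq)
      (by omega) (by omega) (by omega)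
    rw [if_neg hall]
    clear H hall
    split_ifs <;> first | omega | decide

theorem spoke {V : Type*} {N : ℤ} (hN : 0 < N) {T : V → ℤ → Prop} (per : ∀ x, Function.Periodic (T x) N)
    {W : V → V → Prop} {J : V → Prop} {g : ℤ}
    (H : ∀ x p, J x → T x p → g ≤ p → p < g + N →
      (∀ y q, W y x → T y q → g ≤ q → q < g + N → q ≠ p → p < q) ∨
      (∀ y q, W y x → T y q → g ≤ q → q < g + N → q ≠ p → q < p)) :
    ∃ α β : V → ℤ → ZMod 2, ∀ x y p q, J x → W y x → 0 ≤ p → p < N → 0 ≤ q → q < N → T x p → T y q → p ≠ q →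
      (if p < q then (1 : ZMod 2) else 0) = α x p + β y q := by
  have hg : N * (g / N) + g % N = g := Int.mul_ediv_add_emod g N
  have tr : ∀ x p, T x p → T x (p + N * (g / N)) := by
    intro x p h
    have := (per x).int_mul (g / N) p
    rw [mul_comm, Int.cast_id] at this
    rwa [this]
  refine spoke_base (T := T) (fun x p h => by rwa [per x p]) (g := g % N) (Int.emod_nonneg _ (by omega))
    (Int.emod_lt_of_pos _ hN) (W := W) (J := J) ?_
  intro x p hx tp p0 p1
  rcases H x _ hx (tr x p tp) (by omega) (by omega) with h | h
  · left
    intro y q hy tq q0 q1 hne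
    have := h y _ hy (tr y q tq) (by omega) (by omega) (by omega)
    omega
  · right
    intro y q hy tq q0 q1 hne
    have := h y _ hy (tr y q tq) (by omega) (by omega) (by omega)
    omega

namespace Rg
variable {V : Type*} {G : SimpleGraph V} (D : Rg G)

theorem rper : Function.Periodic D.r D.N := D.per

theorem exists_pos : ∃ pos : V → ℤ, (∀ j, 0 ≤ j → j ≤ D.k → pos (D.l j) = j) ∧
    (∀ z, 0 ≤ pos z ∧ pos z < D.k + 1 + D.N) ∧ (∀ z, pos z ≤ D.k → z = D.l (pos z)) ∧
    (∀ z, D.k < pos z → z = D.r (pos z - (D.k + 1))) := by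
  have hp := D.pos
  have : ∀ z, ∃ n, (0 ≤ n ∧ n ≤ D.k ∧ z = D.l n) ∨ (D.k < n ∧ n < D.k + 1 + D.N ∧ z = D.r (n - (D.k + 1))) := by
    intro z
    rcases D.cov z with ⟨j, h1, h2, h3⟩ | ⟨p, h⟩
    · exact ⟨j, Or.inl ⟨h1, h2, h3⟩⟩
    · have h1 := Int.emod_nonneg p (show D.N ≠ 0 by omega)
      have h2 := Int.emod_lt_of_pos p (show 0 < D.N by omega)
      have h4 : D.N * (p / D.N) + p % D.N = p := Int.mul_ediv_add_emod p D.N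
      refine ⟨p % D.N + (D.k + 1), Or.inr ⟨by omega, by omega, ?_⟩⟩
      rw [add_sub_cancel_right, h]
      have := D.rper.int_mul (p / D.N) (p % D.N)
      rw [mul_comm, Int.cast_id, add_comm, h4] at this
      exact this
  choose pos hpos using this
  refine ⟨pos, fun j h1 h2 => ?_, fun z => ?_, fun z hz => ?_, fun z hz => ?_⟩
  · rcases hpos (D.l j) with ⟨h3, h4, h5⟩ | ⟨h3, h4, h5⟩
    · by_contra hne
      rcases lt_or_gt_of_ne hne with h | h
      · exact D.linj _ _ h3 h h2 h5.symm
      · exact D.linj _ _ h1 h h4 h5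
    · exact (D.lr _ _ h1 h2 h5).elim
  · rcases hpos z with h | h <;> omega
  · rcases hpos z with ⟨h3, h4, h5⟩ | h
    · exact h5
    · omega
  · rcases hpos z with h | ⟨h3, h4, h5⟩
    · omega
    · exact h5

theorem att (h3 : KConnected G 3) (hG : HFree G) {i : ℤ} (hi : 0 ≤ i) (hi' : i < D.k) : ∃ t, G.Adj (D.l i) (D.r t) := by
  rcases hi.eq_or_lt with rfl | h0
  · exact ⟨_, D.a1⟩
  obtain ⟨w, h, n1, n2⟩ := deg3 h3 (x := D.l i) (a := D.l (i - 1)) (b := D.l (i + 1))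
    (D.linj (i - 1) i (by omega) (by omega) (by omega)).symm (D.linj i (i + 1) (by omega) (by omega) (by omega))
  rcases D.cov w with ⟨j, h1, h2, rfl⟩ | ⟨p, rfl⟩
  · exfalso
    have c1 : j ≠ i - 1 := fun h => n1 (by rw [h])
    have c2 : j ≠ i + 1 := fun h => n2 (by rw [h])
    have c3 : j ≠ i := fun h' => h.ne (by rw [h'])
    rcases lt_or_ge j i with c | c
    · exact noLL (D := D) hG (a := j) (b := i) (by omega) (by omega) (by omega) h.symm
    · exact noLL (D := D) hG (a := i) (b := j) (by omega) (by omega) (by omega) h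
  · exact ⟨p, h⟩

theorem ordI (h3 : KConnected G 3) (hG : HFree G) {i : ℤ} (hi : 0 ≤ i) (hi' : i < D.k) :
    ∃ g, ∀ j p, 0 ≤ j → j ≤ i → G.Adj (D.l j) (D.r p) → g ≤ p → p < g + D.N →
      (∀ m q, 0 ≤ m → m < j → G.Adj (D.l m) (D.r q) → g ≤ q → q < g + D.N → q ≠ p → p < q) ∨
      (∀ m q, 0 ≤ m → m < j → G.Adj (D.l m) (D.r q) → g ≤ q → q < g + D.N → q ≠ p → q < p) := by
  obtain ⟨t, ht⟩ := D.att h3 hG hi hi'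
  exact (D.os hG hi hi').order (t := t) ht

theorem ordO (h3 : KConnected G 3) (hG : HFree G) {i : ℤ} (hi : 0 ≤ i) (hi' : i < D.k) :
    ∃ g, ∀ j p, i < j → j ≤ D.k → G.Adj (D.l j) (D.r p) → g ≤ p → p < g + D.N →
      (∀ m q, j < m → m ≤ D.k → G.Adj (D.l m) (D.r q) → g ≤ q → q < g + D.N → q ≠ p → p < q) ∨
      (∀ m q, j < m → m ≤ D.k → G.Adj (D.l m) (D.r q) → g ≤ q → q < g + D.N → q ≠ p → q < p) := by
  have hr := D.rotF
  have hp := D.pos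
  obtain ⟨g, hg⟩ := D.rot.ordI h3 hG (i := D.k - i - 1) (by omega) (by omega)
  refine ⟨g + D.β, fun j p h1 h2 e g1 g2 => ?_⟩
  rcases hg (D.k - j) (p - D.β) (by omega) (by omega) (rotT e (by omega) (by omega)) (by omega) (by omega) with h | h
  · left
    intro m q m1 m2 f q1 q2 hne
    have := h (D.k - m) (q - D.β) (by omega) (by omega) (rotT f (by omega) (by omega)) (by omega) (by omega) (by omega)
    omega
  · right
    intro m q m1 m2 f q1 q2 hne
    have := h (D.k - m) (q - D.β) (by omega) (by omega) (rotT f (by omega) (by omega)) (by omega) (by omega) (by omega)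
    omega

end Rg

open SimpleGraph

namespace Rg
variable {V : Type*} {G : SimpleGraph V} (D : Rg G)

theorem llAdj (hG : HFree G) {a b : ℤ} (ha : 0 ≤ a) (ha' : a ≤ D.k) (hb : 0 ≤ b) (hb' : b ≤ D.k)
    (e : G.Adj (D.l a) (D.l b)) : a = b + 1 ∨ b = a + 1 := by
  have hne : a ≠ b := fun h => e.ne (by rw [h])
  have h1 : ¬ a + 2 ≤ b := fun h => noLL (D := D) hG ha h hb' e
  have h2 : ¬ b + 2 ≤ a := fun h => noLL (D := D) hG hb h ha' e.symm
  omega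

theorem planar_del (h3 : KConnected G 3) (hG : HFree G) {i : ℤ} (hi : 0 ≤ i) (hi' : i < D.k) :
    Planar (G.deleteEdges {s(D.l i, D.l (i + 1))}) := by
  classical
  have hp := D.pos
  obtain ⟨pos, pl, bd, el, er⟩ := D.exists_pos
  have pinj : ∀ x y, pos x = pos y → x = y := by
    intro x y h
    rcases le_or_gt (pos x) D.k with c | c
    · rw [el x c, el y (by omega), h]
    · rw [er x c, er y (by omega), h]
  obtain ⟨rk, hrk⟩ : ∃ rk : V → ℕ, ∀ z, (pos z ≤ i ∧ (rk z : ℤ) = i - pos z) ∨ (i < pos z ∧ (rk z : ℤ) = pos z) := by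
    refine ⟨fun z => if pos z ≤ i then (i - pos z).toNat else (pos z).toNat, fun z => ?_⟩
    have := bd z
    by_cases h : pos z ≤ i
    · refine Or.inl ⟨h, ?_⟩
      simp only [h, if_true]
      omega
    · refine Or.inr ⟨by omega, ?_⟩
      simp only [h, if_false]
      omega
  have inj : Function.Injective rk := by
    intro x y h
    have := hrk x; have := hrk y; have := bd x; have := bd y
    exact pinj x y (by omega)
  have hrR : ∀ x, D.k < pos x → (rk x : ℤ) = pos x := fun x hx => by have := hrk x; omega
  have hd : ∀ x y, D.k < pos x → D.k < pos y → dl rk x y = if pos x - (D.k + 1) < pos y - (D.k + 1) then 1 else 0 := by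
    intro x y hx hy
    have := hrR x hx; have := hrR y hy
    unfold dl
    split_ifs <;> first | omega | rfl
  have hN : 0 < D.N := by omega
  have perT : ∀ x : V, Function.Periodic (fun p => G.Adj x (D.r p)) D.N := fun x p => by
    change G.Adj x (D.r (p + D.N)) = G.Adj x (D.r p)
    rw [D.per]
  let C : V → V → Prop := fun x y => D.CA (pos x - (D.k + 1)) (pos y - (D.k + 1)) ∨
    D.CA (pos y - (D.k + 1)) (pos x - (D.k + 1))
  have Csymm : ∀ {x y}, C x y → C y x := fun h => h.symm
  have hCdef : ∀ x y, pos x < pos y → C x y → D.CA (pos x - (D.k + 1)) (pos y - (D.k + 1)) := by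
    intro x y hxy h
    rcases h with h | h
    · exact h
    · exfalso
      unfold CA at h
      omega
  let Ei : V → V → Prop := fun x y => G.Adj x y ∧ (pos x ≤ i ∨ D.k < pos x) ∧ (pos y ≤ i ∨ D.k < pos y) ∧
    (D.k < pos x → D.k < pos y → ¬ C x y)
  let Eo : V → V → Prop := fun x y => G.Adj x y ∧ i < pos x ∧ i < pos y ∧ (D.k < pos x → D.k < pos y → C x y)
  have symi : ∀ x y, Ei x y → Ei y x := fun x y h =>
    ⟨h.1.symm, h.2.2.1, h.2.1, fun a b c => h.2.2.2 b a (Csymm c)⟩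
  have symo : ∀ x y, Eo x y → Eo y x := fun x y h =>
    ⟨h.1.symm, h.2.2.1, h.2.1, fun a b => Csymm (h.2.2.2 b a)⟩
  have eR : ∀ x y, D.k < pos x → D.k < pos y → G.Adj x y → G.Adj (D.r (pos x - (D.k + 1))) (D.r (pos y - (D.k + 1))) := by
    intro x y hx hy e
    rwa [← er x hx, ← er y hy]
  have eS : ∀ x y, pos x ≤ D.k → D.k < pos y → G.Adj x y → G.Adj (D.l (pos x)) (D.r (pos y - (D.k + 1))) := by
    intro x y hx hy e
    rwa [← er y hy, ← el x hx]
  have eL : ∀ x y, pos x ≤ D.k → pos y ≤ D.k → G.Adj x y → pos x = pos y + 1 ∨ pos y = pos x + 1 := by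
    intro x y hx hy e
    refine D.llAdj hG (bd x).1 hx (bd y).1 hy ?_
    rwa [← el x hx, ← el y hy]
  -- inner side
  obtain ⟨g, hg⟩ := D.ordI h3 hG hi hi'
  obtain ⟨α, β, hαβ⟩ := spoke hN perT (W := fun y x => pos y < pos x) (J := fun x => pos x ≤ i) (g := g) (by
    intro x p hx e g1 g2
    have hx' := el x (by omega)
    rcases hg (pos x) p (bd x).1 hx (by rwa [← hx']) g1 g2 with h | h
    · left
      intro y q hy f
      exact h (pos y) q (bd y).1 hy (by rwa [← el y (by omega)])
    · right
      intro y q hy f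
      exact h (pos y) q (bd y).1 hy (by rwa [← el y (by omega)]))
  obtain ⟨rri, sei⟩ := ring_part (V := V) (pos := pos) (rk := rk) (K := D.k) (N := D.N) (E := Ei)
    (C := fun x y => D.CB (pos x - (D.k + 1)) (pos y - (D.k + 1))) (J := fun v => pos v ≤ i) pinj hrR
    (fun x => (bd x).2) symi
    (by
      intro x y hx hy e hxy
      have b1 := bd x; have b2 := bd y
      by_cases c1 : pos y = pos x + 1
      · exact Or.inl c1
      by_cases c2 : pos x = D.k + 1 ∧ pos y = D.k + D.N
      · exact Or.inr (Or.inl c2)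
      refine Or.inr (Or.inr ?_)
      exact (D.chord hG (by omega) (by omega) (by omega) (by omega) (eR x y hx hy e.1)).resolve_left
        fun h => e.2.2.2 hx hy (Or.inl h))
    (by
      intro x y z w hx hy hz hw e e' c c' l1 l2 l3
      exact D.ncB hG c c' (eR x y hx hy e.1) (eR z w hz hw e'.1) (by omega) (by omega) (by omega))
    (by
      intro x y q v q' v' hx hy e c jv jv' hq hq' f f' l1 l2 l3
      have b1 := bd v; have b2 := bd v'; have b3 := bd q'
      exact D.sepB hG c (eR x y hx hy e.1) (j := pos v) (j' := pos v') (by omega) (by omega)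
        (s := pos q - (D.k + 1)) (s' := pos q' - (D.k + 1)) (by omega) (by omega)
        (eS v q (by omega) hq f.1) (eS v' q' (by omega) hq' f'.1))
  obtain ⟨ψ, p0, hψ⟩ := side_cert (E := Ei) (I := fun x => pos x ≤ i) (R := fun x => D.k < pos x) (f := pos) (rk := rk)
    inj (fun x h => by omega) (fun x y h => ⟨h.2.1, h.2.2.1⟩) symi
    (fun x y hx hy h => eL x y (by omega) (by omega) h.1) (fun x y _ _ h => pinj x y h)
    (fun x y hx hy h => by have := hrk x; have := hrk y; omega)
    (fun x y hx hy => by have := hrk x; have := hrk y; have := bd x; omega)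
    ⟨fun x p => α x (pos p - (D.k + 1)), fun y q => β y (pos q - (D.k + 1)), by
      intro x y p q hx hy hp hq e f hlt hne
      have b1 := bd p; have b2 := bd q
      rw [hd p q hp hq]
      refine hαβ x y _ _ hx hlt (by omega) (by omega) (by omega) (by omega) ?_ ?_ ?_
      · show G.Adj x _
        rw [← er p hp]; exact e.1
      · show G.Adj y _
        rw [← er q hq]; exact f.1
      · intro h
        exact hne (pinj _ _ (by omega))⟩
    rri sei
  -- outer side
  obtain ⟨g', hg'⟩ := D.ordO h3 hG hi hi'
  obtain ⟨α', β', hαβ'⟩ := spoke hN perT (W := fun y x => pos x < pos y ∧ pos y ≤ D.k)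
    (J := fun x => i < pos x ∧ pos x ≤ D.k) (g := g') (by
    intro x p hx e g1 g2
    have hx' := el x hx.2
    rcases hg' (pos x) p hx.1 hx.2 (by rwa [← hx']) g1 g2 with h | h
    · left
      intro y q hy f
      exact h (pos y) q hy.1 hy.2 (by rwa [← el y hy.2])
    · right
      intro y q hy f
      exact h (pos y) q hy.1 hy.2 (by rwa [← el y hy.2]))
  obtain ⟨rro, seo⟩ := ring_part (V := V) (pos := pos) (rk := rk) (K := D.k) (N := D.N) (E := Eo)
    (C := fun x y => D.CA (pos x - (D.k + 1)) (pos y - (D.k + 1))) (J := fun v => i < pos v ∧ pos v ≤ D.k) pinj hrR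
    (fun x => (bd x).2) symo
    (fun x y hx hy e hxy => Or.inr (Or.inr (hCdef x y hxy (e.2.2.2 hx hy))))
    (by
      intro x y z w hx hy hz hw e e' c c' l1 l2 l3
      exact D.ncA hG c c' (eR x y hx hy e.1) (eR z w hz hw e'.1) (by omega) (by omega) (by omega))
    (by
      intro x y q v q' v' hx hy e c jv jv' hq hq' f f' l1 l2 l3
      have b1 := bd v; have b2 := bd v'; have b3 := bd q'
      exact D.sepA hG c (eR x y hx hy e.1) (j := pos v) (j' := pos v') (by omega) (by omega)
        (s := pos q - (D.k + 1)) (s' := pos q' - (D.k + 1)) (by omega) (by omega)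
        (eS v q (by omega) hq f.1) (eS v' q' (by omega) hq' f'.1))
  obtain ⟨ψ', p0', hψ'⟩ := side_cert (E := Eo) (I := fun x => i < pos x ∧ pos x ≤ D.k) (R := fun x => D.k < pos x)
    (f := fun x => - pos x) (rk := rk)
    inj (fun x h => by omega)
    (fun x y h => ⟨(le_or_gt (pos x) D.k).imp (fun a => ⟨h.2.1, a⟩) id, (le_or_gt (pos y) D.k).imp (fun a => ⟨h.2.2.1, a⟩) id⟩) symo
    (fun x y hx hy h => by have := eL x y hx.2 hy.2 h.1; omega) (fun x y _ _ h => pinj x y (by omega))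
    (fun x y hx hy h => by have := hrk x; have := hrk y; omega)
    (fun x y hx hy => by have := hrk x; have := hrk y; omega)
    ⟨fun x p => α' x (pos p - (D.k + 1)), fun y q => β' y (pos q - (D.k + 1)), by
      intro x y p q hx hy hp hq e f hlt hne
      have b1 := bd p; have b2 := bd q
      rw [hd p q hp hq]
      refine hαβ' x y _ _ hx ⟨by omega, hy.2⟩ (by omega) (by omega) (by omega) (by omega) ?_ ?_ ?_
      · show G.Adj x _
        rw [← er p hp]; exact e.1
      · show G.Adj y _
        rw [← er q hq]; exact f.1
      · intro h
        exact hne (pinj _ _ (by omega))⟩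
    rro seo
  refine planar_of_cert inj (glue_cert (Ei := Ei) (Eo := Eo) (I := fun x => pos x ≤ i)
    (O := fun x => i < pos x ∧ pos x ≤ D.k) inj ?_ ?_ ?_ p0 p0' hψ hψ')
  · intro x y e
    rw [SimpleGraph.deleteEdges_adj, Set.mem_singleton_iff] at e
    obtain ⟨e, hne⟩ := e
    have cross : ∀ a b, G.Adj a b → pos a ≤ i → i < pos b → pos b ≤ D.k → s(a, b) = s(D.l i, D.l (i + 1)) := by
      intro a b e h1 h2 h4
      have := eL a b (by omega) h4 e
      have ea := el a (by omega)
      have eb := el b h4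
      rw [show pos a = i by omega] at ea
      rw [show pos b = i + 1 by omega] at eb
      rw [ea, eb]
    by_cases c1 : pos x ≤ i
    · by_cases c2 : i < pos y ∧ pos y ≤ D.k
      · exact (hne (cross x y e c1 c2.1 c2.2)).elim
      · exact Or.inl ⟨e, Or.inl c1, by omega, fun h => by omega⟩
    by_cases c3 : pos y ≤ i
    · by_cases c2 : pos x ≤ D.k
      · exact (hne (by rw [Sym2.eq_swap]; exact cross y x e.symm c3 (by omega) c2)).elim
      · exact Or.inl ⟨e, by omega, Or.inl c3, fun _ h => by omega⟩
    by_cases c4 : D.k < pos x ∧ D.k < pos y ∧ ¬ C x y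
    · exact Or.inl ⟨e, Or.inr c4.1, Or.inr c4.2.1, fun _ _ => c4.2.2⟩
    · refine Or.inr ⟨e, by omega, by omega, fun h h' => ?_⟩
      by_contra h''
      exact c4 ⟨h, h', h''⟩
  · intro x y h
    have h1 := h.2.1; have h2 := h.2.2.1
    exact ⟨by omega, by omega⟩
  · intro x y h
    have h1 := h.2.1; have h2 := h.2.2.1
    exact ⟨by omega, by omega⟩

end Rg

open SimpleGraph

section build
variable {V : Type*} {G : SimpleGraph V}

theorem getD_mem {L : List V} {n : ℕ} {d : V} (h : n < L.length) : L.getD n d ∈ L := by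
  rw [List.getD_eq_getElem _ _ h]; exact List.getElem_mem h

theorem getD_inj {L : List V} (hL : L.Nodup) {a b : ℕ} {d : V} (ha : a < L.length) (hb : b < L.length)
    (h : L.getD a d = L.getD b d) : a = b := by
  rw [List.getD_eq_getElem _ _ ha, List.getD_eq_getElem _ _ hb] at h
  exact (hL.getElem_inj_iff).1 h

theorem getD_of_mem {L : List V} {z d : V} (h : z ∈ L) : ∃ n, n < L.length ∧ z = L.getD n d := by
  obtain ⟨n, hn, rfl⟩ := List.getElem_of_mem h
  exact ⟨n, hn, (List.getD_eq_getElem _ _ hn).symm⟩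

theorem chain_getD {L : List V} (hL : List.IsChain G.Adj L) {n : ℕ} {d : V} (h : n + 1 < L.length) :
    G.Adj (L.getD n d) (L.getD (n + 1) d) := by
  rw [List.getD_eq_getElem _ _ h, List.getD_eq_getElem _ _ (by omega)]
  exact List.isChain_iff_getElem.1 hL n h

theorem exists_rg {L R : List V} {d : V} {k N b c e : ℕ} (hk : L.length = k + 1) (hk2 : 2 ≤ k) (hN : R.length = N)
    (hb : 0 < b) (hc : b < c) (he : c < e) (heN : e < N) (cL : List.IsChain G.Adj L)
    (cR : List.IsChain G.Adj (R ++ [R.getD 0 d])) (nL : L.Nodup) (nR : R.Nodup) (disj : ∀ z ∈ L, z ∉ R)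
    (cov : ∀ z, z ∈ L ∨ z ∈ R) (a1 : G.Adj (L.getD 0 d) (R.getD b d)) (a2 : G.Adj (L.getD 0 d) (R.getD e d))
    (a3 : G.Adj (L.getD k d) (R.getD 0 d)) (a4 : G.Adj (L.getD k d) (R.getD c d)) :
    ∃ D : Rg G, D.k = k ∧ ∀ n : ℕ, D.l n = L.getD n d := by
  have hNpos : (0 : ℤ) < N := by omega
  have mod0 : ∀ p : ℤ, 0 ≤ p % N := fun p => Int.emod_nonneg p (by omega)
  have mod1 : ∀ p : ℤ, p % N < N := fun p => Int.emod_lt_of_pos p hNpos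
  have cR1 : ∀ n, n + 1 < N → G.Adj (R.getD n d) (R.getD (n + 1) d) := fun n hn => by
    exact chain_getD cR.left_of_append (by omega)
  have cR2 : G.Adj (R.getD (N - 1) d) (R.getD 0 d) := by
    have := chain_getD cR (n := N - 1) (d := d) (by simp; omega)
    rw [show N - 1 + 1 = R.length by omega, List.getD_append_right _ _ _ _ le_rfl,
      List.getD_append _ _ _ _ (by omega)] at this
    simpa using this
  refine ⟨{ k := k, N := N, β := b, γ := c, δ := e, l := fun j => L.getD j.toNat d,
            r := fun p => R.getD (p % N).toNat d,
            hk := by omega, hβ := by omega, hγ := by omega, hδ := by omega, hN := by omega,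
            lad := ?_, rad := ?_, per := ?_, linj := ?_, rinj := ?_, lr := ?_, cov := ?_,
            a1 := ?_, a2 := ?_, a3 := ?_, a4 := ?_ }, rfl, fun n => rfl⟩
  · intro j h0 h1
    rw [show (j + 1).toNat = j.toNat + 1 by omega]
    exact chain_getD cL (by omega)
  · intro p
    have h0 := mod0 p; have h1 := mod1 p
    by_cases h : p % N + 1 = N
    · have : (p + 1) % N = 0 := by
        rw [← Int.emod_add_emod, h, Int.emod_self]
      rw [this, show (p % N).toNat = N - 1 by omega]
      exact cR2
    · have : (p + 1) % N = p % N + 1 := by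
        rw [← Int.emod_add_emod]; exact Int.emod_eq_of_lt (by omega) (by omega)
      rw [this, show (p % N + 1).toNat = (p % N).toNat + 1 by omega]
      exact cR1 _ (by omega)
  · intro p
    simp only [Int.add_emod_right]
  · intro x y h0 h1 h2 h
    have := getD_inj nL (by omega) (by omega) h
    omega
  · intro p q h0 h1 h
    have a0 := mod0 p; have a1 := mod1 p; have b0 := mod0 q; have b1 := mod1 q
    have := getD_inj nR (by omega) (by omega) h
    have h2 : (q - p) % N = 0 := Int.emod_eq_zero_of_dvd (Int.ModEq.dvd (show p % N = q % N by omega))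
    rw [Int.emod_eq_of_lt (by omega) (by omega)] at h2
    omega
  · intro j p h0 h1 h
    have a0 := mod0 p; have a1 := mod1 p
    exact disj (L.getD j.toNat d) (getD_mem (by omega)) (by rw [h]; exact getD_mem (by omega))
  · intro z
    rcases cov z with h | h
    · obtain ⟨n, hn, rfl⟩ := getD_of_mem (d := d) h
      exact Or.inl ⟨n, by omega, by omega, by simp⟩
    · obtain ⟨n, hn, rfl⟩ := getD_of_mem (d := d) h
      refine Or.inr ⟨n, ?_⟩
      rw [Int.emod_eq_of_lt (by omega) (by omega)]
      simp
  · rw [Int.emod_eq_of_lt (by omega) (by omega)]; simpa using a1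
  · rw [Int.emod_eq_of_lt (by omega) (by omega)]; simpa using a2
  · rw [Int.emod_eq_of_lt (by omega) (by omega)]; simpa using a3
  · rw [Int.emod_eq_of_lt (by omega) (by omega)]; simpa using a4

theorem pair_getD {L : List V} {u v d : V} (h : [u, v] <:+: L) :
    ∃ n, n + 1 < L.length ∧ L.getD n d = u ∧ L.getD (n + 1) d = v := by
  obtain ⟨s, t, rfl⟩ := h
  refine ⟨s.length, by simp, ?_, ?_⟩
  · rw [List.append_assoc, List.getD_append_right _ _ _ _ le_rfl]; simp
  · rw [List.append_assoc, List.getD_append_right _ _ _ _ (by omega)]; simp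

theorem getD_mid {l1 l2 : List V} {x d : V} {n : ℕ} (h : n = l1.length) : (l1 ++ x :: l2).getD n d = x := by
  rw [List.getD_append_right _ _ _ _ (by omega), h]; simp

theorem Opt.rg [Finite V] (h3 : KConnected G 3) (hG : HFree G) {u v : V} {D : Dat V} (h : Opt G u v D) :
    ∃ (W : Rg G) (i : ℤ), 0 ≤ i ∧ i < W.k ∧ s(W.l i, W.l (i + 1)) = s(u, v) := by
  obtain ⟨n1, n2, n3, n4⟩ := h.nil h3 hG
  have hs := h.good.sub
  have b1 := hs.h1b; have b2 := hs.h1c; have b3 := hs.h2a; have b4 := hs.h3a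
  rw [n1, pth_nil] at b1
  rw [n2, pth_nil] at b2
  rw [n3, pth_nil] at b3
  rw [n4, pth_nil] at b4
  have cnt := hs.cnt
  simp only [n1, n2, n3, n4, ctn_nil] at cnt
  have hlen : 0 < D.p1a.length := List.length_pos_iff.2 h.good.ne
  let L := D.v1 :: (D.p1a ++ [D.va])
  let R := D.v2 :: (D.p2b ++ D.vb :: (D.p3b.reverse ++ D.v3 :: (D.p3c ++ D.vc :: D.p2c.reverse)))
  have cL : ∀ z, ctn L z = one D.v1 z + (ctn D.p1a z + one D.va z) := by
    intro z; simp only [L, ctn_cons, ctn_append, ctn_nil, add_zero]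
  have cR : ∀ z, ctn R z = one D.v2 z + (ctn D.p2b z + (one D.vb z + (ctn D.p3b z + (one D.v3 z + (ctn D.p3c z +
      (one D.vc z + ctn D.p2c z)))))) := by
    intro z; simp only [R, ctn_cons, ctn_append, ctn_reverse]
  have chR : Pth G D.v2 (D.p2b ++ D.vb :: (D.p3b.reverse ++ D.v3 :: (D.p3c ++ D.vc :: D.p2c.reverse))) D.v2 :=
    pth_split.2 ⟨hs.h2b, pth_split.2 ⟨hs.h3b.rev, pth_split.2 ⟨hs.h3c, hs.h2c.rev⟩⟩⟩
  have e0 : R.getD 0 D.v1 = D.v2 := rfl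
  have eb : R.getD (D.p2b.length + 1) D.v1 = D.vb := getD_mid (l1 := D.v2 :: D.p2b) (by simp)
  have ec : R.getD (D.p2b.length + 1 + (D.p3b.length + 1)) D.v1 = D.v3 := by
    have := getD_mid (l1 := D.v2 :: (D.p2b ++ D.vb :: D.p3b.reverse)) (l2 := D.p3c ++ D.vc :: D.p2c.reverse) (x := D.v3)
      (d := D.v1) (n := D.p2b.length + 1 + (D.p3b.length + 1)) (by simp; omega)
    simpa [R] using this
  have ee : R.getD (D.p2b.length + 1 + (D.p3b.length + 1) + (D.p3c.length + 1)) D.v1 = D.vc := by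
    have := getD_mid (l1 := D.v2 :: (D.p2b ++ D.vb :: (D.p3b.reverse ++ D.v3 :: D.p3c))) (l2 := D.p2c.reverse) (x := D.vc)
      (d := D.v1) (n := D.p2b.length + 1 + (D.p3b.length + 1) + (D.p3c.length + 1)) (by simp; omega)
    simpa [R] using this
  have ek : L.getD (D.p1a.length + 1) D.v1 = D.va := getD_mid (l1 := D.v1 :: D.p1a) (by simp)
  obtain ⟨W, hWk, hWl⟩ := exists_rg (G := G) (L := L) (R := R) (d := D.v1) (k := D.p1a.length + 1) (N := R.length)
    (b := D.p2b.length + 1) (c := D.p2b.length + 1 + (D.p3b.length + 1))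
    (e := D.p2b.length + 1 + (D.p3b.length + 1) + (D.p3c.length + 1))
    (by simp [L]) (by omega) rfl (by omega) (by omega) (by omega) (by simp [R]; omega) hs.h1a
    (by rw [e0]; exact chR)
    (nodup_of_ctn fun z => by rw [cL]; have := cnt z; omega)
    (nodup_of_ctn fun z => by rw [cR]; have := cnt z; omega)
    (fun z hz hz' => by
      have h1 := ctn_pos.1 hz; have h2 := ctn_pos.1 hz'
      rw [cL] at h1; rw [cR] at h2
      have := cnt z; omega)
    (fun z => by
      obtain ⟨z', hz⟩ := has_nbr h3 z
      have := hs.span hG hz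
      simp only [n1, n2, n3, n4, ctn_nil] at this
      rw [ctn_pos, ctn_pos, cL, cR]
      omega)
    (by rw [eb]; exact b1) (by rw [ee]; exact b2) (by rw [ek, e0]; exact b3.symm) (by rw [ek, ec]; exact b4.symm)
  have hL : L.length = D.p1a.length + 2 := by simp [L]
  have key : ∀ x y, [x, y] <:+: L → ∃ i, 0 ≤ i ∧ i < W.k ∧ s(W.l i, W.l (i + 1)) = s(x, y) := by
    intro x y hxy
    obtain ⟨n, hn, hx, hy⟩ := pair_getD (d := D.v1) hxy
    refine ⟨n, by omega, by omega, ?_⟩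
    rw [show ((n : ℤ) + 1) = ((n + 1 : ℕ) : ℤ) by simp, hWl, hWl, hx, hy]
  rcases h.good.hE with hE | hE
  · obtain ⟨i, h1⟩ := key _ _ hE
    exact ⟨W, i, h1⟩
  · obtain ⟨i, h1, h2, h4⟩ := key _ _ hE
    exact ⟨W, i, h1, h2, by rw [h4, Sym2.eq_swap]⟩

theorem AP33 [Finite V] (h3 : KConnected G 3) (hG : HFree G) {u v : V} (huv : G.Adj u v)
    (hm : IsMinor K33 (contractEdge G u v)) : Planar (G.deleteEdges {s(u, v)}) := by
  obtain ⟨D, hD⟩ := exists_opt (exists_good h3 hG huv hm)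
  obtain ⟨W, i, h1, h2, h4⟩ := hD.rg h3 hG
  rw [← h4]
  exact W.planar_del h3 hG h1 h2

end build

open SimpleGraph

theorem AP_final {U : Type} [Finite U] (H : SimpleGraph U) (h3 : KConnected H 3)
    (hnp : ¬ Planar H) (hG : HFree H) : AlmostPlanar H := by
  refine ⟨hnp, fun u v huv => ?_⟩
  by_cases hK : IsMinor K33 (contractEdge H u v)
  · exact Or.inl (AP33 h3 hG huv hK)
  by_cases hm : IsMinor K5 (contractEdge H u v)
  · exact Or.inl (AP5 h3 hG huv hK hm)
  · exact Or.inr ⟨hm, hK⟩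

/-- A nonplanar {K5+, K33+, K5h, K33h, K5⊕e, K33⊕e}-free graph `G` has `G*` obtained
from some 3-connected almost-planar `H` by subdividing only edges of `D(H)`. -/
theorem stmt13 {V : Type} [Fintype V] (G : SimpleGraph V) (hnp : ¬ Planar G)
    (hfree : ¬ IsMinor K5plus G ∧ ¬ IsMinor K33plus G ∧ ¬ IsMinor K5h G ∧ ¬ IsMinor K33h G ∧
      ¬ IsMinor K5oplus G ∧ ¬ IsMinor K33oplus G) :
    ∃ (U : Type) (H : SimpleGraph U), KConnected H 3 ∧ AlmostPlanar H ∧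
      IsSubdivisionWithin (G.induce (core G)) H (Dset H) := by
  exact main_reduction (fun H => AP_final H) G hnp hfree
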